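/- Let r ≥ 1 and s ∈ {-1, 1} be integers with Δ := r² + 4s > 0 and Δ not a perfect square, and let (U_n)_{n≥0} be the generalized Lucas sequence with U_0 = 0, U_1 = 1, U_{n+1} = r·U_n + s·U_{n-1}; set δ := (r + √Δ)/2. Let b ≥ 2 be an integer. Suppose k, m, n are positive integers and a is an integer with 1 ≤ a ≤ b−1 satisfying a·(b^k − 1)/(b − 1) = U_n − U_m with n > m. Put D := 1 + n·(log δ)/(log b) and ξ := log(4·b²·Δ·(1 + 3√Δ)) + 2·10^12·(1 + log D)·(log δ)·(log b)·(2·log b + log Δ). Then n·log δ − log(8.1·√Δ) < 2·10^12·(1 + log D)·(log δ)·(log b)·ξ. -/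

import Mathlib

open Finset in
/-- A matrix with trivial kernel has an invertible maximal square submatrix. -/
theorem exists_submatrix_det_ne_zero {P T F : Type*} [Fintype T] [DecidableEq T] [Field F]
    (A : P → T → F) (h : ∀ c : T → F, (∀ p, ∑ t, A p t * c t = 0) → c = 0) :
    ∃ e : T → P, (Matrix.of fun i j => A (e i) j).det ≠ 0 := by
  have hspan : Submodule.span F (Set.range A) = ⊤ := by
    by_contra hne
    obtain ⟨f, hf0, hf⟩ := Submodule.exists_le_ker_of_lt_top _ (lt_top_iff_ne_top.2 hne)
    apply hf0
    have hfe : ∀ v : T → F, f v = ∑ t, v t * f (Pi.single t 1) := by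
      intro v
      conv_lhs => rw [← Finset.univ_sum_single v]
      rw [map_sum]
      refine Finset.sum_congr rfl fun t _ => ?_
      have : (Pi.single t (v t) : T → F) = v t • Pi.single t 1 := by
        ext u; by_cases hu : u = t <;> simp [hu]
      rw [this, map_smul, smul_eq_mul]
    have := h (fun t => f (Pi.single t 1)) (fun p => by
      rw [← hfe]; exact hf (Submodule.subset_span ⟨p, rfl⟩))
    ext t
    simpa using congrFun this t
  obtain ⟨b, hb, hbs, hbi⟩ := exists_linearIndependent F (Set.range A)
  rw [hspan] at hbs
  let B := Module.Basis.mk hbi (by rw [Subtype.range_coe, hbs])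
  have : Fintype b := FiniteDimensional.fintypeBasisIndex B
  have hcard : Fintype.card T = Fintype.card b := by
    rw [← Module.finrank_eq_card_basis B, Module.finrank_fintype_fun_eq_card]
  obtain e₀ := Fintype.equivOfCardEq hcard
  choose g hg using fun x : b => hb x.2
  refine ⟨fun t => g (e₀ t), ?_⟩
  have hrow : LinearIndependent F (Matrix.of fun i j => A (g (e₀ i)) j).row := by
    have h1 := hbi.comp e₀ e₀.injective
    have h2 : (Matrix.of fun i j => A (g (e₀ i)) j).row = Subtype.val ∘ e₀ := by
      ext i j
      simp [Matrix.row, hg]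
    rw [h2]
    exact h1
  have := Matrix.linearIndependent_rows_iff_isUnit.1 hrow
  rw [Matrix.isUnit_iff_isUnit_det] at this
  exact this.ne_zero

open Polynomial Filter Topology in
/-- The determinant of a matrix obtained by translating the entries of a row of nonzero
polynomials is nonzero once the matrix of weights is invertible. -/
theorem det_translate_ne_zero {T : Type*} [Fintype T] [DecidableEq T] (p : T → ℝ[X])
    (hp : ∀ l, p l ≠ 0) (x : T → ℝ) (c : Matrix T T ℝ) (hc : c.det ≠ 0) :
    (Matrix.of fun i l => C (c i l) * (p l).comp (X + C (x i))).det ≠ 0 := by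
  intro h0
  set d := fun l => (p l).natDegree
  have hev : ∀ t : ℝ, (Matrix.of fun i l => c i l * (p l).eval (t + x i)).det = 0 := by
    intro t
    have := congrArg (Polynomial.evalRingHom t) h0
    rw [RingHom.map_det, map_zero] at this
    rw [← this]; congr 1; ext i l
    simp [Polynomial.eval_comp]
  have hscale : ∀ t : ℝ,
      (Matrix.of fun i l => c i l * ((p l).eval (t + x i) / t ^ d l)).det = 0 := by
    intro t
    have := Matrix.det_mul_row (fun l => (t ^ d l)⁻¹)
      (Matrix.of fun i l => c i l * (p l).eval (t + x i))
    rw [hev, mul_zero] at this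
    rw [← this]; congr 1; ext i l
    simp only [Matrix.of_apply]; ring
  have hlim : Tendsto (fun t : ℝ => (Matrix.of fun i l =>
      c i l * ((p l).eval (t + x i) / t ^ d l)).det) atTop
      (𝓝 (Matrix.of fun i l => c i l * (p l).leadingCoeff).det) := by
    have hcont : Continuous fun M : Matrix T T ℝ => M.det := Continuous.matrix_det continuous_id
    refine (hcont.tendsto _).comp ?_
    refine tendsto_pi_nhds.2 fun i => tendsto_pi_nhds.2 fun l => ?_
    simp only [Matrix.of_apply]
    refine Tendsto.const_mul _ ?_
    have h1 := Polynomial.div_tendsto_atTop_leadingCoeff_div_of_degree_eq ((p l).comp (X + C (x i)))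
      (X ^ d l) (by
        rw [Polynomial.degree_X_pow, Polynomial.degree_eq_natDegree]
        · rw [Polynomial.natDegree_comp, Polynomial.natDegree_X_add_C, mul_one]
        · intro h
          rcases Polynomial.comp_eq_zero_iff.1 h with h | h
          · exact hp l h
          · have := congrArg Polynomial.natDegree h.2
            rw [Polynomial.natDegree_X_add_C] at this
            simp at this)
    rw [Polynomial.leadingCoeff_X_pow, div_one, Polynomial.leadingCoeff_comp
      (by rw [Polynomial.natDegree_X_add_C]; exact one_ne_zero),
      Polynomial.leadingCoeff_X_add_C, one_pow, mul_one] at h1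
    refine h1.congr fun t => ?_
    simp [Polynomial.eval_comp]
  have h2 := tendsto_nhds_unique hlim (by simp_rw [hscale]; exact tendsto_const_nhds)
  have h3 := Matrix.det_mul_row (fun l => (p l).leadingCoeff) c
  have h4 : (Matrix.of fun i l => c i l * (p l).leadingCoeff).det
      = (Matrix.of fun i l => (p l).leadingCoeff * c i l).det := by
    congr 1; ext i l; simp [mul_comm]
  rw [h4, h3] at h2
  rcases mul_eq_zero.1 h2 with h | h
  · rw [Finset.prod_eq_zero_iff] at h
    obtain ⟨l, -, hl⟩ := h
    exact hp l (Polynomial.leadingCoeff_eq_zero.1 hl)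
  · exact hc h

open Polynomial in
theorem natDegree_det_le_sum {T : Type*} [Fintype T] [DecidableEq T] (M : Matrix T T ℝ[X])
    (d : ℕ) (h : ∀ i l, (M i l).natDegree ≤ d) : M.det.natDegree ≤ Fintype.card T * d := by
  rw [Matrix.det_apply]
  refine Polynomial.natDegree_sum_le_of_forall_le _ _ fun σ _ => ?_
  refine (Polynomial.natDegree_smul_le _ _).trans ?_
  refine (Polynomial.natDegree_prod_le _ _).trans ?_
  refine (Finset.sum_le_sum fun i _ => h _ _).trans ?_
  simp

open Polynomial in
/-- Zero estimate in two variables: a polynomial in `X` and `Y`, vanishing on a sumset in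
the product of the additive and the multiplicative group, is zero. -/
theorem zero_estimate_two {K S : ℕ} (p : Fin S → ℝ[X]) (hK : ∀ l, (p l).natDegree < K)
    {ι : Type*} (x y : Fin S → ℝ) (hy : Function.Injective y)
    (F : Finset ι) (u v : ι → ℝ) (hv : ∀ i ∈ F, v i ≠ 0)
    (hu : K * S ≤ (F.image u).card)
    (h : ∀ j, ∀ i ∈ F, ∑ l : Fin S, (p l).eval (u i + x j) * (v i * y j) ^ (l : ℕ) = 0) :
    ∀ l, p l = 0 := by
  classical
  by_contra hne
  push Not at hne
  obtain ⟨l₀, hl₀⟩ := hne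
  let T := {l : Fin S // p l ≠ 0}
  have : Nonempty T := ⟨⟨l₀, hl₀⟩⟩
  obtain ⟨e, he⟩ := exists_submatrix_det_ne_zero (P := Fin S) (T := T)
    (fun j l => y j ^ (l.1 : ℕ)) (by
      intro c hc
      have hV := Matrix.det_vandermonde_ne_zero_iff.2 hy
      set c' : Fin S → ℝ := fun l => if hl : p l ≠ 0 then c ⟨l, hl⟩ else 0 with hc'
      have : (Matrix.vandermonde y).mulVec c' = 0 := by
        ext j
        have := hc j
        simp only [Matrix.mulVec, dotProduct, Matrix.vandermonde_apply, Pi.zero_apply]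
        rw [← this, ← Fintype.sum_subtype_add_sum_subtype (fun l => p l ≠ 0),
          Finset.sum_eq_zero (s := (Finset.univ : Finset {l // ¬ p l ≠ 0})), add_zero]
        · exact Finset.sum_congr rfl fun l _ => by simp [hc', l.2]
        · intro l _
          have := not_not.1 l.2
          simp [hc', this]
      have h0 := Matrix.eq_zero_of_mulVec_eq_zero hV this
      ext l
      have := congrFun h0 l.1
      simpa [hc', l.2] using this)
  set M : Matrix T T ℝ[X] := Matrix.of fun i l : T =>
    C (y (e i) ^ (l.1 : ℕ)) * (p l.1).comp (X + C (x (e i))) with hM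
  have hD : M.det ≠ 0 := det_translate_ne_zero (fun l : T => p l.1) (fun l => l.2)
    (fun i => x (e i)) (Matrix.of fun i (l : T) => y (e i) ^ (l.1 : ℕ)) he
  have hdeg : M.det.natDegree ≤ Fintype.card T * (K - 1) := by
    refine natDegree_det_le_sum M _ fun i l => ?_
    refine (Polynomial.natDegree_C_mul_le (y (e i) ^ (l.1 : ℕ))
      ((p l.1).comp (X + C (x (e i))))).trans ?_
    rw [Polynomial.natDegree_comp, Polynomial.natDegree_X_add_C, mul_one]
    have := hK l.1; omega
  have hcardT : Fintype.card T ≤ S := by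
    have := Fintype.card_subtype_le fun l : Fin S => p l ≠ 0
    rwa [Fintype.card_fin] at this
  have hTpos : 0 < Fintype.card T := Fintype.card_pos
  have hroot : F.image u ⊆ M.det.roots.toFinset := by
    intro t ht
    obtain ⟨i, hi, rfl⟩ := Finset.mem_image.1 ht
    rw [Multiset.mem_toFinset, Polynomial.mem_roots hD, Polynomial.IsRoot.def]
    have : (Polynomial.evalRingHom (u i)) M.det = 0 := by
      rw [RingHom.map_det]
      refine Matrix.exists_mulVec_eq_zero_iff.1 ⟨fun l : T => v i ^ (l.1 : ℕ), ?_, ?_⟩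
      · intro h0
        have := congrFun h0 ⟨l₀, hl₀⟩
        exact pow_ne_zero _ (hv i hi) this
      · ext j
        have := h (e j) i hi
        simp only [Matrix.mulVec, dotProduct, Pi.zero_apply]
        rw [← this, ← Fintype.sum_subtype_add_sum_subtype (fun l => p l ≠ 0),
          Finset.sum_eq_zero (s := (Finset.univ : Finset {l // ¬ p l ≠ 0})), add_zero]
        · refine Finset.sum_congr rfl fun l _ => ?_
          simp [hM, Polynomial.eval_comp]
          ring
        · intro l _
          have := not_not.1 l.2
          simp [this]
    simpa using this
  have h1 := Finset.card_le_card hroot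
  have h2 := (Multiset.toFinset_card_le M.det.roots).trans (Polynomial.card_roots' M.det)
  have hKpos : 0 < K := lt_of_le_of_lt (Nat.zero_le _) (hK l₀)
  have h3 : Fintype.card T * (K - 1) < K * S := by
    have : Fintype.card T * (K - 1) < Fintype.card T * K :=
      Nat.mul_lt_mul_of_pos_left (by omega) hTpos
    nlinarith
  omega

namespace ZeroEstimate

open MvPolynomial

/-- Polynomials in three variables over the reals. -/
abbrev Poly := MvPolynomial (Fin 3) ℝ

/-- The point of `ℝ × ℝ × ℝ^*` with logarithmic coordinates `v`. -/
noncomputable def pt (v : Fin 3 → ℝ) : Fin 3 → ℝ := ![v 0, v 1, Real.exp (v 2)]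

/-- Substitution in a polynomial of the translation by `pt v`. -/
noncomputable def shift (v : Fin 3 → ℝ) : Poly →ₐ[ℝ] Poly :=
  aeval ![X 0 + C (v 0), X 1 + C (v 1), C (Real.exp (v 2)) * X 2]

theorem eval_shift (v w : Fin 3 → ℝ) (f : Poly) :
    eval (pt w) (shift v f) = eval (pt (w + v)) f := by
  have : (eval (pt w)).comp (shift v).toRingHom = eval (pt (w + v)) := by
    apply MvPolynomial.ringHom_ext
    · intro c; simp [shift]
    · intro i; fin_cases i <;> simp [shift, pt, Real.exp_add, mul_comm]
  exact RingHom.congr_fun this f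

theorem shift_shift (v w : Fin 3 → ℝ) (f : Poly) : shift v (shift w f) = shift (v + w) f := by
  have : (shift v).comp (shift w) = shift (v + w) := by
    apply MvPolynomial.algHom_ext
    intro i
    fin_cases i
    · simp [shift]; ring
    · simp [shift]; ring
    · simp [shift, Real.exp_add]; ring
  exact AlgHom.congr_fun this f

theorem shift_zero (f : Poly) : shift 0 f = f := by
  have : shift 0 = AlgHom.id ℝ Poly := by
    apply MvPolynomial.algHom_ext
    intro i
    fin_cases i <;> simp [shift]
  rw [this]; rfl

theorem shift_neg_shift (v : Fin 3 → ℝ) (f : Poly) : shift (-v) (shift v f) = f := by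
  rw [shift_shift, neg_add_cancel, shift_zero]

theorem shift_shift_neg (v : Fin 3 → ℝ) (f : Poly) : shift v (shift (-v) f) = f := by
  rw [shift_shift, add_neg_cancel, shift_zero]

/-- Translation as a ring isomorphism. -/
noncomputable def shiftEquiv (v : Fin 3 → ℝ) : Poly ≃+* Poly :=
  RingEquiv.ofRingHom (shift v).toRingHom (shift (-v)).toRingHom
    (RingHom.ext fun f => shift_shift_neg v f) (RingHom.ext fun f => shift_neg_shift v f)

theorem shift_dvd_iff (v : Fin 3 → ℝ) (f g : Poly) : shift v f ∣ g ↔ f ∣ shift (-v) g := by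
  constructor
  · rintro ⟨h, rfl⟩
    exact ⟨shift (-v) h, by rw [map_mul, shift_neg_shift]⟩
  · rintro ⟨h, hh⟩
    exact ⟨shift v h, by rw [← map_mul, ← hh, shift_shift_neg]⟩

/-- The polynomials whose partial degrees are bounded by `d`. -/
noncomputable def box (d : Fin 3 → ℕ) : Submodule ℝ Poly :=
  restrictSupport ℝ (Set.Iic (Finsupp.equivFunOnFinite.symm d))

theorem mem_box {d : Fin 3 → ℕ} {f : Poly} : f ∈ box d ↔ ∀ i, degreeOf i f ≤ d i := by
  simp only [box, mem_restrictSupport_iff, degreeOf_le_iff]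
  constructor
  · intro h i m hm
    exact h hm i
  · intro h m hm i
    exact h i m hm

theorem finrank_box (d : Fin 3 → ℕ) :
    Module.finrank ℝ (box d) = (d 0 + 1) * (d 1 + 1) * (d 2 + 1) := by
  have hb := basisRestrictSupport ℝ (Set.Iic (Finsupp.equivFunOnFinite.symm d))
  rw [box, Module.finrank_eq_card_basis hb, Fintype.card_Iic, Finsupp.card_Iic]
  rw [Finset.prod_subset (Finset.subset_univ _)]
  · simp [Fin.prod_univ_three]
  · intro i _ hi
    have : d i = 0 := by simpa using hi
    simp [this]

instance finite_box (d : Fin 3 → ℕ) : Module.Finite ℝ (box d) :=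
  Module.Finite.of_basis (basisRestrictSupport ℝ (Set.Iic (Finsupp.equivFunOnFinite.symm d)))

theorem box_mono {d e : Fin 3 → ℕ} (h : d ≤ e) : box d ≤ box e := fun _ hf =>
  mem_box.2 fun i => (mem_box.1 hf i).trans (h i)

theorem mul_mem_box {d e : Fin 3 → ℕ} {f g : Poly} (hf : f ∈ box d) (hg : g ∈ box e) :
    f * g ∈ box (d + e) :=
  mem_box.2 fun i => (degreeOf_mul_le i f g).trans (add_le_add (mem_box.1 hf i) (mem_box.1 hg i))

theorem mem_box_degreeOf (f : Poly) : f ∈ box fun i => degreeOf i f :=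
  mem_box.2 fun _ => le_rfl

theorem one_mem_box (d : Fin 3 → ℕ) : (1 : Poly) ∈ box d :=
  mem_box.2 fun i => by simp [degreeOf_one]

theorem X_mem_box {d : Fin 3 → ℕ} (i : Fin 3) (h : 1 ≤ d i) : (X i : Poly) ∈ box d :=
  mem_box.2 fun j => by
    rw [degreeOf_X]; split_ifs with hij
    · rw [← hij] at h; subst hij; exact h
    · exact Nat.zero_le _

theorem C_mem_box (d : Fin 3 → ℕ) (c : ℝ) : (C c : Poly) ∈ box d :=
  mem_box.2 fun i => by simp [degreeOf_C]

theorem pow_mem_box {d : Fin 3 → ℕ} {f : Poly} (hf : f ∈ box d) (n : ℕ) : f ^ n ∈ box (n • d) := by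
  induction n with
  | zero => simpa using one_mem_box _
  | succ n ih => rw [pow_succ, succ_nsmul]; exact mul_mem_box ih hf

theorem shift_mem_box {d : Fin 3 → ℕ} {f : Poly} (hf : f ∈ box d) (v : Fin 3 → ℝ) :
    shift v f ∈ box d := by
  rw [f.as_sum, map_sum]
  refine Submodule.sum_mem _ fun m hm => ?_
  have hmd : ∀ i, m i ≤ d i := fun i => (degreeOf_le_iff.1 (mem_box.1 hf i)) m hm
  rw [shift, aeval_monomial, Finsupp.prod_fintype _ _ (by simp), Fin.prod_univ_three]
  have h0 : (X 0 + C (v 0) : Poly) ∈ box (Pi.single 0 1) :=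
    Submodule.add_mem _ (X_mem_box 0 (by simp)) (C_mem_box _ _)
  have h1 : (X 1 + C (v 1) : Poly) ∈ box (Pi.single 1 1) :=
    Submodule.add_mem _ (X_mem_box 1 (by simp)) (C_mem_box _ _)
  have h2 : (C (Real.exp (v 2)) * X 2 : Poly) ∈ box (Pi.single 2 1) := by
    have := mul_mem_box (C_mem_box 0 (Real.exp (v 2))) (X_mem_box (d := Pi.single 2 1) 2 (by simp))
    simpa using this
  have h := mul_mem_box (C_mem_box 0 (coeff m f))
    (mul_mem_box (mul_mem_box (pow_mem_box h0 (m 0)) (pow_mem_box h1 (m 1)))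
    (pow_mem_box h2 (m 2)))
  refine box_mono ?_ h
  intro i
  fin_cases i
  · simpa using hmd 0
  · simpa using hmd 1
  · simpa using hmd 2

theorem degreeOf_shift (v : Fin 3 → ℝ) (f : Poly) (i : Fin 3) :
    degreeOf i (shift v f) = degreeOf i f := by
  apply le_antisymm
  · exact mem_box.1 (shift_mem_box (mem_box_degreeOf f) v) i
  · have := mem_box.1 (shift_mem_box (mem_box_degreeOf (shift v f)) (-v)) i
    rwa [shift_neg_shift] at this

/-- The linear form vanishing along the direction `ν` from the point `z`. -/
noncomputable def lineForm (z ν : Fin 3 → ℝ) : Poly :=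
  C (ν 1) * (X 0 - C (z 0)) - C (ν 0) * (X 1 - C (z 1))

theorem lineForm_eq (z ν : Fin 3 → ℝ) :
    lineForm z ν = C (ν 1) * X 0 - C (ν 0) * X 1 - C (ν 1 * z 0 - ν 0 * z 1) := by
  simp only [lineForm, map_sub, map_mul]; ring

theorem shift_lineForm (v z ν : Fin 3 → ℝ) : shift v (lineForm z ν) = lineForm (z - v) ν := by
  simp only [lineForm, shift, map_sub, map_mul, aeval_X, aeval_C, algebraMap_eq, Pi.sub_apply]
  simp
  ring

theorem exists_polynomial_line (z ν : Fin 3 → ℝ) (h01 : ν 0 ≠ 0 ∨ ν 1 ≠ 0) :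
    ∃ (θ : Poly →+* Polynomial (Polynomial ℝ)),
      (∀ f, θ f = 0 → lineForm z ν ∣ f) ∧
      ∀ f t y, ((θ f).eval₂ (Polynomial.evalRingHom t) y) =
        eval ![z 0 + ν 0 * t, z 1 + ν 1 * t, y] f := by
  set s : ℝ := ν 0 ^ 2 + ν 1 ^ 2 with hs
  have hs0 : s ≠ 0 := by
    rcases h01 with h | h
    · have := sq_pos_of_ne_zero h; positivity
    · have := sq_pos_of_ne_zero h; positivity
  let θ : Poly →ₐ[ℝ] Polynomial (Polynomial ℝ) :=
    aeval ![Polynomial.C (Polynomial.C (z 0) + Polynomial.C (ν 0) * Polynomial.X),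
    Polynomial.C (Polynomial.C (z 1) + Polynomial.C (ν 1) * Polynomial.X), Polynomial.X]
  let ι : Polynomial (Polynomial ℝ) →+* Poly :=
    Polynomial.eval₂RingHom (Polynomial.eval₂RingHom (C : ℝ →+* Poly)
    (C (1 / s) * (C (ν 0) * (X 0 - C (z 0)) + C (ν 1) * (X 1 - C (z 1))))) (X 2)
  have hιC : ∀ c, ι (Polynomial.C (Polynomial.C c)) = C c := fun c => by
    rw [Polynomial.coe_eval₂RingHom, Polynomial.eval₂_C, Polynomial.coe_eval₂RingHom,
      Polynomial.eval₂_C]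
  have hιX : ι (Polynomial.C Polynomial.X) =
      C s⁻¹ * (C (ν 0) * (X 0 - C (z 0)) + C (ν 1) * (X 1 - C (z 1))) := by
    rw [Polynomial.coe_eval₂RingHom, Polynomial.eval₂_C, Polynomial.coe_eval₂RingHom,
      Polynomial.eval₂_X, one_div]
  have hιY : ι Polynomial.X = X 2 := by
    rw [Polynomial.coe_eval₂RingHom, Polynomial.eval₂_X]
  clear_value ι
  refine ⟨θ.toRingHom, ?_, ?_⟩
  · have hcong : ∀ f, lineForm z ν ∣ f - ι (θ f) := by
      intro f
      have : (Ideal.Quotient.mk (Ideal.span {lineForm z ν})).comp (ι.comp θ.toRingHom) =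
          Ideal.Quotient.mk (Ideal.span {lineForm z ν}) := by
        apply MvPolynomial.ringHom_ext
        · intro c
          have : θ (C c) = Polynomial.C (Polynomial.C c) := by
            simp [θ]
          simp [this, hιC]
        · intro i
          simp only [RingHom.comp_apply]
          symm
          rw [Ideal.Quotient.eq, Ideal.mem_span_singleton]
          fin_cases i
          · refine ⟨C (ν 1 / s), ?_⟩
            have hC : (C s : Poly) * C (1 / s) = 1 := by
              rw [← map_mul]; simp [hs0]
            have e1 : (C (ν 1 / s) : Poly) = C (ν 1) * C (1 / s) := by
              rw [← map_mul]; congr 1; ring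
            have e2 : (C s : Poly) = C (ν 0) ^ 2 + C (ν 1) ^ 2 := by
              rw [hs]; simp
            simp [θ, hιC, hιX, lineForm]
            simp at hC e1 e2
            rw [e1]; rw [e2] at hC
            linear_combination (- (X 0 - C (z 0))) * hC
          · refine ⟨- C (ν 0 / s), ?_⟩
            have hC : (C s : Poly) * C (1 / s) = 1 := by
              rw [← map_mul]; simp [hs0]
            have e1 : (C (ν 0 / s) : Poly) = C (ν 0) * C (1 / s) := by
              rw [← map_mul]; congr 1; ring
            have e2 : (C s : Poly) = C (ν 0) ^ 2 + C (ν 1) ^ 2 := by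
              rw [hs]; simp
            simp [θ, hιC, hιX, lineForm]
            simp at hC e1 e2
            rw [e1]; rw [e2] at hC
            linear_combination (- (X 1 - C (z 1))) * hC
          · simp [θ, hιY]
      rw [← Ideal.mem_span_singleton, ← Ideal.Quotient.eq]
      exact (RingHom.congr_fun this f).symm
    intro f hf
    have := hcong f
    have hf' : θ f = 0 := hf
    rwa [hf', map_zero, sub_zero] at this
  · intro f t y
    have : (Polynomial.eval₂RingHom (Polynomial.evalRingHom t) y).comp θ.toRingHom =
        eval ![z 0 + ν 0 * t, z 1 + ν 1 * t, y] := by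
      apply MvPolynomial.ringHom_ext
      · intro c
        have : θ (C c) = Polynomial.C (Polynomial.C c) := by
          simp [θ]
        simp [this]
      · intro i
        fin_cases i <;> simp [θ]
    exact RingHom.congr_fun this f

theorem lineForm_dvd {z ν : Fin 3 → ℝ} (h01 : ν 0 ≠ 0 ∨ ν 1 ≠ 0) (h2 : ν 2 ≠ 0) {f : Poly}
    (hf : ∀ j : ℕ, eval (pt (z + (j : ℝ) • ν)) f = 0) : lineForm z ν ∣ f := by
  obtain ⟨θ, hθ, hev⟩ := exists_polynomial_line z ν h01
  apply hθ
  set g := θ f with hg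
  set S := g.natDegree + 1
  set K := (Finset.univ.sup fun l : Fin S => (g.coeff l).natDegree) + 1
  have hq : Function.Injective fun j : ℕ => Real.exp (j * ν 2) := by
    intro i j hij
    have := Real.exp_injective hij
    exact_mod_cast mul_right_cancel₀ h2 this
  have hz := zero_estimate_two (K := K) (S := S) (fun l => g.coeff l)
    (fun l => Nat.lt_succ_of_le (Finset.le_sup (f := fun l : Fin S => (g.coeff l).natDegree)
      (Finset.mem_univ l)))
    (fun j => ((j : ℕ) : ℝ)) (fun j => Real.exp ((j : ℕ) * ν 2))
    (fun i j hij => Fin.ext (hq hij)) (Finset.range (K * S)) (fun i => (i : ℝ))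
    (fun i => Real.exp (z 2) * Real.exp (i * ν 2)) (fun i _ => by positivity)
    (by rw [Finset.card_image_of_injective _ Nat.cast_injective, Finset.card_range])
    (by
      intro j i _
      have h1 := hf (i + j)
      have h2 := hev f ((i : ℝ) + (j : ℕ))
          (Real.exp (z 2) * Real.exp (i * ν 2) * Real.exp ((j : ℕ) * ν 2))
      rw [← hg, Polynomial.eval₂_eq_sum_range, Finset.sum_range] at h2
      simp only [Polynomial.coe_evalRingHom] at h2
      rw [h2, ← h1]
      congr 2
      ext k
      fin_cases k
      · simp [pt]; ring
      · simp [pt]; ring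
      · simp [pt, ← Real.exp_add]; ring)
  ext1 l
  by_cases hl : l < S
  · exact hz ⟨l, hl⟩
  · rw [Polynomial.coeff_zero, Polynomial.coeff_eq_zero_of_natDegree_lt]; omega

end ZeroEstimate

namespace ZeroEstimate

open MvPolynomial

/-- The dimension of the image modulo `I` of the space of polynomials of degree at most `d`. -/
noncomputable def hilb (I : Ideal Poly) (d : Fin 3 → ℕ) : ℕ :=
  Module.finrank ℝ ((box d).map (Ideal.Quotient.mkₐ ℝ I).toLinearMap)

theorem finrank_map_of_injective {V W : Type*} [AddCommGroup V] [Module ℝ V] [AddCommGroup W]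
    [Module ℝ W] {φ : V →ₗ[ℝ] W} (hφ : Function.Injective φ) (p : Submodule ℝ V) :
    Module.finrank ℝ (p.map φ) = Module.finrank ℝ p :=
  (Submodule.equivMapOfInjective φ hφ p).finrank_eq.symm

theorem finrank_map_mulLeft {f : Poly} (hf : f ≠ 0) (d : Fin 3 → ℕ) :
    Module.finrank ℝ ((box d).map (LinearMap.mulLeft ℝ f)) = Module.finrank ℝ (box d) :=
  finrank_map_of_injective (fun _ _ h => mul_left_cancel₀ hf h) _

theorem hilb_add_le {I : Ideal Poly} {d : Fin 3 → ℕ} {W : Submodule ℝ Poly}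
    (hW : W ≤ box d) (hI : ∀ f ∈ W, f ∈ I) :
    hilb I d + Module.finrank ℝ W ≤ Module.finrank ℝ (box d) := by
  set φ := (Ideal.Quotient.mkₐ ℝ I).toLinearMap.domRestrict (box d) with hφ
  have h1 := LinearMap.finrank_range_add_finrank_ker φ
  rw [hφ, LinearMap.range_domRestrict] at h1
  have h2 : Module.finrank ℝ W ≤ Module.finrank ℝ (LinearMap.ker φ) := by
    rw [← finrank_map_of_injective (box d).subtype_injective (LinearMap.ker φ)]
    apply Submodule.finrank_mono
    intro f hf
    refine ⟨⟨f, hW hf⟩, ?_, rfl⟩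
    simp only [SetLike.mem_coe, LinearMap.mem_ker, hφ]
    exact Ideal.Quotient.eq_zero_iff_mem.2 (hI f hf)
  have h3 : hilb I d + Module.finrank ℝ (LinearMap.ker φ) = Module.finrank ℝ (box d) := h1
  omega

theorem finrank_sup_ge {f g : Poly} (hf : f ≠ 0) (hg : g ≠ 0) (hfg : IsRelPrime f g)
    (a : Fin 3 → ℕ) :
    Module.finrank ℝ (box fun i => a i - degreeOf i f) +
      Module.finrank ℝ (box fun i => a i - degreeOf i g) ≤
    Module.finrank ℝ ((box fun i => a i - degreeOf i f).map (LinearMap.mulLeft ℝ f) ⊔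
      (box fun i => a i - degreeOf i g).map (LinearMap.mulLeft ℝ g) : Submodule ℝ Poly) +
    Module.finrank ℝ (box fun i => a i - degreeOf i f - degreeOf i g) := by
  rw [← finrank_map_mulLeft hf, ← finrank_map_mulLeft hg (fun i => a i - degreeOf i g),
    ← Submodule.finrank_sup_add_finrank_inf_eq,
    ← finrank_map_mulLeft (mul_ne_zero hf hg) (fun i => a i - degreeOf i f - degreeOf i g)]
  refine Nat.add_le_add_left (Submodule.finrank_mono ?_) _
  rintro _ ⟨⟨u, hu, rfl⟩, ⟨v, hv, huv⟩⟩
  simp only [LinearMap.mulLeft_apply] at huv ⊢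
  obtain ⟨e, rfl⟩ : g ∣ u := hfg.symm.dvd_of_dvd_mul_left ⟨v, huv.symm⟩
  refine ⟨e, ?_, by simp⟩
  by_cases he : e = 0
  · rw [he]; exact Submodule.zero_mem _
  refine mem_box.2 fun i => ?_
  have := mem_box.1 hu i
  rw [degreeOf_mul_eq hg he] at this
  omega

theorem hilb_le {f g : Poly} (hf : f ≠ 0) (hg : g ≠ 0) (hfg : IsRelPrime f g)
    {D : Fin 3 → ℕ} (hfD : f ∈ box D) (hgD : g ∈ box D) {I : Ideal Poly} (hfI : f ∈ I)
    (hgI : g ∈ I) {n : ℕ} (hn : 2 ≤ n) :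
    hilb I (n • D) ≤ 6 * n * (D 0 * D 1 * D 2) + 2 * (D 0 * D 1 + D 0 * D 2 + D 1 * D 2) := by
  have hfd := mem_box.1 hfD
  have hgd := mem_box.1 hgD
  have hn2 : ∀ i, D i + D i ≤ (n • D) i := fun i => by
    simp only [Pi.smul_apply, smul_eq_mul]; nlinarith
  have hfa : ∀ i, degreeOf i f + degreeOf i g ≤ (n • D) i := fun i =>
    (add_le_add (hfd i) (hgd i)).trans (hn2 i)
  have h1 := finrank_sup_ge hf hg hfg (n • D)
  have h2 := hilb_add_le (I := I) (d := n • D)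
    (W := (box fun i => (n • D) i - degreeOf i f).map (LinearMap.mulLeft ℝ f) ⊔
      (box fun i => (n • D) i - degreeOf i g).map (LinearMap.mulLeft ℝ g)) (by
      refine sup_le ?_ ?_
      · rintro _ ⟨u, hu, rfl⟩
        have := mul_mem_box (mem_box_degreeOf f) hu
        refine box_mono ?_ this
        intro i
        have := hfa i
        simp only [Pi.add_apply]; omega
      · rintro _ ⟨u, hu, rfl⟩
        have := mul_mem_box (mem_box_degreeOf g) hu
        refine box_mono ?_ this
        intro i
        have := hfa i
        simp only [Pi.add_apply]; omega) (by
      have : (box fun i => (n • D) i - degreeOf i f).map (LinearMap.mulLeft ℝ f) ⊔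
        (box fun i => (n • D) i - degreeOf i g).map (LinearMap.mulLeft ℝ g) ≤
        I.restrictScalars ℝ := by
        refine sup_le ?_ ?_
        · rintro _ ⟨u, hu, rfl⟩
          exact I.mul_mem_right _ hfI
        · rintro _ ⟨u, hu, rfl⟩
          exact I.mul_mem_right _ hgI
      exact this)
  simp only [finrank_box] at h1 h2
  have e : ∀ i, ∃ x : ℕ, (n • D) i = x + degreeOf i f + degreeOf i g := fun i =>
    ⟨(n • D) i - degreeOf i f - degreeOf i g, by have := hfa i; omega⟩
  obtain ⟨x, hx⟩ := e 0
  obtain ⟨y, hy⟩ := e 1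
  obtain ⟨z, hz⟩ := e 2
  simp only [hx, hy, hz] at h1 h2
  have ea : ∀ p q r : ℕ, p + q + r - q = p + r := by intros; omega
  have eb : ∀ p q r : ℕ, p + q + r - r = p + q := by intros; omega
  simp only [ea, eb, Nat.add_sub_cancel] at h1
  simp only [Pi.smul_apply, smul_eq_mul] at hx hy hz
  have p0 := hfd 0
  have p1 := hfd 1
  have p2 := hfd 2
  have q0 := hgd 0
  have q1 := hgd 1
  have q2 := hgd 2
  generalize degreeOf 0 f = u0 at *
  generalize degreeOf 1 f = u1 at *
  generalize degreeOf 2 f = u2 at *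
  generalize degreeOf 0 g = v0 at *
  generalize degreeOf 1 g = v1 at *
  generalize degreeOf 2 g = v2 at *
  generalize D 0 = d0 at *
  generalize D 1 = d1 at *
  generalize D 2 = d2 at *
  have key : hilb I (n • D) ≤
      (u0 * v1 + u1 * v0) * (n * d2 + 1) + (u0 * v2 + u2 * v0) * (n * d1 + 1)
      + (u1 * v2 + u2 * v1) * (n * d0 + 1) := by
    rw [hx, hy, hz]
    have key2 : (x + u0 + v0 + 1) * (y + u1 + v1 + 1) * (z + u2 + v2 + 1) +
        (x + 1) * (y + 1) * (z + 1) + (u0 * u1 * v2 + u0 * v1 * u2 + u0 * v1 * v2 +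
        v0 * u1 * u2 + v0 * u1 * v2 + v0 * v1 * u2) =
        (x + v0 + 1) * (y + v1 + 1) * (z + v2 + 1) + (x + u0 + 1) * (y + u1 + 1) * (z + u2 + 1) +
        ((u0 * v1 + u1 * v0) * (z + u2 + v2 + 1) + (u0 * v2 + u2 * v0) * (y + u1 + v1 + 1)
        + (u1 * v2 + u2 * v1) * (x + u0 + v0 + 1)) := by ring
    omega
  refine key.trans ?_
  have a01 : u0 * v1 + u1 * v0 ≤ 2 * (d0 * d1) := by
    linarith only [Nat.mul_le_mul p0 q1, Nat.mul_le_mul p1 q0]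
  have a02 : u0 * v2 + u2 * v0 ≤ 2 * (d0 * d2) := by
    linarith only [Nat.mul_le_mul p0 q2, Nat.mul_le_mul p2 q0]
  have a12 : u1 * v2 + u2 * v1 ≤ 2 * (d1 * d2) := by
    linarith only [Nat.mul_le_mul p1 q2, Nat.mul_le_mul p2 q1]
  have b01 := Nat.mul_le_mul_right (n * d2 + 1) a01
  have b02 := Nat.mul_le_mul_right (n * d1 + 1) a02
  have b12 := Nat.mul_le_mul_right (n * d0 + 1) a12
  have e3 : 6 * n * (d0 * d1 * d2) + 2 * (d0 * d1 + d0 * d2 + d1 * d2) =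
    2 * (d0 * d1) * (n * d2 + 1) + 2 * (d0 * d2) * (n * d1 + 1) + 2 * (d1 * d2) * (n * d0 + 1) := by
    ring
  omega

end ZeroEstimate

namespace ZeroEstimate

open MvPolynomial

theorem exists_section_map {V W : Type*} [AddCommGroup V] [Module ℝ V] [AddCommGroup W]
    [Module ℝ W] (φ : V →ₗ[ℝ] W) (p : Submodule ℝ V) :
    ∃ s : p.map φ →ₗ[ℝ] p, ∀ v : p.map φ, φ (s v : V) = v := by
  obtain ⟨s, hs⟩ := LinearMap.exists_rightInverse_of_surjective (φ.submoduleMap p)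
    (LinearMap.range_eq_top.2 (LinearMap.submoduleMap_surjective _ _))
  exact ⟨s, fun v => congrArg Subtype.val (LinearMap.congr_fun hs v)⟩

theorem finrank_pos_of_mem {W : Type*} [AddCommGroup W] [Module ℝ W] (p : Submodule ℝ W)
    [Module.Finite ℝ p] {x : W} (hx : x ∈ p) (hx0 : x ≠ 0) : 0 < Module.finrank ℝ p := by
  rw [Module.finrank_pos_iff_exists_ne_zero]
  exact ⟨⟨x, hx⟩, fun h => hx0 (congrArg Subtype.val h)⟩

theorem sum_finrank_le_of_injective {ι : Type*} [Fintype ι] {W : ι → Type*}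
    [∀ i, AddCommGroup (W i)] [∀ i, Module ℝ (W i)] (V : ∀ i, Submodule ℝ (W i))
    [∀ i, Module.Finite ℝ (V i)] {U : Type*} [AddCommGroup U] [Module ℝ U] (p : Submodule ℝ U)
    [Module.Finite ℝ p] (Φ : (∀ i, V i) →ₗ[ℝ] p) (hΦ : ∀ v, Φ v = 0 → v = 0) :
    ∑ i, Module.finrank ℝ (V i) ≤ Module.finrank ℝ p := by
  rw [← Module.finrank_pi_fintype]
  exact LinearMap.finrank_le_finrank_of_injective
    (LinearMap.ker_eq_bot.1 ((Submodule.eq_bot_iff _).2 hΦ))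

theorem aeval_X_two_mem_box {D : Fin 3 → ℕ} {n : ℕ} (q : Polynomial ℝ) (hD : 1 ≤ D 2)
    (hq : q.natDegree ≤ n) : (Polynomial.aeval (X 2 : Poly) q) ∈ box (n • D) := by
  rw [Polynomial.aeval_eq_sum_range]
  refine Submodule.sum_mem _ fun i hi => Submodule.smul_mem _ _ ?_
  have hi' : i ≤ n := by have := Finset.mem_range.1 hi; omega
  exact box_mono (nsmul_le_nsmul_left (fun _ => Nat.zero_le _) hi')
    (pow_mem_box (X_mem_box 2 hD) i)

theorem hilb_succ_ge {I : Ideal Poly} {h : Poly} {D : Fin 3 → ℕ} (hD : 1 ≤ D 2) (hh : h ∈ box D)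
    (hI : ∀ u, h * u ∈ I → u ∈ I) (B : Finset (Fin 3 → ℝ))
    (hB : Set.InjOn (fun z : Fin 3 → ℝ => z 2) B) (hhB : ∀ z ∈ B, eval (pt z) h = 0)
    (hIB : ∀ f ∈ I, ∀ z ∈ B, eval (pt z) f = 0) {n : ℕ} (hn : B.card ≤ n) :
    hilb I (n • D) + B.card ≤ hilb I ((n + 1) • D) := by
  set π := Ideal.Quotient.mkₐ ℝ I
  set M := (box ((n + 1) • D)).map π.toLinearMap with hM
  let e : Poly →ₐ[ℝ] (B → ℝ) := AlgHom.pi fun z => aeval (pt z)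
  have he : ∀ f z, e f z = eval (pt z) f := fun f z => by simp [e, aeval_eq_eval]
  let ev : (Poly ⧸ I) →ₐ[ℝ] (B → ℝ) := Ideal.Quotient.liftₐ I e (fun f hf => by
    ext z; rw [he]; exact hIB f hf z z.2)
  have hev : ∀ f, ev (π f) = e f := fun f => rfl
  set φ := ev.toLinearMap.domRestrict M with hφ
  have hrange : LinearMap.range φ = ⊤ := by
    rw [eq_top_iff]
    rintro g -
    let q := Lagrange.interpolate Finset.univ (fun z : B => Real.exp (z.1 2)) g
    have hinj : Set.InjOn (fun z : B => Real.exp (z.1 2)) (Finset.univ : Finset B) := by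
      intro z _ w _ hzw
      exact Subtype.ext (hB z.2 w.2 (Real.exp_injective hzw))
    have hqz : ∀ z : B, q.eval (Real.exp (z.1 2)) = g z := fun z =>
      Lagrange.eval_interpolate_at_node g hinj (Finset.mem_univ z)
    have hq : q.natDegree ≤ n + 1 := by
      have := Lagrange.degree_interpolate_lt g hinj
      rw [Finset.card_univ, Fintype.card_coe] at this
      have h2 : q.natDegree ≤ B.card := Polynomial.natDegree_le_of_degree_le this.le
      omega
    clear_value q
    refine ⟨⟨π (Polynomial.aeval (X 2 : Poly) q), ⟨_, aeval_X_two_mem_box q hD hq, rfl⟩⟩, ?_⟩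
    change ev (π _) = g
    rw [hev]
    ext z
    rw [he]
    rw [← hqz z]
    rw [← MvPolynomial.coe_aeval_eq_eval, RingHom.coe_coe, ← Polynomial.aeval_algHom_apply]
    simp [pt, Polynomial.aeval_def, Polynomial.eval₂_eq_eval_map]
  have hker : hilb I (n • D) ≤ Module.finrank ℝ (LinearMap.ker φ) := by
    have hmul : Function.Injective (LinearMap.mulLeft ℝ (π h)) := by
      rw [← LinearMap.ker_eq_bot, eq_bot_iff]
      intro x hx
      obtain ⟨u, rfl⟩ := Ideal.Quotient.mkₐ_surjective ℝ I x
      have hx' : π h * π u = 0 := hx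
      rw [← map_mul] at hx'
      exact Ideal.Quotient.eq_zero_iff_mem.2 (hI u (Ideal.Quotient.eq_zero_iff_mem.1 hx'))
    rw [hilb, ← finrank_map_of_injective hmul,
      ← finrank_map_of_injective M.subtype_injective (LinearMap.ker φ)]
    apply Submodule.finrank_mono
    rintro _ ⟨_, ⟨u, hu, rfl⟩, rfl⟩
    refine ⟨⟨π (h * u), ⟨_, ?_, rfl⟩⟩, ?_, ?_⟩
    · rw [succ_nsmul']; exact mul_mem_box hh hu
    · change ev (π _) = 0
      rw [hev]; ext z; rw [he, map_mul, hhB z z.2, zero_mul]; rfl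
    · exact map_mul π h u
  have h1 := LinearMap.finrank_range_add_finrank_ker φ
  rw [hrange, finrank_top, Module.finrank_fintype_fun_eq_card, Fintype.card_coe] at h1
  have h3 : B.card + Module.finrank ℝ (LinearMap.ker φ) = hilb I ((n + 1) • D) := h1
  omega

theorem hilb_ge_of_prime {Q : Ideal Poly} (hQ : Q.IsPrime) (hmax : ¬ Q.IsMaximal) {D : Fin 3 → ℕ}
    (hD : ∀ i, 1 ≤ D i) (m : ℕ) : m + 1 ≤ hilb Q (m • D) := by
  set π := Ideal.Quotient.mkₐ ℝ Q with hπ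
  induction m with
  | zero =>
    have : 0 < hilb Q (0 • D) := by
      refine finrank_pos_of_mem _ (x := π 1) ⟨1, one_mem_box _, rfl⟩ fun h' => ?_
      exact hQ.ne_top ((Ideal.eq_top_iff_one _).2 (Ideal.Quotient.eq_zero_iff_mem.1 h'))
    omega
  | succ m ih =>
    refine lt_of_le_of_lt ih ?_
    apply Submodule.finrank_lt_finrank_of_lt
    have hle : (box (m • D)).map π.toLinearMap ≤ (box ((m + 1) • D)).map π.toLinearMap :=
      Submodule.map_mono (box_mono (nsmul_le_nsmul_left (fun _ => Nat.zero_le _) (Nat.le_succ m)))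
    refine lt_of_le_of_ne hle fun heq => hmax ?_
    have htop : (box (m • D)).map π.toLinearMap = ⊤ := by
      rw [eq_top_iff]
      rintro x -
      obtain ⟨f, rfl⟩ := Ideal.Quotient.mkₐ_surjective ℝ Q x
      induction f using MvPolynomial.induction_on with
      | C c => exact ⟨C c, C_mem_box _ c, rfl⟩
      | add p q hp hq => rw [map_add]; exact Submodule.add_mem _ hp hq
      | mul_X p i hp =>
        obtain ⟨u, hu, hup⟩ := hp
        rw [heq]
        refine ⟨u * X i, ?_, ?_⟩
        · rw [succ_nsmul]; exact mul_mem_box hu (X_mem_box i (hD i))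
        · have hup' : π u = π p := hup
          change π (u * X i) = π (p * X i)
          rw [map_mul, map_mul, hup']
    have hfin : Module.Finite ℝ (Poly ⧸ Q) := by
      have h1 : Module.Finite ℝ ((box (m • D)).map π.toLinearMap) := inferInstance
      rw [htop] at h1
      exact Module.Finite.of_surjective (⊤ : Submodule ℝ (Poly ⧸ Q)).subtype
        (fun x => ⟨⟨x, trivial⟩, rfl⟩)
    have : Algebra.IsIntegral ℝ (Poly ⧸ Q) := Algebra.IsIntegral.of_finite _ _
    exact Ideal.Quotient.maximal_of_isField _ (isField_of_isIntegral_of_isField'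
      (R := ℝ) (Field.toIsField ℝ))

theorem exists_hilb_iInf_ge {ι : Type*} [Fintype ι] (Q : ι → Ideal Poly) (hQ : ∀ i, (Q i).IsPrime)
    (hmax : ∀ i, ¬ (Q i).IsMaximal) (hinc : ∀ i j, i ≠ j → ¬ Q i ≤ Q j) {D : Fin 3 → ℕ}
    (hD : ∀ i, 1 ≤ D i) :
    ∃ c : ℕ, ∀ m : ℕ, Fintype.card ι * (m + 1) ≤ hilb (⨅ i, Q i) ((m + c) • D) := by
  classical
  have hx : ∀ i j, ∃ x : Poly, j ≠ i → x ∈ Q j ∧ x ∉ Q i := fun i j => by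
    by_cases hji : j = i
    · exact ⟨0, fun h => absurd hji h⟩
    · obtain ⟨x, hx⟩ := Set.not_subset.1 (hinc j i hji)
      exact ⟨x, fun _ => hx⟩
  choose x hx using hx
  set g : ι → Poly := fun i => ∏ j ∈ Finset.univ.erase i, x i j
  have hgi : ∀ i, g i ∉ Q i := fun i hi => by
    obtain ⟨j, hj, hji⟩ := (hQ i).prod_mem_iff.1 hi
    exact (hx i j (Finset.ne_of_mem_erase hj)).2 hji
  have hgj : ∀ i j, j ≠ i → g i ∈ Q j := fun i j hji =>
    (Q j).mem_of_dvd (Finset.dvd_prod_of_mem _ (Finset.mem_erase.2 ⟨hji, Finset.mem_univ _⟩))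
      (hx i j hji).1
  obtain ⟨c, hc⟩ : ∃ c : ℕ, ∀ i, g i ∈ box (c • D) := by
    refine ⟨Finset.univ.sup fun i => ∑ l, degreeOf l (g i), fun i => mem_box.2 fun l => ?_⟩
    have h1 := Finset.le_sup (f := fun i => ∑ l, degreeOf l (g i)) (Finset.mem_univ i)
    have h2 := Finset.single_le_sum (f := fun l => degreeOf l (g i)) (fun _ _ => Nat.zero_le _)
      (Finset.mem_univ l)
    calc _ ≤ _ := h2.trans h1
      _ ≤ _ := by
        simp only [Pi.smul_apply, smul_eq_mul]
        exact Nat.le_mul_of_pos_right _ (hD l)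
  refine ⟨c, fun m => ?_⟩
  set I := ⨅ i, Q i
  set V : ∀ i, Submodule ℝ (Poly ⧸ Q i) := fun i =>
    (box (m • D)).map (Ideal.Quotient.mkₐ ℝ (Q i)).toLinearMap with hV
  have hsec : ∀ i, ∃ s : V i →ₗ[ℝ] box (m • D),
      ∀ v : V i, Ideal.Quotient.mkₐ ℝ (Q i) (s v : Poly) = v := by
    exact fun i => exists_section_map _ _
  choose s hs using hsec
  let Φ₀ : (∀ i, V i) →ₗ[ℝ] Poly := ∑ i, (LinearMap.mulLeft ℝ (g i)).comp
    ((box (m • D)).subtype.comp ((s i).comp (LinearMap.proj i)))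
  have hΦ₀ : ∀ v, Φ₀ v = ∑ i, g i * (s i (v i) : Poly) := fun v => by simp [Φ₀]
  let Φ : (∀ i, V i) →ₗ[ℝ] (box ((m + c) • D)).map (Ideal.Quotient.mkₐ ℝ I).toLinearMap :=
    ((Ideal.Quotient.mkₐ ℝ I).toLinearMap.comp Φ₀).codRestrict _ fun v => by
      refine ⟨Φ₀ v, ?_, rfl⟩
      rw [hΦ₀]
      refine Submodule.sum_mem _ fun i _ => ?_
      rw [add_comm m c, add_nsmul]
      exact mul_mem_box (hc i) (s i (v i)).2
  have hΦ : ∀ v, Φ v = 0 → v = 0 := by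
    intro v hv
    have hv' : Ideal.Quotient.mkₐ ℝ I (Φ₀ v) = 0 := congrArg Subtype.val hv
    have hv2 : Φ₀ v ∈ I := Ideal.Quotient.eq_zero_iff_mem.1 hv'
    rw [hΦ₀] at hv2
    refine funext fun i => ?_
    have h1 : ∑ j, g j * (s j (v j) : Poly) ∈ Q i := (iInf_le Q i : I ≤ Q i) hv2
    rw [← Finset.add_sum_erase _ _ (Finset.mem_univ i)] at h1
    have h2 : ∑ j ∈ Finset.univ.erase i, g j * (s j (v j) : Poly) ∈ Q i :=
      Ideal.sum_mem _ fun j hj => Ideal.mul_mem_right _ _ (hgj j i (Finset.ne_of_mem_erase hj).symm)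
    have h3 := ((Q i).add_mem_iff_left h2).1 h1
    rcases (hQ i).mem_or_mem h3 with h | h
    · exact absurd h (hgi i)
    · have := hs i (v i)
      apply Subtype.ext
      rw [← this]
      exact Ideal.Quotient.eq_zero_iff_mem.2 h
  have h1 := sum_finrank_le_of_injective V _ Φ hΦ
  refine le_trans ?_ h1
  rw [← smul_eq_mul, ← Finset.card_univ, ← Finset.sum_const]
  exact Finset.sum_le_sum fun i _ => hilb_ge_of_prime (hQ i) (hmax i) hD m

end ZeroEstimate

namespace ZeroEstimate

open MvPolynomial

theorem exists_mem_forall_notMem {V ι : Type*} [AddCommGroup V] [Module ℝ V] [Finite ι]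
    (W : Submodule ℝ V) (N : ι → Submodule ℝ V) (h : ∀ i, ∃ w ∈ W, w ∉ N i) :
    ∃ w ∈ W, ∀ i, w ∉ N i := by
  by_contra! hc
  have hcov : ⋃ i, ((N i).comap W.subtype : Set W) = Set.univ := by
    ext w
    simpa using hc w w.2
  obtain ⟨i, hi⟩ := Subspace.exists_eq_top_of_iUnion_eq_univ hcov
  obtain ⟨w, hw, hwi⟩ := h i
  exact hwi (by simpa using (Submodule.eq_top_iff'.1 hi) ⟨w, hw⟩)

theorem height_ker_eval_ge (a : Fin 3 → ℝ) : 3 ≤ (RingHom.ker (eval a)).height := by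
  have key : ∀ φ : Poly →ₐ[ℝ] Poly, (RingHom.ker φ.toRingHom).IsPrime := fun φ =>
    RingHom.ker_isPrime _
  let φ₁ : Poly →ₐ[ℝ] Poly := aeval ![C (a 0), X 1, X 2]
  let φ₂ : Poly →ₐ[ℝ] Poly := aeval ![C (a 0), C (a 1), X 2]
  have h₁ := key φ₁
  have h₂ := key φ₂
  have h₃ : (RingHom.ker (eval a)).IsPrime := RingHom.ker_isPrime _
  have h0 : (⊥ : Ideal Poly).IsPrime := Ideal.isPrime_bot
  have hX : ∀ i : Fin 3, ∀ c : ℝ, (X i - C c : Poly) ≠ 0 := fun i c h => by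
    have := congrArg (eval (fun _ => c + 1)) h
    simp at this
  have e12 : ∀ f, φ₂ (φ₁ f) = φ₂ f := fun f => by
    have : φ₂.comp φ₁ = φ₂ := by
      refine MvPolynomial.algHom_ext fun i => ?_
      fin_cases i <;> simp [φ₁, φ₂]
    exact DFunLike.congr_fun this f
  have e23 : ∀ f, eval a (φ₂ f) = eval a f := fun f => by
    have : (aeval a : Poly →ₐ[ℝ] ℝ).comp φ₂ = aeval a := by
      refine MvPolynomial.algHom_ext fun i => ?_
      fin_cases i <;> simp [φ₂]
    simpa [aeval_eq_eval] using DFunLike.congr_fun this f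
  have l1 : (⊥ : Ideal Poly) < RingHom.ker φ₁.toRingHom := by
    refine SetLike.lt_iff_le_and_exists.2 ⟨bot_le, X 0 - C (a 0), ?_, ?_⟩
    · simp [RingHom.mem_ker, φ₁]
    · simpa using hX 0 (a 0)
  have l2 : RingHom.ker φ₁.toRingHom < RingHom.ker φ₂.toRingHom := by
    refine SetLike.lt_iff_le_and_exists.2 ⟨fun f hf => ?_, X 1 - C (a 1), ?_, ?_⟩
    · have hf' : φ₁ f = 0 := hf
      change φ₂ f = 0
      rw [← e12, hf', map_zero]
    · simp [RingHom.mem_ker, φ₂]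
    · intro hf
      have hf' : φ₁ (X 1 - C (a 1)) = 0 := hf
      simp only [φ₁, map_sub, aeval_X, aeval_C, algebraMap_eq] at hf'
      exact hX 1 (a 1) (by simpa using hf')
  have l3 : RingHom.ker φ₂.toRingHom < RingHom.ker (eval a) := by
    refine SetLike.lt_iff_le_and_exists.2 ⟨fun f hf => ?_, X 2 - C (a 2), ?_, ?_⟩
    · have hf' : φ₂ f = 0 := hf
      rw [RingHom.mem_ker, ← e23, hf', map_zero]
    · simp [RingHom.mem_ker]
    · intro hf
      have hf' : φ₂ (X 2 - C (a 2)) = 0 := hf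
      simp only [φ₂, map_sub, aeval_X, aeval_C, algebraMap_eq] at hf'
      exact hX 2 (a 2) (by simpa using hf')
  have i1 := Ideal.height_add_one_le_of_lt_of_isPrime l1
  have i2 := Ideal.height_add_one_le_of_lt_of_isPrime l2
  have i3 := Ideal.height_add_one_le_of_lt_of_isPrime l3
  calc (3 : ℕ∞) = 0 + 1 + 1 + 1 := by norm_num
    _ ≤ _ := le_trans (add_le_add_left (add_le_add_left (add_le_add_left zero_le 1) 1) 1)
        (le_trans (add_le_add_left (add_le_add_left i1 1) 1) (le_trans (add_le_add_left i2 1) i3))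

theorem exists_prime_le_ker_eval {f g : Poly} {a : Fin 3 → ℝ} (hf : eval a f = 0)
    (hg : eval a g = 0) :
    ∃ P : Ideal Poly, P.IsPrime ∧ f ∈ P ∧ g ∈ P ∧ P ≤ RingHom.ker (eval a) ∧ ¬ P.IsMaximal := by
  classical
  have h₃ : (RingHom.ker (eval a)).IsPrime := RingHom.ker_isPrime _
  have hle : Ideal.span (({f, g} : Finset Poly) : Set Poly) ≤ RingHom.ker (eval a) := by
    rw [Ideal.span_le]
    intro x hx
    simp only [Finset.coe_insert, Finset.coe_singleton, Set.mem_insert_iff,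
      Set.mem_singleton_iff] at hx
    rcases hx with rfl | rfl
    exacts [hf, hg]
  obtain ⟨P, hP, hPle⟩ := Ideal.exists_minimalPrimes_le hle
  have hsub : ∀ x ∈ ({f, g} : Finset Poly), x ∈ P := fun x hx =>
    hP.1.2 (Ideal.subset_span hx)
  refine ⟨P, hP.1.1, hsub f (by simp), hsub g (by simp), hPle, fun hmax => ?_⟩
  have heq := hmax.eq_of_le h₃.ne_top hPle
  have h1 := Ideal.height_le_card_of_mem_minimalPrimes_span_finset hP
  rw [heq] at h1
  have h2 := height_ker_eval_ge a
  have h4 : ((({f, g} : Finset Poly).card : ℕ) : ℕ∞) ≤ 2 := by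
    exact_mod_cast Finset.card_le_two
  exact absurd (h2.trans (h1.trans h4)) (by decide)

theorem exists_degreeOf_pos {q : Poly} (hq : q ≠ 0) (hu : ¬ IsUnit q) : ∃ i, 1 ≤ degreeOf i q := by
  by_contra! h
  have h0 : totalDegree q = 0 := by
    rw [totalDegree_eq_zero_iff]
    intro m hm i
    have := (degreeOf_le_iff.1 (Nat.lt_one_iff.1 (h i)).le) m hm
    omega
  have h1 := totalDegree_eq_zero_iff_eq_C.1 h0
  have hc : coeff 0 q ≠ 0 := fun h2 => hq (by rw [h1, h2, map_zero])
  exact hu (by rw [h1]; exact (isUnit_iff_ne_zero.2 hc).map C)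

theorem lineForm_not_isUnit {z ν : Fin 3 → ℝ} : ¬ IsUnit (lineForm z ν) := fun h => by
  have := h.map (eval z)
  simp [lineForm] at this

theorem sum_degreeOf_le {ι : Type*} (s : Finset ι) (g : ι → Poly) {f : Poly} (hf : f ≠ 0)
    (hrel : (s : Set ι).Pairwise (Function.onFun IsRelPrime g))
    (hdvd : ∀ i ∈ s, g i ∣ f) (l : Fin 3) :
    ∑ i ∈ s, degreeOf l (g i) ≤ degreeOf l f := by
  obtain ⟨u, hu⟩ := Finset.prod_dvd_of_isRelPrime hrel hdvd
  have hg : ∀ i ∈ s, g i ≠ 0 := fun i hi h0 => hf (by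
    have := hdvd i hi; rwa [h0, zero_dvd_iff] at this)
  have hprod : (∏ i ∈ s, g i) ≠ 0 := Finset.prod_ne_zero_iff.2 hg
  have hu0 : u ≠ 0 := by rintro rfl; exact hf (by rw [hu, mul_zero])
  rw [← degreeOf_prod_eq s g hg, hu, degreeOf_mul_eq hprod hu0]
  exact Nat.le_add_right _ _

/-- A polynomial divisible by many translates of a linear form has large degree. -/
theorem not_forall_lineForm_dvd {z ν : Fin 3 → ℝ} (h01 : ν 0 ≠ 0 ∨ ν 1 ≠ 0) {f : Poly} (hf : f ≠ 0)
    {D : Fin 3 → ℕ} (hfD : f ∈ box D) (B : Finset (Fin 3 → ℝ))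
    (hB : max (D 0) (D 1) < (B.image fun v => ν 1 * v 0 - ν 0 * v 1).card) :
    ∃ β ∈ B, ¬ lineForm (z + β) ν ∣ f := by
  classical
  by_contra! h
  set F := B.image fun v => ν 1 * v 0 - ν 0 * v 1 with hF
  set c₀ := ν 1 * z 0 - ν 0 * z 1
  set g : ℝ → Poly := fun t => C (ν 1) * X 0 - C (ν 0) * X 1 - C (c₀ + t)
  have hg : ∀ t ∈ F, g t ∣ f := fun t ht => by
    obtain ⟨v, hv, rfl⟩ := Finset.mem_image.1 ht
    have := h v hv
    rw [lineForm_eq] at this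
    convert this using 3
    simp only [Pi.add_apply, c₀]; ring_nf
  have hg0 : ∀ t ∈ F, g t ≠ 0 := fun t ht h0 => hf (by
    have := hg t ht; rwa [h0, zero_dvd_iff] at this)
  have hrel : (F : Set ℝ).Pairwise (Function.onFun IsRelPrime g) := by
    intro s _ t _ hst
    refine IsCoprime.isRelPrime ⟨-C (1 / (s - t)), C (1 / (s - t)), ?_⟩
    have hst' : s - t ≠ 0 := sub_ne_zero.2 hst
    have : -C (1 / (s - t)) * g s + C (1 / (s - t)) * g t = C (1 / (s - t)) * (C s - C t) := by
      simp only [g, map_add]; ring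
    rw [this, ← map_sub, ← map_mul, one_div_mul_cancel hst', map_one]
  have hdeg : ∀ i : Fin 3, (∀ t, 1 ≤ degreeOf i (g t)) → F.card ≤ D i := fun i hi => by
    calc F.card = ∑ _t ∈ F, 1 := by simp
      _ ≤ ∑ t ∈ F, degreeOf i (g t) := Finset.sum_le_sum fun t _ => hi t
      _ ≤ degreeOf i f := sum_degreeOf_le F g hf hrel hg i
      _ ≤ D i := mem_box.1 hfD i
  have hpos : ∀ (i : Fin 3) (t : ℝ) (x y : Fin 3 → ℝ), (∀ j ≠ i, x j = y j) →
      eval x (g t) ≠ eval y (g t) → 1 ≤ degreeOf i (g t) := by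
    intro i t x y hxy hne
    by_contra hlt
    have h0 : degreeOf i (g t) = 0 := by omega
    refine hne (eval₂Hom_congr' rfl (fun j hj _ => ?_) rfl)
    refine hxy j ?_
    rintro rfl
    obtain ⟨m, hm, hjm⟩ := (mem_vars_iff_mem_support _).1 hj
    have := (degreeOf_le_iff.1 h0.le) m hm
    rw [Finsupp.mem_support_iff] at hjm
    omega
  rcases h01 with h0 | h1
  · have := hdeg 1 fun t => hpos 1 t ![0, 0, 0] ![0, 1, 0]
      (by intro j hj; fin_cases j <;> simp_all) (by
        simp [g]; intro h; apply h0; linarith)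
    omega
  · have := hdeg 0 fun t => hpos 0 t ![0, 0, 0] ![1, 0, 0]
      (by intro j hj; fin_cases j <;> simp_all) (by
        simp [g]; intro h; apply h1; linarith)
    omega

end ZeroEstimate

namespace ZeroEstimate

open MvPolynomial

/-- The span of the translates of `P` by the points of `B`. -/
noncomputable def translates (P : Poly) (B : Finset (Fin 3 → ℝ)) : Submodule ℝ Poly :=
  Submodule.span ℝ ((fun v => shift v P) '' B)

theorem shift_mem_translates {P : Poly} {B : Finset (Fin 3 → ℝ)} {v : Fin 3 → ℝ} (hv : v ∈ B) :
    shift v P ∈ translates P B := Submodule.subset_span ⟨v, hv, rfl⟩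

theorem translates_le {P : Poly} {B : Finset (Fin 3 → ℝ)} {N : Submodule ℝ Poly}
    (h : ∀ v ∈ B, shift v P ∈ N) : translates P B ≤ N := by
  rw [translates, Submodule.span_le]
  rintro _ ⟨v, hv, rfl⟩
  exact h v hv

theorem eval_pt_eq_zero_of_mem_translates {P f : Poly} {B : Finset (Fin 3 → ℝ)} {w : Fin 3 → ℝ}
    (h : ∀ v ∈ B, eval (pt (v + w)) P = 0) (hf : f ∈ translates P B) : eval (pt w) f = 0 := by
  have : translates P B ≤ LinearMap.ker (aeval (R := ℝ) (pt w) : Poly →ₐ[ℝ] ℝ).toLinearMap :=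
    translates_le fun v hv => by
      change aeval (pt w) (shift v P) = 0
      rw [aeval_eq_eval, eval_shift, add_comm, h v hv]
  simpa [aeval_eq_eval] using this hf

theorem translates_le_box {P : Poly} {B : Finset (Fin 3 → ℝ)} {D : Fin 3 → ℕ} (hP : P ∈ box D) :
    translates P B ≤ box D := translates_le fun v _ => shift_mem_box hP v

theorem le_of_forall_mul_le {a V C c : ℕ} (h : ∀ m, 2 ≤ m → a * m ≤ 6 * (m + c) * V + C) :
    a ≤ 6 * V := by
  by_contra! hlt
  have h1 := h (6 * c * V + C + 2) (by omega)
  have h2 : (6 * V + 1) * (6 * c * V + C + 2) ≤ a * (6 * c * V + C + 2) :=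
    Nat.mul_le_mul_right _ hlt
  nlinarith

/-- Hypotheses of the zero estimate on the translates. -/
structure Generic (B : Finset (Fin 3 → ℝ)) : Prop where
  zero_mem : (0 : Fin 3 → ℝ) ∈ B
  ne_zero : ∀ v ∈ B, ∀ w ∈ B, v ≠ w → ((w - v) 0 ≠ 0 ∨ (w - v) 1 ≠ 0) ∧ (w - v) 2 ≠ 0

theorem exists_not_dvd_shift {P q : Poly} (hP : P ≠ 0) {D : Fin 3 → ℕ} (hPD : P ∈ box D)
    (hq : Irreducible q) {z : Fin 3 → ℝ} (hz : eval (pt z) q = 0)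
    {B : Finset (Fin 3 → ℝ)} (hB : Generic B) (hcard : ∀ i, D i < B.card)
    (himg : ∀ c : Fin 2 → ℝ, c ≠ 0 →
      max (D 0) (D 1) < (B.image fun v => c 0 * v 0 + c 1 * v 1).card) :
    ∃ β ∈ B, ¬ q ∣ shift β P := by
  classical
  by_contra! h
  have hdvd : ∀ β ∈ B, shift (-β) q ∣ P := fun β hβ => by
    rw [shift_dvd_iff, neg_neg]; exact h β hβ
  have hirr : ∀ v, Irreducible (shift v q) := fun v =>
    (MulEquiv.irreducible_iff (shiftEquiv v)).2 hq
  by_cases hrel : (B : Set (Fin 3 → ℝ)).Pairwise (Function.onFun IsRelPrime fun β => shift (-β) q)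
  · obtain ⟨i, hi⟩ := exists_degreeOf_pos hq.ne_zero hq.not_isUnit
    have h1 := sum_degreeOf_le B _ hP hrel hdvd i
    simp only [degreeOf_shift, Finset.sum_const, smul_eq_mul] at h1
    have h2 := mem_box.1 hPD i
    have h3 := hcard i
    nlinarith
  · simp only [Set.Pairwise, not_forall, Function.onFun] at hrel
    obtain ⟨v, hv, w, hw, hvw, hn⟩ := hrel
    have hd : shift (-v) q ∣ shift (-w) q := by
      by_contra hnd
      exact hn ((hirr _).isRelPrime_iff_not_dvd.2 hnd)
    obtain ⟨⟨h01, h2⟩⟩ : ∃ _ : (((w - v) 0 ≠ 0 ∨ (w - v) 1 ≠ 0) ∧ (w - v) 2 ≠ 0), True :=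
      ⟨hB.ne_zero v hv w hw hvw, trivial⟩
    set ν := w - v
    have hd' : shift ν q ∣ q := by
      rw [shift_dvd_iff, neg_neg, shift_shift] at hd
      rw [shift_dvd_iff]
      have : -ν = v - w := by simp [ν]
      rwa [this, sub_eq_add_neg]
    have hass : q ∣ shift ν q := ((hirr ν).dvd_symm hq) hd'
    have hall : ∀ j : ℕ, eval (pt (z + (j : ℝ) • ν)) q = 0 := by
      intro j
      induction j with
      | zero => simpa using hz
      | succ j ih =>
        obtain ⟨u, hu⟩ := hass
        have h5 := eval_shift ν (z + (j : ℝ) • ν) q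
        rw [hu, map_mul, ih, zero_mul] at h5
        rw [h5]
        congr 2
        push_cast
        rw [add_smul, one_smul, ← add_assoc]
    have hl := lineForm_dvd h01 h2 hall
    obtain ⟨β, hβ, hnβ⟩ := not_forall_lineForm_dvd (z := z) h01 hP hPD B (by
      have := himg ![ν 1, -ν 0] (by
        intro h0
        have e0 := congrFun h0 0
        have e1 := congrFun h0 1
        simp at e0 e1
        tauto)
      simpa [sub_eq_add_neg] using this)
    refine hnβ ?_
    have h6 : shift (-β) (lineForm z ν) ∣ shift (-β) q := map_dvd _ hl
    rw [shift_lineForm, sub_neg_eq_add] at h6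
    exact h6.trans (hdvd β hβ)

theorem exists_isRelPrime_translate {P : Poly} (hP : P ≠ 0) (hPu : ¬ IsUnit P)
    {B : Finset (Fin 3 → ℝ)} (h : ∀ q, Irreducible q → q ∣ P → ∃ β ∈ B, ¬ q ∣ shift β P) :
    ∃ f ∈ translates P B, f ≠ 0 ∧ IsRelPrime P f := by
  classical
  let F := (UniqueFactorizationMonoid.factors P).toFinset
  have hFirr : ∀ q ∈ F, Irreducible q := fun q hq =>
    UniqueFactorizationMonoid.irreducible_of_factor q (Multiset.mem_toFinset.1 hq)
  have hFdvd : ∀ q ∈ F, q ∣ P := fun q hq =>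
    UniqueFactorizationMonoid.dvd_of_mem_factors (Multiset.mem_toFinset.1 hq)
  obtain ⟨f, hf, hfq⟩ := exists_mem_forall_notMem (translates P B)
    (fun q : F => (Ideal.span {q.1}).restrictScalars ℝ) (fun q => by
      obtain ⟨β, hβ, hn⟩ := h q (hFirr q q.2) (hFdvd q q.2)
      exact ⟨_, shift_mem_translates hβ, fun hm => hn (Ideal.mem_span_singleton.1 hm)⟩)
  have hkey : ∀ z : Poly, Irreducible z → z ∣ P → ¬ z ∣ f := fun z hz hzP hzf => by
    obtain ⟨q, hq, hzq⟩ := UniqueFactorizationMonoid.exists_mem_factors_of_dvd hP hz hzP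
    exact hfq ⟨q, Multiset.mem_toFinset.2 hq⟩ (Ideal.mem_span_singleton.2 (hzq.symm.dvd.trans hzf))
  obtain ⟨z, hz, hzP⟩ := WfDvdMonoid.exists_irreducible_factor hPu hP
  refine ⟨f, hf, fun h0 => hkey z hz hzP (h0 ▸ dvd_zero z), ?_⟩
  exact WfDvdMonoid.isRelPrime_of_no_irreducible_factors (fun h0 => hP h0.1) hkey

theorem exists_shift_notMem {P f : Poly} (hP : P ≠ 0) (hf : f ≠ 0) (hrel : IsRelPrime P f)
    {D : Fin 3 → ℕ} (hD : ∀ i, 1 ≤ D i) (hPD : P ∈ box D) (hfD : f ∈ box D)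
    {A B : Finset (Fin 3 → ℝ)} (hA : Generic A) (hB0 : 0 ∈ B) (hfB : f ∈ translates P B)
    (hcard : 6 * (D 0 * D 1 * D 2) < A.card) {Q : Ideal Poly} (hQ : Q.IsPrime)
    (hmax : ¬ Q.IsMaximal) {z : Fin 3 → ℝ} (hQz : Q ≤ RingHom.ker (eval (pt z))) :
    ∃ v ∈ A, ∃ w ∈ B, shift (v + w) P ∉ Q := by
  by_contra! h
  let R : A → Ideal Poly := fun v => Q.comap (shift v.1)
  have hmem : ∀ v g, g ∈ R v ↔ shift v.1 g ∈ Q := fun v g => Ideal.mem_comap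
  have hPR : ∀ v, P ∈ R v := fun v => by
    have := h v v.2 0 hB0
    rwa [hmem, ← add_zero v.1]
  have hfR : ∀ v, f ∈ R v := fun v => by
    have : translates P B ≤ (R v).restrictScalars ℝ := translates_le fun w hw => by
      rw [Submodule.restrictScalars_mem, hmem, shift_shift]; exact h v v.2 w hw
    exact this hfB
  have hinc : ∀ v w, v ≠ w → ¬ R v ≤ R w := by
    intro v w hvw hle
    obtain ⟨h01, h2⟩ := hA.ne_zero v v.2 w w.2 (fun h => hvw (Subtype.ext h))
    set ν := w.1 - v.1
    have hstep : ∀ g, g ∈ Q → shift ν g ∈ Q := fun g hg => by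
      have h1 : shift (-v.1) g ∈ R v := by rw [hmem, shift_shift_neg]; exact hg
      have h2 := (hmem _ _).1 (hle h1)
      rwa [shift_shift, ← sub_eq_add_neg] at h2
    have hiter : ∀ g, g ∈ Q → ∀ j : ℕ, eval (pt (z + (j : ℝ) • ν)) g = 0 := by
      intro g hg j
      induction j generalizing g with
      | zero => simpa using RingHom.mem_ker.1 (hQz hg)
      | succ j ih =>
        have := ih _ (hstep g hg)
        rw [eval_shift] at this
        rw [← this]
        congr 2
        push_cast
        rw [add_smul, one_smul, ← add_assoc]
    have hall : ∀ g, g ∈ R v → lineForm z ν ∣ shift v.1 g := fun g hg =>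
      lineForm_dvd h01 h2 (hiter _ hg)
    have hd : ∀ g, g ∈ R v → shift (-v.1) (lineForm z ν) ∣ g := fun g hg => by
      rw [shift_dvd_iff, neg_neg]; exact hall g hg
    have hu := hrel (hd P (hPR v)) (hd f (hfR v))
    rw [shift_lineForm] at hu
    exact lineForm_not_isUnit hu
  have hRp : ∀ v, (R v).IsPrime := fun v => Ideal.comap_isPrime _ _
  have hRm : ∀ v, ¬ (R v).IsMaximal := fun v hm => hmax (by
    have hmap : Q = (R v).comap (shift (-v.1)) := by
      ext g
      rw [Ideal.mem_comap, hmem, shift_shift_neg]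
    rw [hmap]
    exact Ideal.comap_isMaximal_of_surjective _ fun g => ⟨shift v.1 g, shift_neg_shift _ _⟩)
  obtain ⟨c, hc⟩ := exists_hilb_iInf_ge R hRp hRm hinc hD
  refine absurd hcard (not_lt.2 (le_of_forall_mul_le
    (C := 2 * (D 0 * D 1 + D 0 * D 2 + D 1 * D 2)) (c := c) (fun m hm => ?_)))
  have h1 := hc m
  rw [Fintype.card_coe] at h1
  exact (Nat.mul_le_mul_left _ (Nat.le_succ m)).trans (h1.trans (hilb_le hP hf hrel hPD hfD
    ((Ideal.mem_iInf).2 hPR) ((Ideal.mem_iInf).2 hfR) (by omega)))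

/-- Zero estimate on `ℝ × ℝ × ℝ^*`: a nonzero polynomial of bounded degrees cannot vanish on a
sumset of large generic sets. -/
theorem eq_zero_of_vanish {D : Fin 3 → ℕ} (hD : ∀ i, 1 ≤ D i) {A B E : Finset (Fin 3 → ℝ)}
    (hA : Generic A) (hB : Generic B) (hE : Generic E)
    (hAcard : 6 * (D 0 * D 1 * D 2) < A.card) (hEcard : 6 * (D 0 * D 1 * D 2) < E.card)
    (hBcard : ∀ i, D i < B.card)
    (hBimg : ∀ c : Fin 2 → ℝ, c ≠ 0 →
      max (D 0) (D 1) < (B.image fun v => c 0 * v 0 + c 1 * v 1).card)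
    (P : Poly) (hPD : P ∈ box D)
    (hP : ∀ a ∈ A, ∀ b ∈ B, ∀ e ∈ E, eval (pt (a + b + e)) P = 0) : P = 0 := by
  classical
  induction hdeg : totalDegree P using Nat.strong_induction_on generalizing P with
  | _ d ih => ?_
  by_contra hP0
  have hroot : ∀ q, Irreducible q → q ∣ P → ∃ z, eval (pt z) q = 0 := by
    rintro q hq ⟨P', rfl⟩
    have hP'0 : P' ≠ 0 := right_ne_zero_of_mul hP0
    by_contra! hz
    obtain ⟨i, hi⟩ := exists_degreeOf_pos hq.ne_zero hq.not_isUnit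
    have h1 : totalDegree P' < d := by
      rw [← hdeg, totalDegree_mul_of_isDomain hq.ne_zero hP'0]
      have := degreeOf_le_totalDegree q i
      omega
    refine hP'0 (ih _ h1 P' (mem_box.2 fun i => ?_) (fun a ha b hb e he => ?_) rfl)
    · have := mem_box.1 hPD i
      rw [degreeOf_mul_eq hq.ne_zero hP'0] at this
      omega
    · have := hP a ha b hb e he
      rw [map_mul] at this
      exact (mul_eq_zero.1 this).resolve_left (hz _)
  have hPu : ¬ IsUnit P := fun hu => by
    have h1 := hP 0 hA.zero_mem 0 hB.zero_mem 0 hE.zero_mem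
    exact (hu.map (eval (pt (0 + 0 + 0)))).ne_zero h1
  obtain ⟨f, hfT, hf0, hrel⟩ := exists_isRelPrime_translate hP0 hPu (B := B) fun q hq hqP => by
    obtain ⟨z, hz⟩ := hroot q hq hqP
    exact exists_not_dvd_shift hP0 hPD hq hz hB hBcard hBimg
  have hfD : f ∈ box D := translates_le_box hPD hfT
  have hPz : ∀ z ∈ E, eval (pt z) P = 0 := fun z hz => by
    simpa using hP 0 hA.zero_mem 0 hB.zero_mem z hz
  have hfz : ∀ z ∈ E, eval (pt z) f = 0 := fun z hz =>
    eval_pt_eq_zero_of_mem_translates (fun v hv => by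
      simpa using hP 0 hA.zero_mem v hv z hz) hfT
  choose Q hQp hPQ hfQ hQle hQm using fun z : E => exists_prime_le_ker_eval (hPz z z.2) (hfz z z.2)
  set G : Finset (Fin 3 → ℝ) := (A ×ˢ B).image fun p => p.1 + p.2
  obtain ⟨g, hg, hgQ⟩ := exists_mem_forall_notMem (translates P G)
    (fun z => (Q z).restrictScalars ℝ) (fun z => by
      obtain ⟨v, hv, w, hw, hn⟩ := exists_shift_notMem hP0 hf0 hrel hD hPD hfD hA hB.zero_mem hfT
        hAcard (hQp z) (hQm z) (hQle z)
      exact ⟨_, shift_mem_translates (Finset.mem_image.2 ⟨(v, w), by simp [hv, hw], rfl⟩), hn⟩)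
  have hgz : ∀ z ∈ E, eval (pt z) g = 0 := fun z hz =>
    eval_pt_eq_zero_of_mem_translates (fun v hv => by
      obtain ⟨⟨v, w⟩, hvw, rfl⟩ := Finset.mem_image.1 hv
      rw [Finset.mem_product] at hvw
      exact hP v hvw.1 w hvw.2 z hz) hg
  set I := ⨅ z, Q z
  have hstep : ∀ n, E.card ≤ n → hilb I (n • D) + E.card ≤ hilb I ((n + 1) • D) := fun n hn => by
    refine hilb_succ_ge (hD 2) (translates_le_box hPD hg) (fun u hu => ?_) E ?_ hgz ?_ hn
    · simp only [I, Ideal.mem_iInf] at hu ⊢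
      exact fun z => ((hQp z).mem_or_mem (hu z)).resolve_left (hgQ z)
    · intro v hv w hw hvw
      by_contra hne
      exact (hE.ne_zero v hv w hw hne).2 (by simpa [sub_eq_zero] using hvw.symm)
    · intro f hf z hz
      simp only [I, Ideal.mem_iInf] at hf
      exact hQle ⟨z, hz⟩ (hf ⟨z, hz⟩)
  have hgrow : ∀ j, j * E.card ≤ hilb I ((E.card + j) • D) := by
    intro j
    induction j with
    | zero => simp
    | succ j ihj =>
      have := hstep (E.card + j) (by omega)
      rw [add_mul, one_mul, ← add_assoc]
      omega
  refine absurd hEcard (not_lt.2 (le_of_forall_mul_le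
    (C := 2 * (D 0 * D 1 + D 0 * D 2 + D 1 * D 2)) (c := E.card) (fun m hm => ?_)))
  have h1 := hgrow m
  rw [mul_comm, add_comm] at h1
  exact h1.trans (hilb_le hP0 hf0 hrel hPD hfD ((Ideal.mem_iInf).2 hPQ) ((Ideal.mem_iInf).2 hfQ)
    (by omega))

end ZeroEstimate

namespace InterpolationDet

open Matrix Finset

theorem exists_taylor_remainder {f : ℂ → ℂ} (hf : Differentiable ℂ f) (M : ℕ) :
    ∃ (a : ℕ → ℂ) (g : ℂ → ℂ), Differentiable ℂ g ∧
      ∀ t, f t = ∑ k ∈ range M, a k * t ^ k + t ^ M * g t := by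
  induction M with
  | zero => exact ⟨0, f, hf, fun t => by simp⟩
  | succ M ih =>
    obtain ⟨a, g, hg, h⟩ := ih
    refine ⟨fun k => if k = M then g 0 else a k, dslope g 0, ?_, fun t => ?_⟩
    · rw [← differentiableOn_univ] at hg ⊢
      exact (Complex.differentiableOn_dslope Filter.univ_mem).2 hg
    · have h1 : g t = g 0 + t * dslope g 0 t := by
        have := sub_smul_dslope g 0 t
        simp only [sub_zero, smul_eq_mul] at this
        rw [this]; ring
      rw [h t, sum_range_succ, h1]
      have h2 : ∑ k ∈ range M, (if k = M then g 0 else a k) * t ^ k = ∑ k ∈ range M, a k * t ^ k :=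
        sum_congr rfl fun k hk => by rw [if_neg (Finset.mem_range.1 hk).ne]
      simp only [h2, if_true]
      ring

/-- A unitary matrix whose `p`-th row annihilates the first `p` of the given vectors. -/
theorem exists_triangularizing {N : ℕ} (u : ℕ → Fin N → ℂ) :
    ∃ P : Matrix (Fin N) (Fin N) ℂ, P.det ≠ 0 ∧
      ∀ p : Fin N, ∀ e < (p : ℕ), ∑ q, P p q * u e q = 0 := by
  let f : Fin N → EuclideanSpace ℂ (Fin N) := fun e => WithLp.toLp 2 (u e)
  let B := InnerProductSpace.gramSchmidtOrthonormalBasis (𝕜 := ℂ)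
    (by simp : Module.finrank ℂ (EuclideanSpace ℂ (Fin N)) = Fintype.card (Fin N)) f
  let Q : Matrix (Fin N) (Fin N) ℂ := Matrix.of fun p q => B p q
  refine ⟨Matrix.of fun p q => star (B p q), ?_, fun p e he => ?_⟩
  · have hQ : (Matrix.of fun p q => star (B p q)) * Qᵀ = 1 := by
      ext i j
      have := orthonormal_iff_ite.1 B.orthonormal i j
      rw [Matrix.mul_apply, Matrix.one_apply, ← this]
      rw [PiLp.inner_apply]
      simp [Q, mul_comm]
    exact fun h => by
      have := congrArg Matrix.det hQ
      rw [Matrix.det_mul, h, zero_mul, Matrix.det_one] at this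
      exact zero_ne_one this
  · have heN : e < N := he.trans p.2
    have := InnerProductSpace.gramSchmidtOrthonormalBasis_inv_triangular (𝕜 := ℂ)
      (by simp : Module.finrank ℂ (EuclideanSpace ℂ (Fin N)) = Fintype.card (Fin N)) f
      (i := ⟨e, heN⟩) (j := p) he
    rw [PiLp.inner_apply] at this
    rw [← this]
    refine Finset.sum_congr rfl fun q _ => ?_
    simp [f, B, mul_comm]

theorem norm_det_mul_pow_le {N : ℕ} {A : ℂ → Matrix (Fin N) (Fin N) ℂ}
    {P : Matrix (Fin N) (Fin N) ℂ} (hP : P.det ≠ 0) (o : Fin N → ℕ)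
    (g : ℂ → Matrix (Fin N) (Fin N) ℂ) (hg : ∀ p c, Differentiable ℂ fun x => g x p c)
    (hPA : ∀ x p c, (P * A x) p c = x ^ o p * g x p c) {ρ β : ℝ} (hρ : 1 ≤ ρ)
    (hβ : ∀ x : ℂ, ‖x‖ = ρ → ∀ p c, ‖A x p c‖ ≤ β) :
    ‖(A 1).det‖ * ρ ^ (∑ p, o p) ≤ N.factorial * β ^ N := by
  have hdet : ∀ x, P.det * (A x).det = x ^ (∑ p, o p) * (g x).det := fun x => by
    have : P * A x = Matrix.of fun p c => x ^ o p * g x p c := by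
      ext p c; exact hPA x p c
    rw [← Matrix.det_mul, this, Matrix.det_mul_column, Finset.prod_pow_eq_pow_sum]
  have hdiff : Differentiable ℂ fun x => (g x).det := by
    simp only [Matrix.det_apply]
    refine Differentiable.fun_sum fun σ _ => Differentiable.const_smul ?_ _
    exact Differentiable.fun_finsetProd fun i _ => hg _ _
  have hρ0 : 0 < ρ := by linarith
  set C := ‖P.det‖ * (N.factorial * β ^ N) / ρ ^ (∑ p, o p)
  have hC : ‖(g 1).det‖ ≤ C := by
    refine Complex.norm_le_of_forall_mem_frontier_norm_le (U := Metric.ball 0 ρ)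
      Metric.isBounded_ball hdiff.diffContOnCl (fun x hx => ?_) ?_
    · rw [frontier_ball _ hρ0.ne', mem_sphere_zero_iff_norm] at hx
      have h1 := congrArg norm (hdet x)
      rw [norm_mul, norm_mul, norm_pow, hx] at h1
      rw [le_div_iff₀ (by positivity), mul_comm, ← h1]
      gcongr
      have h2 := Matrix.det_le (A := A x) (abv := IsAbsoluteValue.toAbsoluteValue (norm : ℂ → ℝ))
        (x := β) (fun i j => hβ x hx i j)
      simpa using h2
    · rw [closure_ball _ hρ0.ne', mem_closedBall_zero_iff, norm_one]
      exact hρ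
  have h1 := congrArg norm (hdet 1)
  rw [one_pow, one_mul, norm_mul] at h1
  rw [← h1, le_div_iff₀ (by positivity)] at hC
  have hP' : 0 < ‖P.det‖ := norm_pos_iff.2 hP
  rw [mul_assoc] at hC
  exact le_of_mul_le_mul_left hC hP'

/-- Upper bound for an interpolation determinant. -/
theorem norm_det_le {N G M : ℕ} (hG : 1 ≤ G) (hN : N ≤ G * M) (w z : Fin N → ℂ)
    (f : Fin N → ℕ → ℂ → ℂ) (hf : ∀ c i, Differentiable ℂ (f c i))
    (R : Fin N → Fin N → ℂ → ℂ) (hR : ∀ p c, Differentiable ℂ (R p c))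
    (A : ℂ → Matrix (Fin N) (Fin N) ℂ)
    (hA : ∀ x p c, A x p c = ∑ i ∈ range G, w p ^ i * f c i (x * z p) + x ^ M * R p c x)
    {ρ β : ℝ} (hρ : 1 ≤ ρ) (hβ : ∀ x : ℂ, ‖x‖ = ρ → ∀ p c, ‖A x p c‖ ≤ β) :
    ‖(A 1).det‖ * ρ ^ (∑ p ∈ range N, p / G) ≤ N.factorial * β ^ N := by
  obtain ⟨P, hP, hPu⟩ := exists_triangularizing fun e (q : Fin N) => w q ^ (e % G) * z q ^ (e / G)
  choose a g hg hfa using fun c i => exists_taylor_remainder (hf c i) M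
  have hpM : ∀ p : Fin N, (p : ℕ) / G ≤ M := fun p =>
    (Nat.div_lt_of_lt_mul (p.2.trans_le hN)).le
  rw [← Fin.sum_univ_eq_sum_range (fun p => p / G)]
  refine norm_det_mul_pow_le hP _ (fun x => Matrix.of fun p c =>
      (∑ i ∈ range G, ∑ k ∈ (range M).filter (fun k => (p : ℕ) / G ≤ k),
        a c i k * x ^ (k - (p : ℕ) / G) * ∑ q, P p q * (w q ^ i * z q ^ k)) +
      x ^ (M - (p : ℕ) / G) * ∑ q, P p q * (∑ i ∈ range G, w q ^ i * (z q ^ M * g c i (x * z q))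
        + R q c x)) (fun p c => ?_) (fun x p c => ?_) hρ hβ
  · simp only [Matrix.of_apply]
    have := hR
    have := hg
    fun_prop
  · simp only [Matrix.of_apply, Matrix.mul_apply, hA]
    have h1 : ∀ q, P p q * (∑ i ∈ range G, w q ^ i * f c i (x * z q) + x ^ M * R q c x) =
        (∑ i ∈ range G, ∑ k ∈ range M, a c i k * x ^ k * (P p q * (w q ^ i * z q ^ k))) +
        x ^ M * (P p q * (∑ i ∈ range G, w q ^ i * (z q ^ M * g c i (x * z q)) + R q c x)) := by
      intro q
      have h2 : ∀ i, w q ^ i * f c i (x * z q) =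
          (∑ k ∈ range M, a c i k * x ^ k * (w q ^ i * z q ^ k)) +
            x ^ M * (w q ^ i * (z q ^ M * g c i (x * z q))) := fun i => by
        rw [hfa c i, mul_add, mul_sum, mul_pow]
        congr 1
        · exact sum_congr rfl fun k _ => by rw [mul_pow]; ring
        · ring
      simp only [h2, sum_add_distrib, mul_add, mul_sum]
      rw [add_assoc]
      congr 1
      · exact sum_congr rfl fun i _ => sum_congr rfl fun k _ => by ring
      · congr 1
        · exact sum_congr rfl fun i _ => by ring
        · ring
    simp only [h1, sum_add_distrib, mul_add]
    congr 1
    · rw [sum_comm, mul_sum]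
      refine sum_congr rfl fun i hi => ?_
      rw [sum_comm, mul_sum, sum_filter]
      refine sum_congr rfl fun k _ => ?_
      rw [← mul_sum]
      split_ifs with hk
      · have h3 : x ^ k = x ^ ((p : ℕ) / G) * x ^ (k - (p : ℕ) / G) := by
          rw [← pow_add, Nat.add_sub_cancel' hk]
        rw [h3]; ring
      · have hi' : i < G := Finset.mem_range.1 hi
        have hlt : k * G + i < p := by
          have h3 : k + 1 ≤ (p : ℕ) / G := by omega
          have h4 := (Nat.le_div_iff_mul_le (by omega : 0 < G)).1 h3
          rw [add_mul, one_mul] at h4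
          omega
        have h5 := hPu p _ hlt
        have h6 : (k * G + i) % G = i := by
          rw [add_comm, Nat.add_mul_mod_self_right, Nat.mod_eq_of_lt hi']
        have h7 : (k * G + i) / G = k := by
          rw [add_comm, Nat.add_mul_div_right _ _ (by omega), Nat.div_eq_of_lt hi', zero_add]
        rw [h6, h7] at h5
        rw [h5, mul_zero]
    · have h3 : x ^ M = x ^ ((p : ℕ) / G) * x ^ (M - (p : ℕ) / G) := by
        rw [← pow_add, Nat.add_sub_cancel' (hpM p)]
      rw [← mul_sum, ← mul_add, ← mul_sum, h3]
      ring

end InterpolationDet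

namespace InterpolationDet

open Matrix Finset Polynomial

/-- The binomial coefficient `x ↦ x.choose j` as a polynomial. -/
noncomputable def choosePoly (𝕜 : Type*) [Field 𝕜] (j : ℕ) : 𝕜[X] :=
  C (j.factorial : 𝕜)⁻¹ * descPochhammer 𝕜 j

theorem choosePoly_eval_nat (𝕜 : Type*) [Field 𝕜] [CharZero 𝕜] (j n : ℕ) :
    (choosePoly 𝕜 j).eval (n : 𝕜) = (n.choose j : 𝕜) := by
  have : (j.factorial : 𝕜) ≠ 0 := by exact_mod_cast j.factorial_ne_zero
  rw [choosePoly, eval_mul, eval_C, descPochhammer_eval_eq_descFactorial,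
    Nat.descFactorial_eq_factorial_mul_choose]
  push_cast
  field_simp

theorem natDegree_choosePoly_le (𝕜 : Type*) [Field 𝕜] (j : ℕ) : (choosePoly 𝕜 j).natDegree ≤ j :=
  (natDegree_C_mul_le _ _).trans (descPochhammer_natDegree 𝕜 j).le

theorem norm_choosePoly_eval_le (j : ℕ) (x : ℂ) :
    ‖(choosePoly ℂ j).eval x‖ ≤ (‖x‖ + j) ^ j / j.factorial := by
  rw [choosePoly, eval_mul, eval_C, descPochhammer_eval_eq_prod_range, norm_mul, norm_prod,
    norm_inv, RCLike.norm_natCast, div_eq_inv_mul]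
  gcongr
  calc ∏ i ∈ range j, ‖x - i‖ ≤ ∏ _i ∈ range j, (‖x‖ + j) := by
        refine Finset.prod_le_prod (fun _ _ => norm_nonneg _) fun i hi => ?_
        have hi' : (i : ℝ) ≤ j := by exact_mod_cast (Finset.mem_range.1 hi).le
        have := norm_sub_le x (i : ℂ)
        rw [RCLike.norm_natCast] at this
        linarith
    _ = _ := by simp

theorem exists_expansion (A B : ℂ[X]) (θ : ℂ) {G : ℕ}
    (hG : A.natDegree + B.natDegree < G ∨ (θ = 0 ∧ A.natDegree < G)) :
    ∃ f : ℕ → ℂ → ℂ, (∀ i, Differentiable ℂ (f i)) ∧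
      ∀ Y t, A.eval Y * B.eval (t - θ * Y) = ∑ i ∈ range G, Y ^ i * f i t := by
  refine ⟨fun i t => (A * (taylor t B).comp (C (-θ) * X)).coeff i, fun i => ?_, fun Y t => ?_⟩
  · simp only [coeff_mul, comp_C_mul_X_coeff, taylor_coeff]
    fun_prop
  · have hdeg : (A * (taylor t B).comp (C (-θ) * X)).natDegree < G := by
      refine natDegree_mul_le.trans_lt ?_
      rcases hG with h | ⟨rfl, h⟩
      · refine lt_of_le_of_lt (Nat.add_le_add_left ?_ _) h
        refine natDegree_comp_le.trans ?_
        rw [natDegree_taylor]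
        have : (C (-θ) * X : ℂ[X]).natDegree ≤ 1 := (natDegree_C_mul_le _ _).trans natDegree_X_le
        nlinarith
      · simpa using h
    have h1 : (A * (taylor t B).comp (C (-θ) * X)).eval Y = A.eval Y * B.eval (t - θ * Y) := by
      rw [eval_mul, eval_comp, taylor_eval, eval_mul, eval_C, eval_X]
      congr 2; ring
    rw [← h1, eval_eq_sum_range' hdeg]
    exact sum_congr rfl fun i _ => mul_comm _ _

theorem exists_exp_remainder (l : ℂ) (c z e : ℂ) (M : ℕ) :
    ∃ R : ℂ → ℂ, Differentiable ℂ R ∧ ∀ x, Complex.exp (l * (c * (x * z) + x ^ M * e)) =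
      Complex.exp (l * (c * (x * z))) + x ^ M * R x := by
  obtain ⟨a, g, hg, h⟩ := exists_taylor_remainder (f := fun y => Complex.exp (l * (y * e)))
    (by fun_prop) 1
  have ha : a 0 = 1 := by simpa using (h 0).symm
  refine ⟨fun x => Complex.exp (l * (c * (x * z))) * g (x ^ M), by fun_prop, fun x => ?_⟩
  have := h (x ^ M)
  simp only [range_one, sum_singleton, ha, pow_zero, pow_one] at this
  rw [mul_add, Complex.exp_add, this]
  ring

/-- The interpolation determinant inequality: a lower bound for a nonvanishing determinant, whose
entries are binomial coefficients times powers of ring elements, against its analytic upper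
bound. -/
theorem interpolation_inequality {O : Type*} [CommRing O] (φ₁ φ₂ : O →+* ℝ)
    (hφ : ∀ x : O, x ≠ 0 → 1 ≤ |φ₁ x| * |φ₂ x|) {P : Type*} (X₁ X₂ : P → ℕ) (η κ : P → O)
    (hη : ∀ p, 0 < φ₁ (η p)) (hκ : ∀ p, 0 < φ₁ (κ p)) {c θ : ℝ} (ε : P → ℝ)
    (hlog : ∀ p, Real.log (φ₁ (η p)) - Real.log (φ₁ (κ p)) = c * (X₂ p + θ * X₁ p) + ε p)
    (hθ : |θ| ≤ 1) {K₁ K₂ S G M : ℕ} (hG1 : 1 ≤ G)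
    (hG : K₁ + K₂ ≤ G + 1 ∨ (θ = 0 ∧ K₁ ≤ G)) (hM : K₁ * (K₂ * S) ≤ G * M)
    {ρ : ℝ} (hρ : 1 ≤ ρ) (hε : ∀ p, ρ ^ M * |ε p| ≤ 1)
    (hinj : ∀ a : Fin K₁ × Fin K₂ × Fin S → ℝ, (∀ p, ∑ t, ((X₁ p).choose t.1 : ℝ) *
      ((X₂ p).choose t.2.1 : ℝ) * (φ₁ (η p) / φ₁ (κ p)) ^ (t.2.2 : ℕ) * a t = 0) → a = 0)
    {a₁ a₂ a₃ h₁ h₂ z₀ : ℝ} (ha₁ : ∀ p, ∀ i < K₁, ((X₁ p).choose i : ℝ) ≤ Real.exp a₁)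
    (ha₂ : ∀ p, ∀ i < K₂, ((X₂ p).choose i : ℝ) ≤ Real.exp a₂)
    (ha₃ : ∀ p, ∀ i < K₂, (ρ * (X₁ p + X₂ p) + X₁ p + i) ^ i / (i.factorial : ℝ) ≤ Real.exp a₃)
    (hh₁ : ∀ p, Real.log (φ₁ (κ p)) ≤ h₁) (hh₂ : ∀ p, |φ₂ (η p)| ≤ Real.exp h₂)
    (hh₂' : ∀ p, |φ₂ (κ p)| ≤ Real.exp h₂) (hz : ∀ p, |c * (X₂ p + θ * X₁ p)| ≤ z₀) :
    (∑ p ∈ range (K₁ * (K₂ * S)), p / G : ℕ) * Real.log ρ ≤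
      (K₁ * (K₂ * S) : ℕ) * (2 * Real.log (K₁ * (K₂ * S) : ℕ) + (2 * a₁ + a₂ + a₃) +
        (S - 1 : ℕ) * (h₁ + h₂ + ρ * z₀ + 1)) := by
  classical
  set N := K₁ * (K₂ * S) with hNdef
  rcases Nat.eq_zero_or_pos N with hN0 | hNpos
  · simp [hN0]
  have hcard : Fintype.card (Fin K₁ × Fin K₂ × Fin S) = N := by simp [hNdef]
  set e := Fintype.equivFinOfCardEq hcard
  let A₀ : P → Fin K₁ × Fin K₂ × Fin S → ℝ := fun p t => ((X₁ p).choose t.1 : ℝ) *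
      ((X₂ p).choose t.2.1 : ℝ) * (φ₁ (η p) / φ₁ (κ p)) ^ (t.2.2 : ℕ)
  obtain ⟨q, hq⟩ := exists_submatrix_det_ne_zero A₀ hinj
  let τ : Fin N → P := fun i => q (e.symm i)
  have hA₀det : (Matrix.of fun i j : Fin N => A₀ (τ i) (e.symm j)).det ≠ 0 := by
    have := Matrix.det_submatrix_equiv_self e.symm (Matrix.of fun i j => A₀ (q i) j)
    rw [← this] at hq
    exact hq
  -- the determinant over `O`
  let DO : Matrix (Fin N) (Fin N) O := Matrix.of fun i j =>
    ((X₁ (τ i)).choose (e.symm j).1 : O) * ((X₂ (τ i)).choose (e.symm j).2.1 : O) *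
      (η (τ i) ^ ((e.symm j).2.2 : ℕ) * κ (τ i) ^ (S - 1 - ((e.symm j).2.2 : ℕ)))
  have hφDO : φ₁ DO.det = (∏ i, φ₁ (κ (τ i)) ^ (S - 1)) *
      (Matrix.of fun i j : Fin N => A₀ (τ i) (e.symm j)).det := by
    rw [RingHom.map_det, ← Matrix.det_mul_column]
    congr 1
    ext i j
    have hk := (hκ (τ i)).ne'
    have hj : ((e.symm j).2.2 : ℕ) ≤ S - 1 := by have := (e.symm j).2.2.2; omega
    simp only [DO, A₀, RingHom.mapMatrix_apply, Matrix.map_apply, Matrix.of_apply, map_mul, map_pow,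
      map_natCast, div_pow]
    have hpow : φ₁ (κ (τ i)) ^ (S - 1) = φ₁ (κ (τ i)) ^ ((e.symm j).2.2 : ℕ) *
        φ₁ (κ (τ i)) ^ (S - 1 - ((e.symm j).2.2 : ℕ)) := by
      rw [← pow_add, Nat.add_sub_cancel' hj]
    rw [hpow]
    field_simp
  have hDO : DO.det ≠ 0 := fun h0 => by
    rw [h0, map_zero] at hφDO
    exact mul_ne_zero (Finset.prod_ne_zero_iff.2 fun i _ => pow_ne_zero _ (hκ _).ne') hA₀det
      hφDO.symm
  have hnorm := hφ _ hDO
  -- bound for the conjugate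
  have hφ₂ : |φ₂ DO.det| ≤ N.factorial * Real.exp (a₁ + a₂ + (S - 1 : ℕ) * h₂) ^ N := by
    rw [RingHom.map_det]
    have h2 := Matrix.det_le (A := φ₂.mapMatrix DO) (abv := AbsoluteValue.abs)
      (x := Real.exp (a₁ + a₂ + (S - 1 : ℕ) * h₂)) (fun i j => ?_)
    · simpa using h2
    · simp only [DO, RingHom.mapMatrix_apply, Matrix.map_apply, Matrix.of_apply, map_mul, map_pow,
        map_natCast, AbsoluteValue.abs_apply, Nat.abs_cast]
      have hj : ((e.symm j).2.2 : ℕ) ≤ S - 1 := by have := (e.symm j).2.2.2; omega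
      have hpow : Real.exp ((S - 1 : ℕ) * h₂) = Real.exp h₂ ^ ((e.symm j).2.2 : ℕ) *
          Real.exp h₂ ^ (S - 1 - ((e.symm j).2.2 : ℕ)) := by
        rw [← pow_add, Nat.add_sub_cancel' hj, ← Real.exp_nat_mul]
      rw [Real.exp_add, Real.exp_add, hpow]
      gcongr
      · exact ha₁ _ _ (e.symm j).1.2
      · exact ha₂ _ _ (e.symm j).2.1.2
      · exact hh₂ _
      · exact hh₂' _
  -- the analytic bound
  choose f hfd hf using fun j : Fin N => exists_expansion (choosePoly ℂ (e.symm j).1)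
    (choosePoly ℂ (e.symm j).2.1) (θ : ℂ) (G := G) (by
      have d1 := natDegree_choosePoly_le ℂ (e.symm j).1
      have d2 := natDegree_choosePoly_le ℂ (e.symm j).2.1
      have l1 := (e.symm j).1.2
      have l2 := (e.symm j).2.1.2
      rcases hG with h | ⟨h, h'⟩
      · left; omega
      · right; exact ⟨by rw [h]; simp, by omega⟩)
  let zz : P → ℝ := fun p => X₂ p + θ * X₁ p
  choose R hRd hR using fun (i j : Fin N) => exists_exp_remainder (((e.symm j).2.2 : ℕ) : ℂ) (c : ℂ)
    (zz (τ i) : ℂ) (ε (τ i) : ℂ) M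
  let A : ℂ → Matrix (Fin N) (Fin N) ℂ := fun x => Matrix.of fun i j =>
    (choosePoly ℂ (e.symm j).1).eval (X₁ (τ i) : ℂ) *
      (choosePoly ℂ (e.symm j).2.1).eval (x * zz (τ i) - θ * X₁ (τ i)) *
      Complex.exp (((e.symm j).2.2 : ℕ) * (c * (x * zz (τ i)) + x ^ M * ε (τ i)))
  have hAdec : ∀ x p j, A x p j = ∑ i ∈ range G, (X₁ (τ p) : ℂ) ^ i *
      (f j i (x * zz (τ p)) * Complex.exp (((e.symm j).2.2 : ℕ) * (c * (x * zz (τ p))))) +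
      x ^ M * ((choosePoly ℂ (e.symm j).1).eval (X₁ (τ p) : ℂ) *
      (choosePoly ℂ (e.symm j).2.1).eval (x * zz (τ p) - θ * X₁ (τ p)) * R p j x) := by
    intro x p j
    simp only [A, Matrix.of_apply]
    rw [hR, mul_add, hf, sum_mul, ]
    congr 1
    · exact sum_congr rfl fun i _ => by ring
    · ring
  set β := Real.exp (a₁ + a₃ + (S - 1 : ℕ) * (ρ * z₀ + 1))
  have hbound : ∀ x : ℂ, ‖x‖ = ρ → ∀ p j, ‖A x p j‖ ≤ β := by
    intro x hx p j
    simp only [A, Matrix.of_apply, norm_mul, β, Real.exp_add]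
    have hj : ((e.symm j).2.2 : ℕ) ≤ S - 1 := by have := (e.symm j).2.2.2; omega
    have hX : ‖(x * zz (τ p) - θ * X₁ (τ p) : ℂ)‖ ≤ ρ * (X₁ (τ p) + X₂ (τ p)) + X₁ (τ p) := by
      refine (norm_sub_le _ _).trans ?_
      rw [norm_mul, norm_mul, hx, Complex.norm_real, Complex.norm_real, RCLike.norm_natCast]
      have h1 : ‖zz (τ p)‖ ≤ X₁ (τ p) + X₂ (τ p) := by
        refine (norm_add_le _ _).trans ?_
        rw [norm_mul, RCLike.norm_natCast, RCLike.norm_natCast, Real.norm_eq_abs]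
        nlinarith [(Nat.cast_nonneg (X₁ (τ p)) : (0 : ℝ) ≤ _)]
      have h2 : ‖θ‖ * (X₁ (τ p) : ℝ) ≤ X₁ (τ p) :=
        mul_le_of_le_one_left (Nat.cast_nonneg _) hθ
      have h3 : ρ * ‖zz (τ p)‖ ≤ ρ * (X₁ (τ p) + X₂ (τ p)) := by gcongr
      linarith
    have e3 : ‖Complex.exp (((e.symm j).2.2 : ℕ) * (c * (x * zz (τ p)) + x ^ M * ε (τ p)))‖ ≤
        Real.exp ((S - 1 : ℕ) * (ρ * z₀ + 1)) := by
      refine (Complex.norm_exp_le_exp_norm _).trans (Real.exp_le_exp.2 ?_)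
      rw [norm_mul, RCLike.norm_natCast]
      have h4 : ‖(c * (x * zz (τ p)) + x ^ M * ε (τ p) : ℂ)‖ ≤ ρ * z₀ + 1 := by
        refine (norm_add_le _ _).trans (add_le_add ?_ ?_)
        · rw [norm_mul, norm_mul, hx, Complex.norm_real, Complex.norm_real]
          have := hz (τ p)
          rw [abs_mul] at this
          calc ‖c‖ * (ρ * ‖zz (τ p)‖) = ρ * (|c| * |zz (τ p)|) := by
                simp only [Real.norm_eq_abs]; ring
            _ ≤ _ := by gcongr
        · rw [norm_mul, norm_pow, hx, Complex.norm_real]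
          exact hε _
      exact mul_le_mul (by exact_mod_cast hj) h4 (norm_nonneg _) (Nat.cast_nonneg _)
    refine mul_le_mul (mul_le_mul ?_ ?_ (norm_nonneg _) (Real.exp_pos _).le) e3 (norm_nonneg _)
      (by positivity)
    · rw [choosePoly_eval_nat, RCLike.norm_natCast]
      exact ha₁ _ _ (e.symm j).1.2
    · refine (norm_choosePoly_eval_le _ _).trans (le_trans ?_ (ha₃ (τ p) _ (e.symm j).2.1.2))
      gcongr
  have hdetle := norm_det_le hG1 hM (fun p => (X₁ (τ p) : ℂ)) (fun p => (zz (τ p) : ℂ))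
    (fun j i t => f j i t * Complex.exp (((e.symm j).2.2 : ℕ) * (c * t)))
    (fun j i => by have := hfd j i; fun_prop)
    (fun p j x => (choosePoly ℂ (e.symm j).1).eval (X₁ (τ p) : ℂ) *
      (choosePoly ℂ (e.symm j).2.1).eval (x * zz (τ p) - θ * X₁ (τ p)) * R p j x)
    (fun p j => by have := hRd p j; fun_prop) A hAdec hρ hbound
  have hA1 : A 1 = (Matrix.of fun i j : Fin N => A₀ (τ i) (e.symm j)).map Complex.ofReal := by
    ext i j
    simp only [A, A₀, Matrix.of_apply, Matrix.map_apply, one_mul, one_pow]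
    have h5 : ((zz (τ i) : ℝ) : ℂ) - θ * X₁ (τ i) = (X₂ (τ i) : ℂ) := by
      simp only [zz]; push_cast; ring
    rw [h5, choosePoly_eval_nat, choosePoly_eval_nat]
    push_cast
    congr 1
    have h6 : φ₁ (η (τ i)) / φ₁ (κ (τ i)) = Real.exp (c * zz (τ i) + ε (τ i)) := by
      rw [← hlog, Real.exp_sub, Real.exp_log (hη _), Real.exp_log (hκ _)]
    rw [← Complex.ofReal_div, h6, ← Complex.ofReal_pow, ← Real.exp_nat_mul, Complex.ofReal_exp]
    push_cast
    rfl
  have hdetA1 : ‖(A 1).det‖ = |(Matrix.of fun i j : Fin N => A₀ (τ i) (e.symm j)).det| := by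
    rw [hA1]
    have := (RingHom.map_det Complex.ofRealHom (Matrix.of fun i j : Fin N => A₀ (τ i) (e.symm j)))
    have h7 : ((Matrix.of fun i j : Fin N => A₀ (τ i) (e.symm j)).map Complex.ofReal).det =
      Complex.ofReal (Matrix.of fun i j : Fin N => A₀ (τ i) (e.symm j)).det := this.symm
    rw [h7, Complex.norm_real, Real.norm_eq_abs]
  rw [hdetA1] at hdetle
  set d := |(Matrix.of fun i j : Fin N => A₀ (τ i) (e.symm j)).det|
  have hdpos : 0 < d := abs_pos.2 hA₀det
  have hκprod : |∏ i, φ₁ (κ (τ i)) ^ (S - 1)| ≤ Real.exp ((S - 1 : ℕ) * h₁) ^ N := by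
    rw [Finset.abs_prod]
    calc ∏ i, |φ₁ (κ (τ i)) ^ (S - 1)| ≤ ∏ _i : Fin N, Real.exp ((S - 1 : ℕ) * h₁) := by
          refine Finset.prod_le_prod (fun _ _ => abs_nonneg _) fun i _ => ?_
          rw [abs_pow, abs_of_pos (hκ _), Real.exp_nat_mul]
          exact pow_le_pow_left₀ (hκ _).le ((Real.log_le_iff_le_exp (hκ _)).1 (hh₁ _)) _
      _ = _ := by simp
  have h8 : 1 ≤ Real.exp ((S - 1 : ℕ) * h₁) ^ N * d *
      (N.factorial * Real.exp (a₁ + a₂ + (S - 1 : ℕ) * h₂) ^ N) := by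
    refine hnorm.trans ?_
    rw [hφDO, abs_mul]
    gcongr
  have hfac : (N.factorial : ℝ) ≤ Real.exp (N * Real.log N) := by
    have hN' : (0 : ℝ) < N := by exact_mod_cast hNpos
    rw [Real.exp_nat_mul, Real.exp_log hN']
    exact_mod_cast Nat.factorial_le_pow N
  set O := ∑ p ∈ range N, p / G
  have h9 : Real.exp (O * Real.log ρ) ≤ Real.exp (N * (2 * Real.log N + (2 * a₁ + a₂ + a₃) +
        (S - 1 : ℕ) * (h₁ + h₂ + ρ * z₀ + 1))) := by
    rw [Real.exp_nat_mul, Real.exp_log (by linarith)]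
    calc ρ ^ O ≤ ρ ^ O * (Real.exp ((S - 1 : ℕ) * h₁) ^ N * d *
          (N.factorial * Real.exp (a₁ + a₂ + (S - 1 : ℕ) * h₂) ^ N)) :=
          le_mul_of_one_le_right (by positivity) h8
      _ = d * ρ ^ O * (Real.exp ((S - 1 : ℕ) * h₁) ^ N *
          (N.factorial * Real.exp (a₁ + a₂ + (S - 1 : ℕ) * h₂) ^ N)) := by ring
      _ ≤ (Real.exp (N * Real.log N) * β ^ N) * (Real.exp ((S - 1 : ℕ) * h₁) ^ N *
          (Real.exp (N * Real.log N) * Real.exp (a₁ + a₂ + (S - 1 : ℕ) * h₂) ^ N)) := by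
          have : d * ρ ^ O ≤ Real.exp (N * Real.log N) * β ^ N := hdetle.trans (by gcongr)
          gcongr
      _ = _ := by
          simp only [β, ← Real.exp_nat_mul, ← Real.exp_add]
          congr 1; ring
  exact Real.exp_le_exp.1 h9

end InterpolationDet

namespace InterpolationDet

open Finset Polynomial

theorem pow_div_factorial_le_exp {K i : ℕ} (hi : i ≤ K) {y t : ℝ} (hy : 0 ≤ y) (ht : 1 ≤ t)
    (h : y ≤ K * Real.exp (t - 1)) : y ^ i / (i.factorial : ℝ) ≤ Real.exp (K * t) := by
  have h1 := Real.pow_div_factorial_le_exp (K : ℝ) (Nat.cast_nonneg K) i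
  calc y ^ i / (i.factorial : ℝ) ≤ (K * Real.exp (t - 1)) ^ i / (i.factorial : ℝ) := by gcongr
    _ = (K : ℝ) ^ i / (i.factorial : ℝ) * Real.exp (t - 1) ^ i := by rw [mul_pow]; ring
    _ ≤ Real.exp K * Real.exp (t - 1) ^ K := by
        gcongr
        exact Real.one_le_exp (by linarith)
    _ = Real.exp (K * t) := by
        rw [← Real.exp_nat_mul, ← Real.exp_add]
        congr 1
        ring

theorem choose_le_exp {K i X : ℕ} (hi : i ≤ K) {t : ℝ} (ht : 1 ≤ t)
    (h : (X : ℝ) ≤ K * Real.exp (t - 1)) : (X.choose i : ℝ) ≤ Real.exp (K * t) :=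
  (Nat.choose_le_pow_div i X).trans (pow_div_factorial_le_exp hi (Nat.cast_nonneg X) ht h)

theorem le_sum_div {G : ℕ} (hG : 1 ≤ G) (N : ℕ) :
    (N : ℝ) * ((N - 1) / (2 * G) - 1) ≤ (∑ p ∈ range N, p / G : ℕ) := by
  have hG' : (0 : ℝ) < G := by exact_mod_cast hG
  have h : ∀ p : ℕ, (p : ℝ) / G - 1 ≤ (p / G : ℕ) := fun p => by
    have := Nat.lt_div_mul_add (a := p) hG
    have h2 : (p : ℝ) < (p / G : ℕ) * G + G := by exact_mod_cast this
    rw [sub_le_iff_le_add, div_le_iff₀ hG']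
    linarith
  have hs : (∑ p ∈ range N, (p : ℝ)) = N * (N - 1) / 2 := by
    have := Finset.sum_range_id_mul_two N
    have h2 : (∑ p ∈ range N, (p : ℝ)) * 2 = N * ((N - 1 : ℕ) : ℝ) := by
      rw [← Nat.cast_sum]
      exact_mod_cast this
    rcases Nat.eq_zero_or_pos N with rfl | hN
    · simp
    · rw [Nat.cast_sub hN] at h2
      push_cast at h2
      linarith
  calc (N : ℝ) * ((N - 1) / (2 * G) - 1) = ∑ p ∈ range N, ((p : ℝ) / G - 1) := by
        rw [sum_sub_distrib, ← sum_div, hs]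
        simp
        field_simp
    _ ≤ ∑ p ∈ range N, ((p / G : ℕ) : ℝ) := sum_le_sum fun p _ => h p
    _ = _ := by push_cast; rfl

theorem eq_zero_of_sum_choose {K : ℕ} (a : Fin K → ℝ)
    (h : ∀ n : ℕ, ∑ i : Fin K, (n.choose i : ℝ) * a i = 0) : a = 0 := by
  funext i
  obtain ⟨i, hi⟩ := i
  induction i using Nat.strong_induction_on with
  | _ i ih =>
    have := h i
    rw [Finset.sum_eq_single ⟨i, hi⟩] at this
    · simpa using this
    · rintro ⟨j, hj⟩ - hne
      have hne' : j ≠ i := fun h => hne (by simp [h])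
      rcases lt_or_gt_of_ne hne' with h1 | h1
      · rw [ih j h1 hj]; simp
      · rw [Nat.choose_eq_zero_of_lt h1]; simp
    · simp

/-- The interpolation inequality for powers of two numbers, combined with the zero estimate on
`ℝ × ℝ^*`. -/
theorem two_log_inequality {O : Type*} [CommRing O] (φ₁ φ₂ : O →+* ℝ)
    (hφ : ∀ x : O, x ≠ 0 → 1 ≤ |φ₁ x| * |φ₂ x|) {S K : ℕ} (hS : 1 ≤ S) (hK : 1 ≤ K) {ι : Type*}
    [Fintype ι] (X : Fin S × ι → ℕ) (η κ : Fin S × ι → O)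
    (hη : ∀ p, 0 < φ₁ (η p)) (hκ : ∀ p, 0 < φ₁ (κ p)) {c : ℝ} (ε : Fin S × ι → ℝ)
    (hlog : ∀ p, Real.log (φ₁ (η p)) - Real.log (φ₁ (κ p)) = c * X p + ε p)
    {ρ : ℝ} (hρ : 1 ≤ ρ) (hε : ∀ p, ρ ^ (K * S) * |ε p| ≤ 1)
    (x y : Fin S → ℝ) (u v : ι → ℝ) (hX : ∀ p, (X p : ℝ) = u p.2 + x p.1)
    (hy : ∀ p, φ₁ (η p) / φ₁ (κ p) = v p.2 * y p.1) (hyi : Function.Injective y)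
    (hu : K * S ≤ (Finset.univ.image u).card) {t : ℝ} (ht : 1 ≤ t)
    (hXt : ∀ p, ρ * X p + K ≤ K * Real.exp (t - 1)) {h₁ h₂ z₀ : ℝ}
    (hh₁ : ∀ p, Real.log (φ₁ (κ p)) ≤ h₁) (hh₂ : ∀ p, |φ₂ (η p)| ≤ Real.exp h₂)
    (hh₂' : ∀ p, |φ₂ (κ p)| ≤ Real.exp h₂) (hz : ∀ p, |c * X p| ≤ z₀) :
    ((K * S - 1) / 2 - 1) * Real.log ρ ≤ 2 * Real.log (K * S) + 2 * (K * t) +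
        (S - 1) * (h₁ + h₂ + ρ * z₀ + 1) := by
  have hXK : ∀ p, (X p : ℝ) ≤ K * Real.exp (t - 1) := fun p => by
    have := hXt p
    have h1 : (X p : ℝ) ≤ ρ * X p := le_mul_of_one_le_left (Nat.cast_nonneg _) hρ
    have := Nat.cast_nonneg (α := ℝ) K
    linarith
  have main := interpolation_inequality φ₁ φ₂ hφ (fun _ => 0) X η κ hη hκ (c := c) (θ := 0) ε
    (by simpa using hlog) (by simp) (K₁ := 1) (K₂ := K) (S := S) (G := 1) (M := K * S) le_rfl
    (Or.inr ⟨rfl, le_rfl⟩) (by simp) hρ hε ?_ (a₁ := 0) (a₂ := K * t) (a₃ := K * t) (h₁ := h₁)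
    (h₂ := h₂) (z₀ := z₀) ?_ (fun p i hi => choose_le_exp hi.le ht (hXK p)) ?_ hh₁ hh₂ hh₂'
    (by simpa using hz)
  · have hsum := le_sum_div le_rfl (G := 1) (1 * (K * S))
    have hN : (0 : ℝ) < (1 * (K * S) : ℕ) := by exact_mod_cast (by positivity)
    have hl : 0 ≤ Real.log ρ := Real.log_nonneg hρ
    have h3 := (mul_le_mul_of_nonneg_right hsum hl).trans main
    rw [mul_assoc] at h3
    have h4 := le_of_mul_le_mul_left h3 hN
    push_cast [Nat.cast_sub hS] at h4
    simp only [one_mul, mul_one] at h4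
    linarith
  · intro a ha
    have hz := zero_estimate_two (K := K) (fun l => ∑ i : Fin K, C (a (0, i, l)) * choosePoly ℝ i)
      (fun l => ?_) x y hyi Finset.univ u v (fun i _ h0 => ?_) hu (fun j i _ => ?_)
    · funext ⟨i₁, i, l⟩
      have := eq_zero_of_sum_choose (fun i : Fin K => a (0, i, l)) (fun n => by
        have h1 := congrArg (Polynomial.eval (n : ℝ)) (hz l)
        simp only [eval_finsetSum, eval_mul, eval_C, choosePoly_eval_nat, eval_zero] at h1
        rw [← h1]
        exact Finset.sum_congr rfl fun i _ => mul_comm _ _)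
      rw [Subsingleton.elim i₁ 0]
      exact congrFun this i
    · refine lt_of_le_of_lt (natDegree_sum_le_of_forall_le _ _ (n := K - 1) fun i _ => ?_)
          (by omega)
      refine (natDegree_C_mul_le _ _).trans ((natDegree_choosePoly_le ℝ _).trans ?_)
      have := i.2
      omega
    · have h1 := hy (⟨0, hS⟩, i)
      rw [h0, zero_mul] at h1
      exact (div_pos (hη _) (hκ _)).ne' h1
    · have h1 := ha (j, i)
      rw [Fintype.sum_prod_type, Fintype.sum_unique, Fintype.sum_prod_type, Finset.sum_comm] at h1
      rw [← h1]
      refine Finset.sum_congr rfl fun l _ => ?_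
      rw [← hX (j, i), ← hy (j, i), eval_finsetSum, Finset.sum_mul]
      refine Finset.sum_congr rfl fun k _ => ?_
      rw [eval_mul, eval_C, choosePoly_eval_nat]
      simp
      ring
  · intro p i hi
    obtain rfl : i = 0 := by omega
    simp
  · intro p i hi
    refine pow_div_factorial_le_exp hi.le (by positivity) ht ?_
    have := hXt p
    have : (i : ℝ) ≤ K := by exact_mod_cast hi.le
    simp
    linarith

end InterpolationDet

namespace InterpolationDet

open Finset

theorem aeval_X_mem_box (i : Fin 3) {n : ℕ} (q : Polynomial ℝ) (hq : q.natDegree ≤ n) :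
    Polynomial.aeval (MvPolynomial.X i : ZeroEstimate.Poly) q ∈
      ZeroEstimate.box (n • Pi.single i 1) := by
  rw [Polynomial.aeval_eq_sum_range]
  refine Submodule.sum_mem _ fun j hj => Submodule.smul_mem _ _ ?_
  have hj' : j ≤ n := by have := Finset.mem_range.1 hj; omega
  exact ZeroEstimate.box_mono (nsmul_le_nsmul_left (fun _ => Nat.zero_le _) hj')
    (ZeroEstimate.pow_mem_box (ZeroEstimate.X_mem_box i (by simp)) j)

theorem eval_aeval_X (v : Fin 3 → ℝ) (i : Fin 3) (q : Polynomial ℝ) :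
    MvPolynomial.eval v (Polynomial.aeval (MvPolynomial.X i) q) = q.eval (v i) := by
  rw [Polynomial.aeval_eq_sum_range, map_sum, Polynomial.eval_eq_sum_range]
  refine Finset.sum_congr rfl fun j _ => ?_
  rw [MvPolynomial.smul_eval, map_pow, MvPolynomial.eval_X]

theorem eq_zero_of_sum_choose_choose_pow {K L S : ℕ} (a : Fin K × Fin L × Fin S → ℝ)
    (h : ∀ m n : ℕ, ∀ y : ℝ, ∑ t : Fin K × Fin L × Fin S,
      (m.choose t.1 : ℝ) * (n.choose t.2.1 : ℝ) *
      y ^ (t.2.2 : ℕ) * a t = 0) : a = 0 := by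
  have h1 : ∀ (m n : ℕ) (l : Fin S), ∑ i : Fin K, (m.choose i : ℝ) *
      ∑ j : Fin L, (n.choose j : ℝ) * a (i, j, l) = 0 := by
    intro m n l
    let p : Polynomial ℝ := ∑ l : Fin S,
      Polynomial.monomial (l : ℕ) (∑ i : Fin K, (m.choose i : ℝ) *
      ∑ j : Fin L, (n.choose j : ℝ) * a (i, j, l))
    have hp : p = 0 := by
      refine Polynomial.funext fun y => ?_
      rw [Polynomial.eval_zero, ← h m n y, Polynomial.eval_finsetSum, Fintype.sum_prod_type]
      simp_rw [Fintype.sum_prod_type, Polynomial.eval_monomial, Finset.sum_mul,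
        Finset.mul_sum, Finset.sum_mul]
      rw [Finset.sum_comm]
      refine Finset.sum_congr rfl fun i _ => ?_
      rw [Finset.sum_comm]
      refine Finset.sum_congr rfl fun j _ => Finset.sum_congr rfl fun l _ => by ring
    have h2 := congrArg (fun q => Polynomial.coeff q l) hp
    simp only [p, Polynomial.finsetSum_coeff, Polynomial.coeff_monomial,
      Polynomial.coeff_zero] at h2
    rw [Finset.sum_eq_single l] at h2
    · simpa using h2
    · intro l' _ hl
      rw [if_neg (fun h => hl (Fin.ext h))]
    · simp
  funext ⟨i, j, l⟩
  have h2 : ∀ n : ℕ, (fun i : Fin K => ∑ j : Fin L, (n.choose j : ℝ) * a (i, j, l)) = 0 := fun n =>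
    eq_zero_of_sum_choose _ fun m => h1 m n l
  exact congrFun (eq_zero_of_sum_choose (fun j => a (i, j, l)) fun n => congrFun (h2 n) i) j

/-- The interpolation inequality for a linear form in two logarithms with algebraic coefficients
close to a third logarithm, combined with the zero estimate on `ℝ × ℝ × ℝ^*`. -/
theorem three_log_inequality {O : Type*} [CommRing O] (φ₁ φ₂ : O →+* ℝ)
    (hφ : ∀ x : O, x ≠ 0 → 1 ≤ |φ₁ x| * |φ₂ x|) {S K : ℕ} (hS : 2 ≤ S) (hK : 2 ≤ K)
    (V : Finset (Fin 3 → ℝ)) (hV : ZeroEstimate.Generic V)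
    (hVcard : 6 * ((K - 1) * (K - 1) * (S - 1)) < V.card) (hKV : K ≤ V.card) (hSV : S ≤ V.card)
    (hVimg : ∀ c : Fin 2 → ℝ, c ≠ 0 → K ≤ (V.image fun v => c 0 * v 0 + c 1 * v 1).card)
    (X₁ X₂ : V × V × V → ℕ) (η κ : V × V × V → O)
    (hη : ∀ p, 0 < φ₁ (η p)) (hκ : ∀ p, 0 < φ₁ (κ p)) {c θ : ℝ} (hθ : |θ| ≤ 1)
    (ε : V × V × V → ℝ)
    (hlog : ∀ p, Real.log (φ₁ (η p)) - Real.log (φ₁ (κ p)) = c * (X₂ p + θ * X₁ p) + ε p)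
    (hX₁ : ∀ p, (X₁ p : ℝ) = (p.1.1 + p.2.1.1 + p.2.2.1) 0)
    (hX₂ : ∀ p, (X₂ p : ℝ) = (p.1.1 + p.2.1.1 + p.2.2.1) 1)
    (hy : ∀ p, Real.log (φ₁ (η p)) - Real.log (φ₁ (κ p)) = (p.1.1 + p.2.1.1 + p.2.2.1) 2)
    {ρ : ℝ} (hρ : 1 ≤ ρ) (hε : ∀ p, ρ ^ (K * S) * |ε p| ≤ 1) {t : ℝ} (ht : 1 ≤ t)
    (hXt : ∀ p, ρ * (X₁ p + X₂ p) + X₁ p + K ≤ K * Real.exp (t - 1)) {h₁ h₂ z₀ : ℝ}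
    (hh₁ : ∀ p, Real.log (φ₁ (κ p)) ≤ h₁) (hh₂ : ∀ p, |φ₂ (η p)| ≤ Real.exp h₂)
    (hh₂' : ∀ p, |φ₂ (κ p)| ≤ Real.exp h₂) (hz : ∀ p, |c * (X₂ p + θ * X₁ p)| ≤ z₀) :
    (K * S / 4 - 2) * Real.log ρ ≤ 2 * Real.log (K * (K * S)) + 4 * (K * t) +
        (S - 1) * (h₁ + h₂ + ρ * z₀ + 1) := by
  have hb : ∀ p, (X₁ p : ℝ) ≤ K * Real.exp (t - 1) ∧
      (X₂ p : ℝ) ≤ K * Real.exp (t - 1) := fun p => by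
    have := hXt p
    have h1 : (X₁ p + X₂ p : ℝ) ≤ ρ * (X₁ p + X₂ p) := le_mul_of_one_le_left (by positivity) hρ
    have := Nat.cast_nonneg (α := ℝ) K
    have := Nat.cast_nonneg (α := ℝ) (X₁ p)
    have := Nat.cast_nonneg (α := ℝ) (X₂ p)
    constructor <;> linarith
  have main := interpolation_inequality φ₁ φ₂ hφ X₁ X₂ η κ hη hκ (c := c) (θ := θ) ε
    hlog hθ (K₁ := K) (K₂ := K) (S := S) (G := 2 * K - 1) (M := K * S) (by omega)
    (Or.inl (by omega)) (Nat.mul_le_mul_right _ (by omega)) hρ hε ?_ (a₁ := K * t) (a₂ := K * t)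
    (a₃ := K * t) (h₁ := h₁) (h₂ := h₂) (z₀ := z₀) (fun p i hi => choose_le_exp hi.le ht (hb p).1)
    (fun p i hi => choose_le_exp hi.le ht (hb p).2) ?_ hh₁ hh₂ hh₂' hz
  · have hsum := le_sum_div (G := 2 * K - 1) (by omega) (K * (K * S))
    have hN : (0 : ℝ) < (K * (K * S) : ℕ) := by exact_mod_cast (by positivity)
    have hl : 0 ≤ Real.log ρ := Real.log_nonneg hρ
    have h3 := (mul_le_mul_of_nonneg_right hsum hl).trans main
    rw [mul_assoc] at h3
    have h4 := le_of_mul_le_mul_left h3 hN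
    push_cast [Nat.cast_sub (show 1 ≤ S by omega), Nat.cast_sub (show 1 ≤ 2 * K by omega)] at h4
    have hK' : (2 : ℝ) ≤ K := by exact_mod_cast hK
    have hS' : (2 : ℝ) ≤ S := by exact_mod_cast hS
    have h5 : (K * S / 4 - 2 : ℝ) ≤ (K * (K * S) - 1) / (2 * (2 * K - 1)) - 1 := by
      have : (K * S / 4 - 1 : ℝ) ≤ (K * (K * S) - 1) / (2 * (2 * K - 1)) := by
        rw [le_div_iff₀ (by linarith)]
        nlinarith [mul_pos (by linarith : (0 : ℝ) < K) (by linarith : (0 : ℝ) < S)]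
      linarith
    have := mul_le_mul_of_nonneg_right h5 hl
    linarith
  · intro a ha
    let P : ZeroEstimate.Poly := ∑ t : Fin K × Fin K × Fin S, a t •
      (Polynomial.aeval (MvPolynomial.X 0) (choosePoly ℝ t.1) *
        Polynomial.aeval (MvPolynomial.X 1) (choosePoly ℝ t.2.1) *
        Polynomial.aeval (MvPolynomial.X 2) (Polynomial.X ^ (t.2.2 : ℕ) : Polynomial ℝ))
    have heval : ∀ v, MvPolynomial.eval v P = ∑ t : Fin K × Fin K × Fin S,
        (choosePoly ℝ t.1).eval (v 0) *
        (choosePoly ℝ t.2.1).eval (v 1) * v 2 ^ (t.2.2 : ℕ) * a t := by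
      intro v
      simp only [P, map_sum, MvPolynomial.smul_eval, map_mul, eval_aeval_X, Polynomial.eval_pow,
        Polynomial.eval_X]
      exact Finset.sum_congr rfl fun t _ => by ring
    have hP : P = 0 := by
      refine ZeroEstimate.eq_zero_of_vanish (D := ![K - 1, K - 1, S - 1]) (fun i => ?_) hV hV hV
        ?_ ?_ (fun i => ?_) (fun c hc => ?_) P ?_ ?_
      · fin_cases i <;> simp <;> omega
      · simpa using hVcard
      · simpa using hVcard
      · fin_cases i <;> simp <;> omega
      · have := hVimg c hc
        simp only [Matrix.cons_val_zero, Matrix.cons_val_one, max_self]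
        omega
      · refine Submodule.sum_mem _ fun t _ => Submodule.smul_mem _ _ ?_
        have e1 := aeval_X_mem_box 0 (choosePoly ℝ t.1) (natDegree_choosePoly_le ℝ _)
        have e2 := aeval_X_mem_box 1 (choosePoly ℝ t.2.1) (natDegree_choosePoly_le ℝ _)
        have e3 := aeval_X_mem_box 2 (Polynomial.X ^ (t.2.2 : ℕ)) (Polynomial.natDegree_X_pow_le _)
        refine ZeroEstimate.box_mono (fun i => ?_)
          (ZeroEstimate.mul_mem_box (ZeroEstimate.mul_mem_box e1 e2) e3)
        have l1 := t.1.2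
        have l2 := t.2.1.2
        have l3 := t.2.2.2
        fin_cases i <;> simp <;> omega
      · intro u hu v hv w hw
        have := ha (⟨u, hu⟩, ⟨v, hv⟩, ⟨w, hw⟩)
        rw [heval, ← this]
        refine Finset.sum_congr rfl fun t _ => ?_
        simp only [ZeroEstimate.pt, Matrix.cons_val_zero, Matrix.cons_val_one, Matrix.cons_val]
        rw [← hy (⟨u, hu⟩, ⟨v, hv⟩, ⟨w, hw⟩), ← hX₁ (⟨u, hu⟩, ⟨v, hv⟩, ⟨w, hw⟩),
          ← hX₂ (⟨u, hu⟩, ⟨v, hv⟩, ⟨w, hw⟩), choosePoly_eval_nat, choosePoly_eval_nat, Real.exp_sub,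
          Real.exp_log (hη _), Real.exp_log (hκ _)]
    refine eq_zero_of_sum_choose_choose_pow a fun m n y => ?_
    have := heval ![m, n, y]
    rw [hP, map_zero] at this
    rw [this]
    refine Finset.sum_congr rfl fun t _ => ?_
    simp [choosePoly_eval_nat]
  · intro p i hi
    refine pow_div_factorial_le_exp hi.le (by positivity) ht ?_
    have := hXt p
    have : (i : ℝ) ≤ K := by exact_mod_cast hi.le
    linarith

end InterpolationDet

namespace InterpolationDet

open Finset

/-- A family, indexed by `ℤ³`, of quotients of elements of a ring with two real embeddings, whose
logarithms are additive and whose heights are bounded by a weight. -/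
structure LogSystem (O : Type*) [CommRing O] where
  φ₁ : O →+* ℝ
  φ₂ : O →+* ℝ
  one_le : ∀ x : O, x ≠ 0 → 1 ≤ |φ₁ x| * |φ₂ x|
  η : (Fin 3 → ℤ) → O
  κ : (Fin 3 → ℤ) → O
  η_pos : ∀ ν, 0 < φ₁ (η ν)
  κ_pos : ∀ ν, 0 < φ₁ (κ ν)
  g : Fin 3 → ℝ
  le_g : ∀ i, 48 / 100 ≤ g i
  ℓ : (Fin 3 → ℤ) →+ ℝ
  log_sub : ∀ ν, Real.log (φ₁ (η ν)) - Real.log (φ₁ (κ ν)) = ℓ ν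
  log_κ_le : ∀ ν, Real.log (φ₁ (κ ν)) ≤ ∑ i, |(ν i : ℝ)| * g i
  abs_η_le : ∀ ν, |φ₂ (η ν)| ≤ Real.exp (∑ i, |(ν i : ℝ)| * g i)
  abs_κ_le : ∀ ν, |φ₂ (κ ν)| ≤ Real.exp (∑ i, |(ν i : ℝ)| * g i)
  abs_ℓ_le : ∀ ν, |ℓ ν| ≤ ∑ i, |(ν i : ℝ)| * g i

namespace LogSystem

variable {O : Type*} [CommRing O] (Y : LogSystem O)

/-- The weight bounding the logarithmic heights in a `LogSystem`. -/
def weight (ν : Fin 3 → ℤ) : ℝ := ∑ i, |(ν i : ℝ)| * Y.g i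

theorem g_pos (i : Fin 3) : 0 < Y.g i := lt_of_lt_of_le (by norm_num) (Y.le_g i)

theorem weight_add_le (ν μ : Fin 3 → ℤ) : Y.weight (ν + μ) ≤ Y.weight ν + Y.weight μ := by
  rw [weight, weight, weight, ← sum_add_distrib]
  refine sum_le_sum fun i _ => ?_
  rw [← add_mul]
  refine mul_le_mul_of_nonneg_right ?_ (Y.g_pos i).le
  rw [Pi.add_apply, Int.cast_add]
  exact abs_add_le _ _

theorem weight_sub_le (ν μ : Fin 3 → ℤ) : Y.weight (ν - μ) ≤ Y.weight ν + Y.weight μ := by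
  have h : Y.weight (-μ) = Y.weight μ := by simp [weight]
  rw [sub_eq_add_neg, ← h]
  exact Y.weight_add_le ν (-μ)

theorem abs_le_weight (ν : Fin 3 → ℤ) (i : Fin 3) : |(ν i : ℝ)| ≤ 3 * Y.weight ν := by
  have h1 : |(ν i : ℝ)| * Y.g i ≤ Y.weight ν :=
    single_le_sum (f := fun i => |(ν i : ℝ)| * Y.g i)
      (fun j _ => mul_nonneg (abs_nonneg _) (Y.g_pos j).le) (mem_univ i)
  have := Y.le_g i
  nlinarith [abs_nonneg (ν i : ℝ)]

theorem exp_two_bounds : (7.38 : ℝ) ≤ Real.exp 2 ∧ Real.exp 2 ≤ 7.39 := by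
  have h : Real.exp 2 = Real.exp 1 ^ 2 := by rw [← Real.exp_nat_mul]; norm_num
  have h1 := Real.exp_one_gt_d9
  have h2 := Real.exp_one_lt_d9
  rw [h]
  constructor <;> nlinarith

/-- Numerical conditions on the parameters of the interpolation determinants. -/
structure Admissible (K S : ℕ) (L : ℝ) : Prop where
  le_L : 50 ≤ L
  le_S : 18 * L ≤ S
  S_le : (S : ℝ) ≤ K
  K_le : (K : ℝ) ≤ Real.exp L
  le_K : 10 ^ 6 ≤ (K : ℝ)

theorem Admissible.log_K_le {K S : ℕ} {L : ℝ} (h : Admissible K S L) : Real.log K ≤ L :=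
  (Real.log_le_iff_le_exp (by linarith [h.le_K])).2 h.K_le

theorem Admissible.S_pos {K S : ℕ} {L : ℝ} (h : Admissible K S L) : (0 : ℝ) < S := by
  linarith [h.le_S, h.le_L]

theorem Admissible.log_S_le {K S : ℕ} {L : ℝ} (h : Admissible K S L) : Real.log S ≤ L :=
  (Real.log_le_log h.S_pos h.S_le).trans h.log_K_le

theorem two_log_contradiction {K S : ℕ} {L : ℝ} (hA : Admissible K S L) (X : (Fin 3 → ℤ) →+ ℤ)
    (F₁ F₂ : Finset (Fin 3 → ℤ)) (hX₁ : ∀ ν ∈ F₁, 0 ≤ X ν) (hX₂ : ∀ ν ∈ F₂, 0 ≤ X ν)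
    (hF₁ : S ≤ (F₁.image Y.ℓ).card) (hF₂ : K * S ≤ (F₂.image X).card) (c : ℝ)
    (hε : ∀ ν ∈ F₁, ∀ μ ∈ F₂, Real.exp (2 * (K * S)) * |Y.ℓ (ν + μ) - c * X (ν + μ)| ≤ 1)
    (hW : ∀ ν ∈ F₁, ∀ μ ∈ F₂, Y.weight (ν + μ) ≤ 12 * (K / 400))
    (ht : ∀ ν ∈ F₁, ∀ μ ∈ F₂, Real.exp 2 * X (ν + μ) + K ≤ K * Real.exp (2 * L - 1)) :
    False := by
  classical
  have hS0 := hA.S_pos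
  have hK0 := hA.le_K
  have hL0 := hA.le_L
  have hS1 : 1 ≤ S := by exact_mod_cast hS0
  have hK1 : 1 ≤ K := by
    have : (1 : ℝ) ≤ K := by linarith
    exact_mod_cast this
  obtain ⟨T, hTF, hT⟩ := exists_subset_card_eq hF₁
  obtain ⟨e⟩ : Nonempty (Fin S ≃ T) := ⟨(finCongr hT.symm).trans T.equivFin.symm⟩
  have hpre : ∀ j : Fin S, ∃ ν ∈ F₁, Y.ℓ ν = e j := fun j => by
    simpa using mem_image.1 (hTF (e j).2)
  choose α hα hαe using hpre
  let ν : Fin S × F₂ → (Fin 3 → ℤ) := fun p => α p.1 + p.2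
  have hXn : ∀ p, ((X (ν p)).toNat : ℝ) = X (ν p) := fun p => by
    have : 0 ≤ X (ν p) := by
      rw [map_add]
      exact add_nonneg (hX₁ _ (hα _)) (hX₂ _ p.2.2)
    exact_mod_cast Int.toNat_of_nonneg this
  have hE1 : 1 ≤ Real.exp (2 * (K * S)) := Real.one_le_exp (by positivity)
  have hε1 : ∀ p, |Y.ℓ (ν p) - c * X (ν p)| ≤ 1 := fun p =>
    (le_mul_of_one_le_left (abs_nonneg _) hE1).trans (hε _ (hα _) _ p.2.2)
  obtain ⟨hρ1, hρ2⟩ := exp_two_bounds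
  have main := two_log_inequality Y.φ₁ Y.φ₂ Y.one_le hS1 hK1 (fun p => (X (ν p)).toNat)
    (fun p => Y.η (ν p)) (fun p => Y.κ (ν p)) (fun p => Y.η_pos _) (fun p => Y.κ_pos _) (c := c)
    (fun p => Y.ℓ (ν p) - c * X (ν p)) (fun p => by rw [Y.log_sub, hXn]; ring)
    (ρ := Real.exp 2) (by linarith)
    (fun p => by
      rw [← Real.exp_nat_mul]
      have := hε _ (hα p.1) _ p.2.2
      rw [mul_comm (2 : ℝ)] at this
      exact_mod_cast this)
    (fun j => X (α j)) (fun j => Real.exp (Y.ℓ (α j))) (fun i => X i) (fun i => Real.exp (Y.ℓ i))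
    (fun p => by
      rw [hXn, ← Int.cast_add, ← map_add, add_comm])
    (fun p => by
      rw [← Real.exp_add, ← map_add, add_comm, ← Y.log_sub, Real.exp_sub, Real.exp_log (Y.η_pos _),
        Real.exp_log (Y.κ_pos _)])
    (fun i j hij => by
      have := Real.exp_injective hij
      rw [hαe, hαe] at this
      exact e.injective (Subtype.ext this))
    (hF₂.trans (by
      rw [← card_image_of_injective _ (Int.cast_injective (α := ℝ))]
      refine card_le_card fun x hx => ?_
      simp only [mem_image] at hx
      obtain ⟨z, ⟨μ, hμ, rfl⟩, rfl⟩ := hx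
      exact mem_image.2 ⟨⟨μ, hμ⟩, mem_univ _, rfl⟩))
    (t := 2 * L) (by linarith)
    (fun p => by rw [hXn]; exact ht _ (hα _) _ p.2.2)
    (h₁ := 12 * (K / 400)) (h₂ := 12 * (K / 400)) (z₀ := 12 * (K / 400) + 1)
    (fun p => (Y.log_κ_le _).trans (hW _ (hα _) _ p.2.2))
    (fun p => (Y.abs_η_le _).trans (Real.exp_le_exp.2 (hW _ (hα _) _ p.2.2)))
    (fun p => (Y.abs_κ_le _).trans (Real.exp_le_exp.2 (hW _ (hα _) _ p.2.2)))
    (fun p => by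
      rw [hXn]
      have h1 := hε1 p
      have h2 := (Y.abs_ℓ_le (ν p)).trans (hW _ (hα _) _ p.2.2)
      rw [abs_le] at h1 h2 ⊢
      constructor <;> linarith)
  rw [Real.log_exp, Real.log_mul (by positivity) (by positivity)] at main
  have l1 := hA.log_K_le
  have l2 := hA.log_S_le
  have l3 := hA.le_S
  have h7 : Real.exp 2 * (12 * (K / 400) + 1) ≤ 7.39 * (12 * (K / 400) + 1) := by gcongr
  have h8 : (S - 1 : ℝ) *
        (12 * (K / 400) + 12 * (K / 400) + Real.exp 2 * (12 * (K / 400) + 1) + 1) ≤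
      S * (12 * (K / 400) + 12 * (K / 400) + 7.39 * (12 * (K / 400) + 1) + 1) := by
    gcongr
    linarith
  have h9 : (K : ℝ) * (18 * L) ≤ K * S := by gcongr
  nlinarith [mul_le_mul_of_nonneg_right hK0 hS0.le]

theorem three_log_contradiction {K S : ℕ} {L : ℝ} (hA : Admissible K S L)
    (x₁ x₂ : (Fin 3 → ℤ) →+ ℤ) (V : Finset (Fin 3 → ℤ)) (hV0 : 0 ∈ V)
    (hVn : ∀ ν ∈ V, 0 ≤ x₁ ν ∧ 0 ≤ x₂ ν)
    (hVx : ∀ ν ∈ V, ∀ μ ∈ V, ν ≠ μ → (x₁ (μ - ν) ≠ 0 ∨ x₂ (μ - ν) ≠ 0))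
    (hVℓ : ∀ ν ∈ V, ∀ μ ∈ V, ν ≠ μ → Y.ℓ (μ - ν) ≠ 0)
    (hVw : ∀ ν ∈ V, Y.weight ν ≤ 3 * (K / 400)) (hVcard : 6 * (K * K * S) ≤ V.card)
    {c₁ c₂ Λ : ℝ} (hc : |c₁| ≤ |c₂|) (hc₂ : c₂ ≠ 0)
    (hℓ : ∀ ν, Y.ℓ ν = c₁ * x₁ ν + c₂ * x₂ ν + ν 2 * Λ)
    (hΛ : Real.exp (2 * (K * S)) * (K * |Λ|) ≤ 1)
    (hx₁ : ∀ ν, |(x₁ ν : ℝ)| ≤ Y.weight ν * (2.1 * Real.exp (L - 1)))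
    (hx₂ : ∀ ν, |(x₂ ν : ℝ)| ≤ Y.weight ν * (2.1 * Real.exp (L - 1))) : False := by
  classical
  have hS0 := hA.S_pos
  have hK0 := hA.le_K
  have hL0 := hA.le_L
  have hSL := hA.le_S
  have hS2 : 2 ≤ S := by
    have : (2 : ℝ) ≤ S := by linarith
    exact_mod_cast this
  have hK2 : 2 ≤ K := by
    have : (2 : ℝ) ≤ K := by linarith
    exact_mod_cast this
  obtain ⟨hρ1, hρ2⟩ := exp_two_bounds
  have hD : (40 : ℝ) ≤ Real.exp (L - 1) := by
    have := Real.add_one_le_exp (L - 1)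
    linarith
  have hE1 : 1 ≤ Real.exp (2 * (K * S)) := Real.one_le_exp (by positivity)
  have hεw : ∀ ν : Fin 3 → ℤ, Y.weight ν ≤ 12 * (K / 400) →
      Real.exp (2 * (K * S)) * |ν 2 * Λ| ≤ 1 := fun ν hν => by
    refine le_trans ?_ hΛ
    rw [abs_mul]
    have := Y.abs_le_weight ν 2
    gcongr
    linarith
  -- a large subset on which one form determines the other is impossible
  have fiber : ∀ (x : (Fin 3 → ℤ) →+ ℤ) (c : ℝ) (F : Finset (Fin 3 → ℤ)), F ⊆ V →
      K * S ≤ F.card → Set.InjOn x F → (∀ ν, |(x ν : ℝ)| ≤ Y.weight ν * (2.1 * Real.exp (L - 1))) →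
      (∀ ν ∈ F, ∀ μ ∈ F, Y.ℓ (ν - μ) = c * x (ν - μ) + ((ν - μ) 2 : ℤ) * Λ) → False := by
    intro x c F hFV hFc hinj hx hFℓ
    have hFne : F.Nonempty := card_pos.1 (by have : 0 < K * S := by positivity
                                             omega)
    obtain ⟨f, hf, hmin⟩ := F.exists_min_image x hFne
    have hwt : ∀ ν ∈ F.image (· - f), ∀ μ ∈ F.image (· - f), Y.weight (ν + μ) ≤ 12 * (K / 400) := by
      simp only [mem_image, forall_exists_index, and_imp, forall_apply_eq_imp_iff₂]
      intro ν hν μ hμ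
      have h1 := Y.weight_add_le (ν - f) (μ - f)
      have h2 := Y.weight_sub_le ν f
      have h3 := Y.weight_sub_le μ f
      have h4 := hVw _ (hFV hν)
      have h5 := hVw _ (hFV hμ)
      have h6 := hVw _ (hFV hf)
      linarith
    refine Y.two_log_contradiction hA x (F.image (· - f)) (F.image (· - f)) ?_ ?_ ?_ ?_ c ?_ hwt ?_
    · simp only [mem_image, forall_exists_index, and_imp, forall_apply_eq_imp_iff₂,
        map_sub, sub_nonneg]
      exact hmin
    · simp only [mem_image, forall_exists_index, and_imp, forall_apply_eq_imp_iff₂,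
        map_sub, sub_nonneg]
      exact hmin
    · rw [image_image, card_image_of_injOn]
      · nlinarith
      · intro ν hν μ hμ hνμ
        by_contra hne
        refine hVℓ ν (hFV hν) μ (hFV hμ) hne ?_
        simp only [Function.comp_apply, map_sub] at hνμ ⊢
        linarith
    · rw [image_image, card_image_of_injOn]
      · exact hFc
      · intro ν hν μ hμ hνμ
        refine hinj hν hμ ?_
        simpa using hνμ
    · intro ν hν μ hμ
      have hw := hwt ν hν μ hμ
      obtain ⟨ν', hν', rfl⟩ := mem_image.1 hν
      obtain ⟨μ', hμ', rfl⟩ := mem_image.1 hμ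
      refine le_trans (le_of_eq ?_) (hεw (ν' - f + (μ' - f)) hw)
      rw [map_add, map_add, hFℓ _ hν' _ hf, hFℓ _ hμ' _ hf, Pi.add_apply]
      push_cast
      congr 2
      ring
    · intro ν hν μ hμ
      have hw := hwt ν hν μ hμ
      have h1 := (le_abs_self _).trans (hx (ν + μ))
      have h2 : Real.exp (L - 1) ≤ Real.exp (2 * L - 1) := Real.exp_le_exp.2 (by linarith)
      have h3 : (x (ν + μ) : ℝ) ≤ 12 * (K / 400) * (2.1 * Real.exp (L - 1)) :=
        h1.trans (mul_le_mul_of_nonneg_right hw (by positivity))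
      have h4 : Real.exp 2 * x (ν + μ) ≤ 7.39 * (12 * (K / 400) * (2.1 * Real.exp (L - 1))) :=
        (mul_le_mul_of_nonneg_left h3 (by positivity)).trans
          (mul_le_mul_of_nonneg_right hρ2 (by positivity))
      nlinarith
  let vec : (Fin 3 → ℤ) → (Fin 3 → ℝ) := fun ν => ![x₁ ν, x₂ ν, Y.ℓ ν]
  have hvec_add : ∀ ν μ, vec (ν + μ) = vec ν + vec μ := fun ν μ => by
    ext i
    fin_cases i <;> simp [vec]
  have hvec_sub : ∀ ν μ, vec (ν - μ) = vec ν - vec μ := fun ν μ => by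
    ext i
    fin_cases i <;> simp [vec]
  have hvec_inj : Set.InjOn vec V := fun ν hν μ hμ h => by
    by_contra hne
    have h1 : vec (μ - ν) = 0 := by rw [hvec_sub, h, sub_self]
    exact hVℓ ν hν μ hμ hne (congrFun h1 2)
  have hgen : ZeroEstimate.Generic (V.image vec) := by
    refine ⟨mem_image.2 ⟨0, hV0, ?_⟩, ?_⟩
    · ext i
      fin_cases i <;> simp [vec]
    · intro v hv w hw hne
      obtain ⟨ν, hν, rfl⟩ := mem_image.1 hv
      obtain ⟨μ, hμ, rfl⟩ := mem_image.1 hw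
      have hne' : ν ≠ μ := fun h => hne (by rw [h])
      rw [← hvec_sub]
      refine ⟨?_, hVℓ ν hν μ hμ hne'⟩
      exact (hVx ν hν μ hμ hne').imp (fun h => Int.cast_ne_zero.2 h) fun h => Int.cast_ne_zero.2 h
  have hcard : (V.image vec).card = V.card := card_image_of_injOn hvec_inj
  choose ι hιV hι using fun p : V.image vec => mem_image.1 p.2
  let ν : (V.image vec) × (V.image vec) × (V.image vec) → (Fin 3 → ℤ) := fun p =>
    ι p.1 + ι p.2.1 + ι p.2.2
  have hνvec : ∀ p, vec (ν p) = p.1.1 + p.2.1.1 + p.2.2.1 := fun p => by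
    simp only [ν, hvec_add, hι]
  have hνw : ∀ p, Y.weight (ν p) ≤ 9 * (K / 400) := fun p => by
    have h1 := Y.weight_add_le (ι p.1 + ι p.2.1) (ι p.2.2)
    have h2 := Y.weight_add_le (ι p.1) (ι p.2.1)
    have h4 := hVw _ (hιV p.1)
    have h5 := hVw _ (hιV p.2.1)
    have h6 := hVw _ (hιV p.2.2)
    linarith
  have hn₁ : ∀ p, ((x₁ (ν p)).toNat : ℝ) = x₁ (ν p) := fun p => by
    have : 0 ≤ x₁ (ν p) := by
      simp only [ν, map_add]
      exact add_nonneg (add_nonneg (hVn _ (hιV _)).1 (hVn _ (hιV _)).1) (hVn _ (hιV _)).1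
    exact_mod_cast Int.toNat_of_nonneg this
  have hn₂ : ∀ p, ((x₂ (ν p)).toNat : ℝ) = x₂ (ν p) := fun p => by
    have : 0 ≤ x₂ (ν p) := by
      simp only [ν, map_add]
      exact add_nonneg (add_nonneg (hVn _ (hιV _)).2 (hVn _ (hιV _)).2) (hVn _ (hιV _)).2
    exact_mod_cast Int.toNat_of_nonneg this
  have hdec : ∀ p, c₂ * (((x₂ (ν p)).toNat : ℝ) + c₁ / c₂ * (x₁ (ν p)).toNat) =
      Y.ℓ (ν p) - ν p 2 * Λ := fun p => by
    rw [hn₁, hn₂, hℓ]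
    field_simp
    ring
  have hKV : 2 * (K * S) * K < V.card := by
    have : 0 < K * K * S := by positivity
    nlinarith
  have main := three_log_inequality Y.φ₁ Y.φ₂ Y.one_le hS2 hK2 (V.image vec) hgen ?_ ?_ ?_ ?_
    (fun p => (x₁ (ν p)).toNat) (fun p => (x₂ (ν p)).toNat) (fun p => Y.η (ν p))
    (fun p => Y.κ (ν p)) (fun p => Y.η_pos _) (fun p => Y.κ_pos _) (c := c₂) (θ := c₁ / c₂)
    (by rw [abs_div]; exact (div_le_one (abs_pos.2 hc₂)).2 hc) (fun p => ν p 2 * Λ)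
    (fun p => by rw [Y.log_sub, hdec]; ring) (fun p => by rw [hn₁, ← hνvec]; rfl)
    (fun p => by rw [hn₂, ← hνvec]; rfl) (fun p => by rw [Y.log_sub, ← hνvec]; rfl)
    (ρ := Real.exp 2) (by linarith)
    (fun p => by
      rw [← Real.exp_nat_mul]
      have := hεw (ν p) ((hνw p).trans (by linarith))
      rw [mul_comm (2 : ℝ)] at this
      exact_mod_cast this)
    (t := L) (by linarith)
    (fun p => by
      rw [hn₁, hn₂]
      have h1 := (le_abs_self _).trans (hx₁ (ν p))
      have h2 := (le_abs_self _).trans (hx₂ (ν p))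
      have h3 : Y.weight (ν p) * (2.1 * Real.exp (L - 1)) ≤
        9 * (K / 400) * (2.1 * Real.exp (L - 1)) :=
          mul_le_mul_of_nonneg_right (hνw p) (by positivity)
      have h4 : Real.exp 2 * (x₁ (ν p) + x₂ (ν p)) ≤
          7.39 * (9 * (K / 400) * (2.1 * Real.exp (L - 1)) +
            9 * (K / 400) * (2.1 * Real.exp (L - 1))) :=
        (mul_le_mul_of_nonneg_left (add_le_add (h1.trans h3) (h2.trans h3)) (by positivity)).trans
          (mul_le_mul_of_nonneg_right hρ2 (by positivity))
      nlinarith)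
    (h₁ := 9 * (K / 400)) (h₂ := 9 * (K / 400)) (z₀ := 9 * (K / 400) + 1)
    (fun p => (Y.log_κ_le _).trans (hνw p))
    (fun p => (Y.abs_η_le _).trans (Real.exp_le_exp.2 (hνw p)))
    (fun p => (Y.abs_κ_le _).trans (Real.exp_le_exp.2 (hνw p)))
    (fun p => by
      rw [hdec]
      have h1 := (le_mul_of_one_le_left (abs_nonneg _) hE1).trans
        (hεw (ν p) ((hνw p).trans (by linarith)))
      have h2 := (Y.abs_ℓ_le (ν p)).trans (hνw p)
      rw [abs_le] at h1 h2 ⊢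
      constructor <;> linarith)
  · rw [Real.log_exp, Real.log_mul (by positivity) (by positivity),
      Real.log_mul (by positivity) (by positivity)] at main
    have l1 := hA.log_K_le
    have l2 := hA.log_S_le
    have h7 : Real.exp 2 * (9 * (K / 400) + 1) ≤ 7.39 * (9 * (K / 400) + 1) := by gcongr
    have h8 : (S - 1 : ℝ) * (9 * (K / 400) + 9 * (K / 400) + Real.exp 2 * (9 * (K / 400) + 1) + 1) ≤
        S * (9 * (K / 400) + 9 * (K / 400) + 7.39 * (9 * (K / 400) + 1) + 1) := by
      gcongr
      linarith
    have h9 : (K : ℝ) * (18 * L) ≤ K * S := by gcongr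
    nlinarith [mul_le_mul_of_nonneg_right hK0 hS0.le]
  · rw [hcard]
    refine lt_of_lt_of_le ?_ hVcard
    have h1 : (K - 1) * (K - 1) ≤ K * K := Nat.mul_le_mul (by omega) (by omega)
    have h2 : (K - 1) * (K - 1) * (S - 1) ≤ K * K * (S - 1) := Nat.mul_le_mul_right _ h1
    have h3 : K * K * (S - 1) < K * K * S := Nat.mul_lt_mul_of_pos_left (by omega) (by positivity)
    omega
  · rw [hcard]
    nlinarith
  · rw [hcard]
    have : S ≤ K * K * S := Nat.le_mul_of_pos_left _ (by positivity)
    omega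
  · intro c hc0
    by_contra hlt
    push Not at hlt
    rw [image_image] at hlt
    set f : (Fin 3 → ℤ) → ℝ := (fun v : Fin 3 → ℝ => c 0 * v 0 + c 1 * v 1) ∘ vec with hf
    have hfν : ∀ ν, f ν = c 0 * x₁ ν + c 1 * x₂ ν := fun ν => by simp [hf, vec]
    obtain ⟨y, -, hy⟩ := exists_lt_card_fiber_of_mul_lt_card_of_maps_to (s := V) (t := V.image f)
      (f := f) (n := 2 * (K * S)) (fun a ha => mem_image_of_mem _ ha)
      (lt_of_le_of_lt (by rw [mul_comm]; exact Nat.mul_le_mul_left _ hlt.le) hKV)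
    have hF : ∀ ν ∈ V.filter (fun a => f a = y), ∀ μ ∈ V.filter (fun a => f a = y),
        c 0 * (x₁ ν - x₁ μ : ℝ) + c 1 * (x₂ ν - x₂ μ) = 0 := by
      intro ν hν μ hμ
      have h1 := (mem_filter.1 hν).2
      have h2 := (mem_filter.1 hμ).2
      rw [hfν] at h1 h2
      linarith
    by_cases hc1 : c 1 = 0
    · have hc0' : c 0 ≠ 0 := fun h => hc0 (by ext i; fin_cases i <;> simp [h, hc1])
      have hx : ∀ ν ∈ V.filter (fun a => f a = y), ∀ μ ∈ V.filter (fun a => f a = y),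
          (x₁ ν - x₁ μ : ℝ) = 0 := fun ν hν μ hμ => by
        have := hF ν hν μ hμ
        rw [hc1, zero_mul, add_zero] at this
        exact (mul_eq_zero.1 this).resolve_left hc0'
      refine fiber x₂ c₂ (V.filter fun a => f a = y)
        (filter_subset _ _) (by omega) ?_ hx₂ ?_
      · intro ν hν μ hμ h
        by_contra hne
        have h3 := hx ν hν μ hμ
        rcases hVx ν (mem_filter.1 hν).1 μ (mem_filter.1 hμ).1 hne with h1 | h1
        · apply h1
          rw [map_sub]
          have : ((x₁ μ - x₁ ν : ℤ) : ℝ) = 0 := by push_cast; linarith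
          exact_mod_cast this
        · exact h1 (by rw [map_sub, h, sub_self])
      · intro ν hν μ hμ
        rw [hℓ, map_sub x₁, Int.cast_sub, hx ν hν μ hμ]
        ring
    · have hx : ∀ ν ∈ V.filter (fun a => f a = y), ∀ μ ∈ V.filter (fun a => f a = y),
          (x₂ ν - x₂ μ : ℝ) = -(c 0 / c 1) * (x₁ ν - x₁ μ) := fun ν hν μ hμ => by
        have := hF ν hν μ hμ
        field_simp
        linarith
      refine fiber x₁ (c₁ - c₂ * (c 0 / c 1)) (V.filter fun a => f a = y)
        (filter_subset _ _) (by omega) ?_ hx₁ ?_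
      · intro ν hν μ hμ h
        by_contra hne
        have h3 := hx ν hν μ hμ
        rcases hVx ν (mem_filter.1 hν).1 μ (mem_filter.1 hμ).1 hne with h1 | h1
        · exact h1 (by rw [map_sub, h, sub_self])
        · apply h1
          rw [map_sub]
          have h4 : x₁ ν = x₁ μ := h
          rw [h4, sub_self, mul_zero] at h3
          have : ((x₂ μ - x₂ ν : ℤ) : ℝ) = 0 := by push_cast; linarith
          exact_mod_cast this
      · intro ν hν μ hμ
        rw [hℓ, map_sub x₂, Int.cast_sub, hx ν hν μ hμ, map_sub x₁, Int.cast_sub]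
        ring

end LogSystem

end InterpolationDet

namespace InterpolationDet

open Finset

/-- A ring with two real embeddings containing a unit `w` of size `δ` and a square root `q`
of `Δ`. -/
structure QuadraticUnit (O : Type*) [CommRing O] (δ Δ : ℝ) where
  φ₁ : O →+* ℝ
  φ₂ : O →+* ℝ
  one_le : ∀ x : O, x ≠ 0 → 1 ≤ |φ₁ x| * |φ₂ x|
  w : O
  q : O
  map₁_w : φ₁ w = δ
  map₂_w : |φ₂ w| = δ⁻¹
  map₁_q : φ₁ q = √Δ
  map₂_q : |φ₂ q| = √Δ

/-- The ring `ℤ[ω]` with `ω ^ 2 = s + r ω`, where `s = ±1`. -/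
noncomputable def quadraticUnit {r s : ℤ} (hr : 1 ≤ r) (hs : s = -1 ∨ s = 1)
    (hΔ : 0 < r ^ 2 + 4 * s) (hns : ¬ IsSquare (r ^ 2 + 4 * s)) :
    QuadraticUnit (QuadraticAlgebra ℤ s r) (((r : ℝ) + √((r : ℝ) ^ 2 + 4 * s)) / 2)
      ((r : ℝ) ^ 2 + 4 * s) := by
  have hΔ' : (0 : ℝ) < (r : ℝ) ^ 2 + 4 * s := by exact_mod_cast hΔ
  have hsq : √((r : ℝ) ^ 2 + 4 * s) * √((r : ℝ) ^ 2 + 4 * s) = (r : ℝ) ^ 2 + 4 * s :=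
    Real.mul_self_sqrt hΔ'.le
  set d := √((r : ℝ) ^ 2 + 4 * s) with hd
  have hd0 : 0 < d := Real.sqrt_pos.2 hΔ'
  have hr' : (1 : ℝ) ≤ r := by exact_mod_cast hr
  have hs' : (s : ℝ) * s = 1 := by rcases hs with rfl | rfl <;> norm_num
  have habs : |(s : ℝ)| = 1 := by rcases hs with rfl | rfl <;> norm_num
  have hδ0 : 0 < ((r : ℝ) + d) / 2 := by positivity
  have hprod : (((r : ℝ) + d) / 2) * (((r : ℝ) - d) / 2) = -s := by nlinarith
  have hinv : (((r : ℝ) + d) / 2)⁻¹ = -s * (((r : ℝ) - d) / 2) := by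
    rw [inv_eq_iff_eq_inv, eq_comm, inv_eq_of_mul_eq_one_left]
    linear_combination (-s : ℝ) * hprod + hs'
  have hinv' : |((r : ℝ) - d) / 2| = (((r : ℝ) + d) / 2)⁻¹ := by
    rw [← abs_of_pos (inv_pos.2 hδ0), hinv, abs_mul, abs_neg, habs, one_mul]
  let φ₁ : QuadraticAlgebra ℤ s r →ₐ[ℤ] ℝ := QuadraticAlgebra.lift ⟨((r : ℝ) + d) / 2, by
    simp only [zsmul_eq_mul]; linear_combination hsq / 4⟩
  let φ₂ : QuadraticAlgebra ℤ s r →ₐ[ℤ] ℝ := QuadraticAlgebra.lift ⟨((r : ℝ) - d) / 2, by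
    simp only [zsmul_eq_mul]; linear_combination hsq / 4⟩
  have h₁ : ∀ z, φ₁ z = z.re + z.im * (((r : ℝ) + d) / 2) := fun z => by
    simp [φ₁, QuadraticAlgebra.lift]
  have h₂ : ∀ z, φ₂ z = z.re + z.im * (((r : ℝ) - d) / 2) := fun z => by
    simp [φ₂, QuadraticAlgebra.lift]
  refine ⟨φ₁, φ₂, ?_, ⟨0, 1⟩, ⟨-r, 2⟩, ?_, ?_, ?_, ?_⟩
  · intro x hx
    have hnorm : φ₁ x * φ₂ x = ((x.re * x.re + r * x.re * x.im - s * x.im * x.im : ℤ) : ℝ) := by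
      rw [h₁, h₂]; push_cast
      linear_combination (x.im : ℝ) ^ 2 * hprod
    have hne : x.re * x.re + r * x.re * x.im - s * x.im * x.im ≠ 0 := by
      intro h0
      have h4 : (2 * x.re + r * x.im) ^ 2 = (r ^ 2 + 4 * s) * x.im ^ 2 := by
        linear_combination 4 * h0
      by_cases him : x.im = 0
      · refine hx (QuadraticAlgebra.ext ?_ him)
        simpa [him] using h0
      · apply hns
        obtain ⟨e, he⟩ : x.im ∣ 2 * x.re + r * x.im :=
          (Int.pow_dvd_pow_iff two_ne_zero).1 ⟨_, h4.trans (mul_comm _ _)⟩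
        refine ⟨e, ?_⟩
        rw [he] at h4
        have : x.im ^ 2 ≠ 0 := pow_ne_zero _ him
        apply mul_right_cancel₀ this
        rw [← h4]; ring
    change 1 ≤ |φ₁ x| * |φ₂ x|
    rw [← abs_mul, hnorm, ← Int.cast_abs]
    exact_mod_cast Int.one_le_abs hne
  · change φ₁ _ = _
    rw [h₁]; simp
  · change |φ₂ _| = _
    rw [h₂]; simpa using hinv'
  · change φ₁ _ = _
    rw [h₁]; push_cast; ring
  · change |φ₂ _| = _
    rw [h₂, ← abs_neg, show -(((-r : ℤ) : ℝ) + ((2 : ℤ) : ℝ) * (((r : ℝ) - d) / 2)) = d by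
      push_cast; ring, abs_of_pos hd0]

namespace QuadraticUnit

variable {O : Type*} [CommRing O] {δ Δ : ℝ} (Z : QuadraticUnit O δ Δ)

theorem map₁_injective : Function.Injective Z.φ₁ := by
  rw [injective_iff_map_eq_zero]
  intro x hx
  by_contra h
  have := Z.one_le x h
  rw [hx, abs_zero, zero_mul] at this
  linarith

/-- The parameters of the logarithms of `b`, `δ` and `a√Δ/(b-1)`. -/
structure Data (δ Δ : ℝ) (a b : ℤ) : Prop where
  hδ : 48 / 100 ≤ Real.log δ
  hδ0 : 1 ≤ δ
  hΔ : 5 ≤ Δ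
  hb : 2 ≤ b
  ha : 1 ≤ a
  hab : a ≤ b - 1

variable {a b : ℤ}

namespace Data

theorem b_real (h : Data δ Δ a b) : (2 : ℝ) ≤ b := by exact_mod_cast h.hb

theorem a_real (h : Data δ Δ a b) : (1 : ℝ) ≤ a := by exact_mod_cast h.ha

theorem ab_real (h : Data δ Δ a b) : (a : ℝ) ≤ b - 1 := by exact_mod_cast h.hab

theorem log_b (h : Data δ Δ a b) : 69 / 100 ≤ Real.log b :=
  le_trans (by linarith [Real.log_two_gt_d9]) (Real.log_le_log (by norm_num) h.b_real)

theorem log_Δ (h : Data δ Δ a b) : 138 / 100 ≤ Real.log Δ := by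
  have h1 : Real.log 4 = 2 * Real.log 2 := by
    rw [← Real.log_rpow (by norm_num)]
    norm_num
  have h2 := Real.log_le_log (by norm_num : (0 : ℝ) < 4) (by linarith [h.hΔ] : 4 ≤ Δ)
  linarith [Real.log_two_gt_d9]

theorem one_le_sqrt (h : Data δ Δ a b) : 1 ≤ √Δ := Real.one_le_sqrt.2 (by linarith [h.hΔ])

theorem log_sqrt (h : Data δ Δ a b) : Real.log √Δ = Real.log Δ / 2 :=
  Real.log_sqrt (by linarith [h.hΔ])

theorem log_pred (h : Data δ Δ a b) : 0 ≤ Real.log (b - 1) ∧ Real.log (b - 1) ≤ Real.log b := by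
  have := h.b_real
  exact ⟨Real.log_nonneg (by linarith), Real.log_le_log (by linarith) (by linarith)⟩

theorem log_a_sqrt (h : Data δ Δ a b) : 0 ≤ Real.log (a * √Δ) ∧
    Real.log (a * √Δ) ≤ Real.log b + Real.log Δ / 2 := by
  have h1 := h.a_real
  have h2 := h.one_le_sqrt
  refine ⟨Real.log_nonneg (by nlinarith), ?_⟩
  rw [Real.log_mul (by linarith) (by linarith), h.log_sqrt]
  have := Real.log_le_log (x := a) (y := b) (by linarith) (by linarith [h.ab_real])
  linarith

end Data

/-- The numerators of the `LogSystem` generated by `b⁻¹`, `δ` and `a√Δ/(b-1)`. -/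
def num (a b : ℤ) (ν : Fin 3 → ℤ) : O :=
  (b : O) ^ (-ν 0).toNat * Z.w ^ (ν 1).toNat * ((a : O) * Z.q) ^ (ν 2).toNat *
    ((b : O) - 1) ^ (-ν 2).toNat

theorem map₁_num (ν : Fin 3 → ℤ) : Z.φ₁ (Z.num a b ν) =
    (b : ℝ) ^ (-ν 0).toNat * δ ^ (ν 1).toNat * (a * √Δ) ^ (ν 2).toNat *
      ((b : ℝ) - 1) ^ (-ν 2).toNat := by
  simp [num, Z.map₁_w, Z.map₁_q]

theorem abs_map₂_num (h : Data δ Δ a b) (ν : Fin 3 → ℤ) : |Z.φ₂ (Z.num a b ν)| =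
    (b : ℝ) ^ (-ν 0).toNat * δ⁻¹ ^ (ν 1).toNat * (a * √Δ) ^ (ν 2).toNat *
      ((b : ℝ) - 1) ^ (-ν 2).toNat := by
  have h1 := h.b_real
  have h2 := h.a_real
  rw [num]
  simp only [map_mul, map_pow, map_sub, map_one, map_intCast, abs_mul, abs_pow, Z.map₂_w, Z.map₂_q]
  rw [abs_of_pos (by linarith : (0 : ℝ) < b), abs_of_pos (by linarith : (0 : ℝ) < a),
    abs_of_pos (by linarith : (0 : ℝ) < b - 1)]

theorem log_num {c x y z : ℝ} (hx : 0 < x) (hc : 0 < c) (hy : 0 < y) (hz : 0 < z) (i j k l : ℕ) :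
    Real.log (x ^ i * c ^ j * y ^ k * z ^ l) =
      i * Real.log x + j * Real.log c + k * Real.log y + l * Real.log z := by
  rw [Real.log_mul (by positivity) (by positivity), Real.log_mul (by positivity) (by positivity),
    Real.log_mul (by positivity) (by positivity)]
  simp only [Real.log_pow]

theorem toNat_sub_toNat_neg_cast (x : ℤ) : ((x.toNat : ℝ) - ((-x).toNat : ℝ)) = x := by
  exact_mod_cast Int.toNat_sub_toNat_neg x

theorem toNat_add_toNat_neg_cast (x : ℤ) : ((x.toNat : ℝ) + ((-x).toNat : ℝ)) = |(x : ℝ)| := by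
  have : x.toNat + (-x).toNat = x.natAbs := by omega
  rw [← Int.cast_abs, Int.abs_eq_natAbs, ← Nat.cast_add, this]
  simp

/-- The `LogSystem` generated by `b⁻¹`, `δ` and `a√Δ/(b-1)`. -/
noncomputable def logSystem (h : Data δ Δ a b) : LogSystem O :=
  have h1 := h.b_real
  have h2 := h.a_real
  have h3 := h.one_le_sqrt
  have h4 := h.hδ
  have h5 := h.log_b
  have h6 := h.log_Δ
  have h7 : 0 < δ := by linarith [h.hδ0]
  have h8 := h.log_a_sqrt
  have h9 := h.log_pred
  have haq : 0 < a * √Δ := by nlinarith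
  have hpos : ∀ ν, 0 < Z.φ₁ (Z.num a b ν) := fun ν => by
    rw [map₁_num]
    have : (0 : ℝ) < b - 1 := by linarith
    positivity
  have hlog : ∀ ν, Real.log (Z.φ₁ (Z.num a b ν)) = (-ν 0).toNat * Real.log b +
      (ν 1).toNat * Real.log δ + (ν 2).toNat * Real.log (a * √Δ) +
      (-ν 2).toNat * Real.log (b - 1) := fun ν => by
    rw [map₁_num, log_num (by linarith) h7 haq (by linarith)]
  have hlog₂ : ∀ ν, Real.log |Z.φ₂ (Z.num a b ν)| = (-ν 0).toNat * Real.log b -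
      (ν 1).toNat * Real.log δ + (ν 2).toNat * Real.log (a * √Δ) +
      (-ν 2).toNat * Real.log (b - 1) := fun ν => by
    rw [Z.abs_map₂_num h, log_num (by linarith) (by positivity) haq (by linarith), Real.log_inv]
    ring
  have key : ∀ ν : Fin 3 → ℤ, (-ν 0).toNat * Real.log b +
      (ν 1).toNat * Real.log δ + (ν 2).toNat * Real.log (a * √Δ) +
      (-ν 2).toNat * Real.log (b - 1) ≤ |(ν 0 : ℝ)| * Real.log b + |(ν 1 : ℝ)| * Real.log δ +
        |(ν 2 : ℝ)| * (Real.log b + Real.log Δ / 2) := fun ν => by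
    have e0 := toNat_add_toNat_neg_cast (ν 0)
    have e1 := toNat_add_toNat_neg_cast (ν 1)
    rw [← e0, ← e1, ← toNat_add_toNat_neg_cast (ν 2)]
    have t0 : 0 ≤ ((ν 0).toNat : ℝ) * Real.log b := mul_nonneg (by positivity) (by linarith)
    have t1 : 0 ≤ ((-ν 1).toNat : ℝ) * Real.log δ := mul_nonneg (by positivity) (by linarith)
    have t2 : ((ν 2).toNat : ℝ) * Real.log (a * √Δ) ≤
      ((ν 2).toNat : ℝ) * (Real.log b + Real.log Δ / 2) :=
      mul_le_mul_of_nonneg_left h8.2 (by positivity)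
    have t3 : ((-ν 2).toNat : ℝ) * Real.log (b - 1) ≤
      ((-ν 2).toNat : ℝ) * (Real.log b + Real.log Δ / 2) :=
      mul_le_mul_of_nonneg_left (by linarith) (by positivity)
    linarith
  have key₂ : ∀ ν, |Z.φ₂ (Z.num a b ν)| ≤ Real.exp (|(ν 0 : ℝ)| * Real.log b +
      |(ν 1 : ℝ)| * Real.log δ + |(ν 2 : ℝ)| * (Real.log b + Real.log Δ / 2)) := fun ν => by
    have hp : 0 < |Z.φ₂ (Z.num a b ν)| := by
      rw [Z.abs_map₂_num h]
      have : (0 : ℝ) < b - 1 := by linarith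
      positivity
    rw [← Real.log_le_iff_le_exp hp, hlog₂]
    have t1 : 0 ≤ ((ν 1).toNat : ℝ) * Real.log δ := mul_nonneg (by positivity) (by linarith)
    linarith [key ν]
  { φ₁ := Z.φ₁
    φ₂ := Z.φ₂
    one_le := Z.one_le
    η := Z.num a b
    κ := fun ν => Z.num a b (-ν)
    η_pos := hpos
    κ_pos := fun ν => hpos _
    g := ![Real.log b, Real.log δ, Real.log b + Real.log Δ / 2]
    le_g := fun i => by
      fin_cases i
      · simp only [Fin.zero_eta, Matrix.cons_val_zero]; linarith
      · exact h4
      · simp only [Fin.reduceFinMk, Matrix.cons_val]; linarith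
    ℓ :=
      { toFun := fun ν => -ν 0 * Real.log b + ν 1 * Real.log δ +
          ν 2 * (Real.log (a * √Δ) - Real.log (b - 1))
        map_zero' := by simp
        map_add' := fun ν μ => by simp only [Pi.add_apply]; push_cast; ring }
    log_sub := fun ν => by
      simp only [AddMonoidHom.coe_mk, ZeroHom.coe_mk]
      rw [hlog, hlog]
      simp only [Pi.neg_apply, neg_neg]
      rw [← toNat_sub_toNat_neg_cast (ν 0), ← toNat_sub_toNat_neg_cast (ν 1),
        ← toNat_sub_toNat_neg_cast (ν 2)]
      ring
    log_κ_le := fun ν => by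
      rw [hlog]
      refine (key _).trans (le_of_eq ?_)
      simp [Fin.sum_univ_three]
    abs_η_le := fun ν => by
      simpa [Fin.sum_univ_three] using key₂ ν
    abs_κ_le := fun ν => by
      simpa [Fin.sum_univ_three] using key₂ (-ν)
    abs_ℓ_le := fun ν => by
      simp only [AddMonoidHom.coe_mk, ZeroHom.coe_mk, Fin.sum_univ_three, Matrix.cons_val]
      refine (abs_add_three _ _ _).trans (add_le_add (add_le_add ?_ ?_) ?_)
      · rw [abs_mul, abs_neg, abs_of_nonneg (by linarith : 0 ≤ Real.log b)]
      · rw [abs_mul, abs_of_nonneg (by linarith : 0 ≤ Real.log δ)]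
      · rw [abs_mul]
        refine mul_le_mul_of_nonneg_left ?_ (abs_nonneg _)
        rw [abs_le]
        constructor <;> linarith }

theorem ℓ_apply (h : Data δ Δ a b) (ν : Fin 3 → ℤ) : (Z.logSystem h).ℓ ν =
    -ν 0 * Real.log b + ν 1 * Real.log δ + ν 2 * (Real.log (a * √Δ) - Real.log (b - 1)) := rfl

theorem weight_eq (h : Data δ Δ a b) (ν : Fin 3 → ℤ) : (Z.logSystem h).weight ν =
    |(ν 0 : ℝ)| * Real.log b + |(ν 1 : ℝ)| * Real.log δ +
      |(ν 2 : ℝ)| * (Real.log b + Real.log Δ / 2) := by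
  simp [LogSystem.weight, Fin.sum_univ_three, logSystem]

/-- A relation between the logarithms does not involve `δ`, by conjugation. -/
theorem eq_zero_of_ℓ_eq_zero (h : Data δ Δ a b) {ν : Fin 3 → ℤ} (hν : (Z.logSystem h).ℓ ν = 0) :
    ν 1 = 0 := by
  have h1 := h.b_real
  have h2 := h.a_real
  have h3 := h.one_le_sqrt
  have h4 := h.hδ
  have h7 : 0 < δ := by linarith [h.hδ0]
  have haq : 0 < a * √Δ := by nlinarith
  have hη : Z.num a b ν = Z.num a b (-ν) := by
    apply Z.map₁_injective
    refine Real.log_injOn_pos ((Z.logSystem h).η_pos ν) ((Z.logSystem h).κ_pos ν) ?_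
    have := (Z.logSystem h).log_sub ν
    rw [hν] at this
    exact sub_eq_zero.1 this
  have hlog := congrArg (fun x => Real.log |Z.φ₂ x|) hη
  simp only [Z.abs_map₂_num h, Pi.neg_apply, neg_neg] at hlog
  rw [log_num (by linarith) (by positivity) haq (by linarith),
    log_num (by linarith) (by positivity) haq (by linarith), Real.log_inv] at hlog
  rw [ℓ_apply] at hν
  rw [← toNat_sub_toNat_neg_cast (ν 0), ← toNat_sub_toNat_neg_cast (ν 2)] at hν
  have e1 := toNat_sub_toNat_neg_cast (ν 1)
  have : (ν 1 : ℝ) * Real.log δ = 0 := by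
    rw [← e1] at hν ⊢
    linarith
  rcases mul_eq_zero.1 this with h | h
  · exact_mod_cast h
  · linarith

end QuadraticUnit

end InterpolationDet

namespace InterpolationDet

open Finset

/-- Liouville's inequality for the linear forms of a `LogSystem`. -/
theorem LogSystem.one_le_exp_mul_abs_ℓ {O : Type*} [CommRing O] (Y : LogSystem O)
    {ν : Fin 3 → ℤ} (hν : Y.ℓ ν ≠ 0) : 1 ≤ 4 * Real.exp (2 * Y.weight ν) * |Y.ℓ ν| := by
  have hW : 0 ≤ Y.weight ν := sum_nonneg fun i _ => mul_nonneg (abs_nonneg _) (Y.g_pos i).le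
  have hE : 1 ≤ Real.exp (2 * Y.weight ν) := Real.one_le_exp (by linarith)
  rcases le_total 1 |Y.ℓ ν| with h1 | h1
  · nlinarith
  have hηκ : Y.φ₁ (Y.η ν) = Real.exp (Y.ℓ ν) * Y.φ₁ (Y.κ ν) := by
    rw [← Y.log_sub, Real.exp_sub, Real.exp_log (Y.η_pos _), Real.exp_log (Y.κ_pos _),
      div_mul_cancel₀ _ (Y.κ_pos _).ne']
  have hne : Y.η ν - Y.κ ν ≠ 0 := by
    intro h0
    rw [sub_eq_zero.1 h0] at hηκ
    have : Real.exp (Y.ℓ ν) = 1 :=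
      mul_right_cancel₀ (Y.κ_pos ν).ne' (by rw [← hηκ, one_mul])
    exact hν (Real.exp_eq_one_iff _ |>.1 this)
  have h := Y.one_le _ hne
  have hκ : Y.φ₁ (Y.κ ν) ≤ Real.exp (Y.weight ν) :=
    (Real.log_le_iff_le_exp (Y.κ_pos ν)).1 (Y.log_κ_le ν)
  have e1 : |Y.φ₁ (Y.η ν - Y.κ ν)| ≤ 2 * |Y.ℓ ν| * Real.exp (Y.weight ν) := by
    rw [map_sub, hηκ, ← sub_one_mul, abs_mul, abs_of_pos (Y.κ_pos ν)]
    exact mul_le_mul (Real.abs_exp_sub_one_le h1) hκ (Y.κ_pos ν).le (by positivity)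
  have e2 : |Y.φ₂ (Y.η ν - Y.κ ν)| ≤ 2 * Real.exp (Y.weight ν) := by
    rw [map_sub]
    have t1 := Y.abs_η_le ν
    have t2 := Y.abs_κ_le ν
    have t3 := abs_sub (Y.φ₂ (Y.η ν)) (Y.φ₂ (Y.κ ν))
    change _ ≤ Real.exp (Y.weight ν) at t1 t2
    linarith
  calc 1 ≤ _ := h
    _ ≤ 2 * |Y.ℓ ν| * Real.exp (Y.weight ν) * (2 * Real.exp (Y.weight ν)) :=
        mul_le_mul e1 e2 (abs_nonneg _) (by positivity)
    _ = _ := by rw [two_mul (Y.weight ν), Real.exp_add]; ring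

namespace QuadraticUnit

open LogSystem

variable {O : Type*} [CommRing O] {δ Δ : ℝ} (Z : QuadraticUnit O δ Δ) {a b : ℤ}

/-- The parameters of the three logarithm argument. -/
structure Parameters (δ Δ : ℝ) (a b : ℤ) (k n K S : ℕ) (D L Λ : ℝ) : Prop
    extends Data δ Δ a b, Admissible K S L where
  D_pos : 0 < D
  L_eq : Real.exp (L - 1) = D
  D_eq : D * Real.log b = Real.log b + n * Real.log δ
  K_le_D : (K : ℝ) ≤ D
  K_le_N : (K : ℝ) ≤ n * Real.log δ
  S_log_b : 40 * (S * Real.log b) ≤ K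
  S_le_K : 200000 * (S * (Real.log b * Real.log δ)) ≤ K
  exp_Λ : Real.exp (2 * (K * S)) * (K * |Λ|) ≤ 1
  Λ_eq : Λ = Real.log (a * √Δ) - Real.log (b - 1) + k * Real.log b - n * Real.log δ

theorem Parameters.K_mul_Λ {k n K S : ℕ} {D L Λ : ℝ} (hP : Parameters δ Δ a b k n K S D L Λ) :
    K * |Λ| ≤ 1 := by
  refine le_trans (le_mul_of_one_le_left (by positivity) ?_) hP.exp_Λ
  exact Real.one_le_exp (by positivity)

/-- The size of the points of the degenerate two logarithm argument. -/
theorem exponent_bound {K D L lb ld ν₂ P Q Λ N x₁ x₂ x₃ : ℝ} (hK : 10 ^ 6 ≤ K) (hKD : K ≤ D)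
    (hL : Real.exp (L - 1) = D) (hD : D * lb = lb + N) (hlb : 69 / 100 ≤ lb) (hld : 48 / 100 ≤ ld)
    (hΛ : |Λ| ≤ 1) (hν : 0 ≤ ν₂) (hνK : ν₂ * lb ≤ K / 400)
    (hQ : Q * ld = ν₂ * N) (hP : P * lb = ν₂ * (N + Λ)) (hQ0 : 0 ≤ Q) (hP0 : 0 ≤ P)
    (h1 : 0 ≤ x₁) (h2 : 0 ≤ x₂) (h3 : 0 ≤ x₃) (h1K : x₁ ≤ K / 20) (h2K : x₂ ≤ K / 200)
    (h3K : x₃ ≤ K / 100) :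
    Real.exp 2 * (x₁ * Q + (x₂ * Q + x₃ * P)) + K ≤ K * Real.exp (2 * L - 1) := by
  have hK0 : 0 < K := by linarith
  have hD0 : 0 < D := by linarith
  have hDν : D * (ν₂ * lb) ≤ D * (K / 400) := mul_le_mul_of_nonneg_left hνK hD0.le
  have hQb : Q ≤ D * (K / 100) := by
    have e1 : Q * (48 / 100) ≤ Q * ld := mul_le_mul_of_nonneg_left hld hQ0
    have e2 : ν₂ * N ≤ ν₂ * (D * lb) := mul_le_mul_of_nonneg_left (by linarith) hν
    have e3 : 0 ≤ D * K := by positivity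
    linarith
  have hPb : P ≤ D * (K / 100) := by
    have e1 : P * (69 / 100) ≤ P * lb := mul_le_mul_of_nonneg_left hlb hP0
    have hDlb : D * (69 / 100) ≤ D * lb := mul_le_mul_of_nonneg_left hlb hD0.le
    have e2 : ν₂ * (N + Λ) ≤ ν₂ * (2 * (D * lb)) :=
      mul_le_mul_of_nonneg_left (by linarith [le_abs_self Λ]) hν
    have e3 : 0 ≤ D * K := by positivity
    linarith
  have hexp : 2 * (D * D) ≤ Real.exp (2 * L - 1) := by
    have : Real.exp (2 * L - 1) = Real.exp 1 * (D * D) := by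
      rw [← hL, ← Real.exp_add, ← Real.exp_add]; ring_nf
    rw [this]
    exact mul_le_mul_of_nonneg_right (by linarith [Real.exp_one_gt_d9]) (by positivity)
  obtain ⟨-, hρ⟩ := exp_two_bounds
  have hXD : x₁ * Q + (x₂ * Q + x₃ * P) ≤ K * (D * D) / 1000 := by
    have t1 : x₁ * Q ≤ K / 20 * (D * (K / 100)) := mul_le_mul h1K hQb hQ0 (by positivity)
    have t2 : x₂ * Q ≤ K / 200 * (D * (K / 100)) := mul_le_mul h2K hQb hQ0 (by positivity)
    have t3 : x₃ * P ≤ K / 100 * (D * (K / 100)) := mul_le_mul h3K hPb hP0 (by positivity)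
    have t4 : K * D * K ≤ K * D * D := mul_le_mul_of_nonneg_left hKD (by positivity)
    have t5 : 0 ≤ K * D * D := by positivity
    linarith
  have hX0 : 0 ≤ x₁ * Q + (x₂ * Q + x₃ * P) := by positivity
  have hDD : 1 ≤ D * D := by nlinarith
  calc Real.exp 2 * (x₁ * Q + (x₂ * Q + x₃ * P)) + K
      ≤ 7.39 * (K * (D * D) / 1000) + K * (D * D) := by
        refine add_le_add (mul_le_mul hρ hXD hX0 (by norm_num)) ?_
        exact le_mul_of_one_le_right hK0.le hDD
    _ ≤ K * (2 * (D * D)) := by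
        have : 0 ≤ K * (D * D) := by positivity
        linarith
    _ ≤ _ := mul_le_mul_of_nonneg_left hexp hK0.le

theorem dependent_false {k n K S : ℕ} {D L Λ : ℝ} (hP : Parameters δ Δ a b k n K S D L Λ)
    {ν : Fin 3 → ℤ} (hν : (Z.logSystem hP.toData).ℓ ν = 0) (hν2 : 0 < ν 2)
    (hb2 : |(ν 2 : ℝ)| * (Real.log b + Real.log Δ / 2) ≤ K / 400) : False := by
  have h := hP.toData
  have hA := hP.toAdmissible
  set Y := Z.logSystem hP.toData with hY
  have hlb := h.log_b
  have hld := h.hδ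
  have hlΔ := h.log_Δ
  have hS0 := hA.S_pos
  have hK6 := hA.le_K
  have hK0 : (0 : ℝ) < K := by linarith
  have hKD := hP.K_le_D
  have hKΛ := hP.K_mul_Λ
  have hν1 : ν 1 = 0 := Z.eq_zero_of_ℓ_eq_zero _ hν
  have hν2' : (1 : ℝ) ≤ ν 2 := by exact_mod_cast hν2
  rw [hY, ℓ_apply, hν1] at hν
  set P : ℤ := ν 0 + k * ν 2 with hPdef
  set Q : ℤ := n * ν 2 with hQdef
  set lb := Real.log b with hlbdef
  set ld := Real.log δ with hlddef
  have hPQ : (P : ℝ) * lb - Q * ld = ν 2 * Λ := by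
    rw [hP.Λ_eq, hPdef, hQdef]; push_cast at hν ⊢
    linear_combination -hν
  have hN := hP.K_le_N
  have hn0 : (0 : ℝ) < n := by
    rcases (Nat.cast_nonneg (α := ℝ) n).eq_or_lt with h0 | h0
    · rw [← h0, zero_mul] at hN
      linarith
    · exact h0
  have hQ0 : (0 : ℝ) < Q := by rw [hQdef]; push_cast; positivity
  have hΛ1 : |Λ| ≤ 1 := (le_mul_of_one_le_left (abs_nonneg _) (by linarith)).trans hKΛ
  have hP0 : (0 : ℝ) < P := by
    have h1 : 0 < (P : ℝ) * lb := by
      have h2 : (P : ℝ) * lb = ν 2 * (n * ld + Λ) := by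
        rw [hQdef] at hPQ; push_cast at hPQ; linarith
      rw [h2]
      have := neg_abs_le Λ
      exact mul_pos (by linarith) (by linarith)
    exact pos_of_mul_pos_left h1 (by linarith)
  have hP1 : (1 : ℝ) ≤ P := by
    have : 0 < P := by exact_mod_cast hP0
    exact_mod_cast this
  have h_ν_log_b : (ν 2 : ℝ) * lb ≤ K / 400 := by
    rw [abs_of_nonneg (by linarith)] at hb2
    refine le_trans (mul_le_mul_of_nonneg_left ?_ (by linarith)) hb2
    linarith
  have h_ν_two : (ν 2 : ℝ) ≤ K / 200 := by
    have := mul_le_mul_of_nonneg_left hlb (by linarith : (0 : ℝ) ≤ ν 2)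
    linarith
  let X : (Fin 3 → ℤ) →+ ℤ :=
    { toFun := fun x => -x 0 * Q + x 1 * P
      map_zero' := by simp
      map_add' := fun x y => by simp only [Pi.add_apply]; ring }
  have hX : ∀ x, X x = -x 0 * Q + x 1 * P := fun _ => rfl
  let I : ℕ := ⌊(K : ℝ) / 400 / lb⌋₊
  let J : ℕ := ⌊(K : ℝ) / 400 / ld⌋₊
  have hI : (I : ℝ) * lb ≤ K / 400 := by
    rw [← le_div_iff₀ (by linarith)]
    exact Nat.floor_le (by positivity)
  have hJ : (J : ℝ) * ld ≤ K / 400 := by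
    rw [← le_div_iff₀ (by linarith)]
    exact Nat.floor_le (by positivity)
  have hI' : K / 400 ≤ ((I : ℝ) + 1) * lb := by
    rw [← div_le_iff₀ (by linarith)]
    exact (Nat.lt_floor_add_one _).le
  have hJ' : K / 400 ≤ ((J : ℝ) + 1) * ld := by
    rw [← div_le_iff₀ (by linarith)]
    exact (Nat.lt_floor_add_one _).le
  have hIK : (I : ℝ) ≤ K / 200 := by
    have := mul_le_mul_of_nonneg_left hlb (Nat.cast_nonneg (α := ℝ) I)
    linarith
  have hJK : (J : ℝ) ≤ K / 100 := by
    have := mul_le_mul_of_nonneg_left hld (Nat.cast_nonneg (α := ℝ) J)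
    linarith
  let e₁ : ℕ → (Fin 3 → ℤ) := fun j => ![-(j : ℤ), 0, 0]
  let e₂ : ℕ × ℕ → (Fin 3 → ℤ) := fun p => ![-(p.1 : ℤ), p.2, 0]
  have hsum : ∀ j p, e₁ j + e₂ p = ![-((j + p.1 : ℕ) : ℤ), p.2, 0] := fun j p => by
    ext i
    fin_cases i <;> simp [e₁, e₂]
    ring
  have hℓ₁ : ∀ j : ℕ, Y.ℓ (e₁ j) = j * lb := fun j => by
    rw [hY, ℓ_apply]; simp [e₁, hlbdef]
  have hX₁ : ∀ j : ℕ, X (e₁ j) = j * Q := fun j => by simp [hX, e₁]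
  have hX₂ : ∀ p : ℕ × ℕ, X (e₂ p) = p.1 * Q + p.2 * P := fun p => by simp [hX, e₂]
  have hQZ : 0 < Q := by exact_mod_cast hQ0
  have hPZ : 0 < P := by exact_mod_cast hP0
  refine two_log_contradiction Y hA X ((range S).image e₁)
    ((range (I + 1) ×ˢ range (J + 1)).image e₂) ?_ ?_ ?_ ?_ (lb / Q) ?_ ?_ ?_
  · intro x hx
    obtain ⟨j, -, rfl⟩ := mem_image.1 hx
    rw [hX₁]; positivity
  · intro x hx
    obtain ⟨p, -, rfl⟩ := mem_image.1 hx
    rw [hX₂]; positivity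
  · rw [image_image, card_image_of_injective, card_range]
    intro i j hij
    simp only [Function.comp, hℓ₁] at hij
    exact_mod_cast mul_right_cancel₀ (by linarith : lb ≠ 0) hij
  · rw [image_image, card_image_of_injOn, card_product, card_range, card_range]
    · have h1 : (K : ℝ) / 400 * (K / 400) ≤ (((I : ℝ) + 1) * lb) * (((J : ℝ) + 1) * ld) :=
        mul_le_mul hI' hJ' (by positivity) (by positivity)
      have h2 := hP.S_le_K
      have h3 : ((K * S : ℕ) : ℝ) ≤ (((I + 1) * (J + 1) : ℕ) : ℝ) := by
        push_cast
        have hlbld : 0 < lb * ld := mul_pos (by linarith) (by linarith)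
        refine le_of_mul_le_mul_right ?_ hlbld
        have h4 : (K : ℝ) * (200000 * (S * (lb * ld))) ≤ K * K :=
          mul_le_mul_of_nonneg_left h2 hK0.le
        linarith [mul_pos hK0 hK0]
      exact_mod_cast h3
    · rintro ⟨i, j⟩ hij ⟨i', j'⟩ hij' heq
      simp only [coe_product, Set.mem_prod, mem_coe, mem_range] at hij hij'
      simp only [Function.comp, hX₂] at heq
      let μ : Fin 3 → ℤ := ![(i' : ℤ) - i, j - j', 0]
      have hμX : ((i : ℝ) - i') * Q + ((j : ℝ) - j') * P = 0 := by
        have : ((i : ℝ) * Q + j * P) = i' * Q + j' * P := by exact_mod_cast heq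
        linear_combination this
      have hμℓ : Y.ℓ μ = (i - i') * lb + (j - j') * ld := by
        rw [hY, ℓ_apply]; simp [μ, hlbdef, hlddef]
      have hμℓ' : P * Y.ℓ μ = (i - i') * (ν 2 * Λ) := by
        rw [hμℓ, ← hPQ]; linear_combination ld * hμX
      have hi : |(i : ℝ) - i'| ≤ I := by
        have h1 : (i : ℝ) ≤ I := by exact_mod_cast Nat.lt_succ_iff.1 hij.1
        have h2 : (i' : ℝ) ≤ I := by exact_mod_cast Nat.lt_succ_iff.1 hij'.1
        rw [abs_le]
        constructor <;> linarith [Nat.cast_nonneg (α := ℝ) i, Nat.cast_nonneg (α := ℝ) i']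
      have hj : |(j : ℝ) - j'| ≤ J := by
        have h1 : (j : ℝ) ≤ J := by exact_mod_cast Nat.lt_succ_iff.1 hij.2
        have h2 : (j' : ℝ) ≤ J := by exact_mod_cast Nat.lt_succ_iff.1 hij'.2
        rw [abs_le]
        constructor <;> linarith [Nat.cast_nonneg (α := ℝ) j, Nat.cast_nonneg (α := ℝ) j']
      by_cases hz : Y.ℓ μ = 0
      · have h1 := Z.eq_zero_of_ℓ_eq_zero _ hz
        have h2 : j = j' := by simp [μ] at h1; omega
        subst h2
        simp only [sub_self, zero_mul, add_zero] at hμX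
        have h3 : (i : ℝ) = i' := by
          rcases mul_eq_zero.1 hμX with h | h
          · linarith
          · linarith
        have : i = i' := by exact_mod_cast h3
        rw [this]
      · exfalso
        have hL := Y.one_le_exp_mul_abs_ℓ hz
        have hw : Y.weight μ ≤ K / 200 := by
          rw [hY, weight_eq]
          simp only [μ, Matrix.cons_val_zero, Matrix.cons_val_one, Matrix.cons_val]
          push_cast
          rw [abs_sub_comm (i' : ℝ), abs_zero, zero_mul, add_zero]
          have t1 : |(i : ℝ) - i'| * lb ≤ I * lb := mul_le_mul_of_nonneg_right hi (by linarith)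
          have t2 : |(j : ℝ) - j'| * ld ≤ J * ld := mul_le_mul_of_nonneg_right hj (by linarith)
          linarith
        have hsmall : |Y.ℓ μ| ≤ K / 40000 * (K * |Λ|) := by
          have h1 : |Y.ℓ μ| ≤ |(P : ℝ) * Y.ℓ μ| := by
            rw [abs_mul, abs_of_pos hP0]
            exact le_mul_of_one_le_left (abs_nonneg _) hP1
          rw [hμℓ', abs_mul, abs_mul, abs_of_pos (by linarith : (0 : ℝ) < ν 2)] at h1
          refine h1.trans ?_
          calc |(i : ℝ) - i'| * (ν 2 * |Λ|) ≤ K / 200 * (K / 200 * |Λ|) := by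
                refine mul_le_mul (hi.trans hIK) ?_ (by positivity) (by positivity)
                exact mul_le_mul_of_nonneg_right h_ν_two (abs_nonneg _)
            _ = _ := by ring
        have hexp : (K : ℝ) / 10000 * Real.exp (K / 100) < Real.exp (2 * (K * S)) := by
          have h1 : (K : ℝ) / 10000 < Real.exp (K / 100) := by
            linarith [Real.add_one_le_exp ((K : ℝ) / 100)]
          calc (K : ℝ) / 10000 * Real.exp (K / 100) < Real.exp (K / 100) * Real.exp (K / 100) :=
                mul_lt_mul_of_pos_right h1 (Real.exp_pos _)
            _ = Real.exp (K / 100 + K / 100) := (Real.exp_add _ _).symm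
            _ ≤ _ := Real.exp_le_exp.2 (by
                have : (1 : ℝ) ≤ S := by linarith [hA.le_S, hA.le_L]
                have := mul_le_mul_of_nonneg_left this hK0.le
                linarith)
        have hexp1 : Real.exp (2 * Y.weight μ) ≤ Real.exp (K / 100) :=
          Real.exp_le_exp.2 (by linarith)
        have hΛ0 : 0 < |Λ| := by
          rw [abs_pos]
          rintro rfl
          rw [abs_zero, mul_zero, mul_zero] at hsmall
          exact hz (abs_eq_zero.1 (le_antisymm hsmall (abs_nonneg _)))
        have : (1 : ℝ) < 1 := calc
          (1 : ℝ) ≤ 4 * Real.exp (2 * Y.weight μ) * |Y.ℓ μ| := hL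
          _ ≤ 4 * Real.exp (K / 100) * (K / 40000 * (K * |Λ|)) :=
            mul_le_mul (by linarith) hsmall (abs_nonneg _) (by positivity)
          _ = (K : ℝ) / 10000 * Real.exp (K / 100) * (K * |Λ|) := by ring
          _ < Real.exp (2 * (K * S)) * (K * |Λ|) :=
            mul_lt_mul_of_pos_right hexp (by positivity)
          _ ≤ 1 := hP.exp_Λ
        exact lt_irrefl _ this
  · intro x hx y hy
    obtain ⟨j, hj, rfl⟩ := mem_image.1 hx
    obtain ⟨p, hp, rfl⟩ := mem_image.1 hy
    simp only [mem_product, mem_range] at hp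
    rw [hsum, hX, hY, ℓ_apply]
    simp only [Matrix.cons_val_zero, Matrix.cons_val_one, Matrix.cons_val]
    have hp2 : (p.2 : ℝ) ≤ K := by
      have : (p.2 : ℝ) ≤ J := by exact_mod_cast Nat.lt_succ_iff.1 hp.2
      linarith
    have hn1 : (1 : ℝ) ≤ n := by
      have : 0 < n := by exact_mod_cast hn0
      exact_mod_cast this
    have heq : (-((-((j + p.1 : ℕ) : ℤ) : ℤ) : ℝ) * lb + ((p.2 : ℤ) : ℝ) * ld +
        ((0 : ℤ) : ℝ) * (Real.log (a * √Δ) - Real.log (b - 1)) -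
        lb / Q * ((- -((j + p.1 : ℕ) : ℤ) * Q + p.2 * P : ℤ) : ℝ)) = - (p.2 * (Λ / n)) := by
      have hQn : (Q : ℝ) = n * ν 2 := by rw [hQdef]; push_cast; ring
      push_cast
      field_simp
      rw [hQn] at hPQ ⊢
      linear_combination (-(p.2 : ℝ) * n ) * hPQ
    rw [heq, abs_neg, abs_mul, abs_div, abs_of_nonneg (Nat.cast_nonneg p.2), abs_of_pos hn0]
    refine le_trans (mul_le_mul_of_nonneg_left ?_ (Real.exp_pos _).le) hP.exp_Λ
    exact mul_le_mul hp2 (div_le_self (abs_nonneg _) hn1) (by positivity) hK0.le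
  · intro x hx y hy
    obtain ⟨j, hj, rfl⟩ := mem_image.1 hx
    obtain ⟨p, hp, rfl⟩ := mem_image.1 hy
    simp only [mem_product, mem_range] at hp hj
    rw [hsum, hY, weight_eq]
    simp only [Matrix.cons_val_zero, Matrix.cons_val_one, Matrix.cons_val]
    have h1 : (p.1 : ℝ) ≤ I := by exact_mod_cast Nat.lt_succ_iff.1 hp.1
    have h2 : (p.2 : ℝ) ≤ J := by exact_mod_cast Nat.lt_succ_iff.1 hp.2
    have h3 : (j : ℝ) ≤ S := by exact_mod_cast hj.le
    push_cast
    rw [abs_neg, abs_of_nonneg (by positivity), abs_of_nonneg (by positivity), abs_zero, zero_mul]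
    have h4 := hP.S_log_b
    have t1 : (p.1 : ℝ) * lb ≤ I * lb := mul_le_mul_of_nonneg_right h1 (by linarith)
    have t2 : (p.2 : ℝ) * ld ≤ J * ld := mul_le_mul_of_nonneg_right h2 (by linarith)
    have t3 : (j : ℝ) * lb ≤ S * lb := mul_le_mul_of_nonneg_right h3 (by linarith)
    linarith
  · intro x hx y hy
    obtain ⟨j, hj, rfl⟩ := mem_image.1 hx
    obtain ⟨p, hp, rfl⟩ := mem_image.1 hy
    simp only [mem_product, mem_range] at hp hj
    have h1 : (p.1 : ℝ) ≤ I := by exact_mod_cast Nat.lt_succ_iff.1 hp.1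
    have h2 : (p.2 : ℝ) ≤ J := by exact_mod_cast Nat.lt_succ_iff.1 hp.2
    have h3 : (j : ℝ) ≤ S := by exact_mod_cast hj.le
    rw [map_add, hX₁, hX₂]
    push_cast
    refine exponent_bound hK6 hKD hP.L_eq hP.D_eq hlb hld hΛ1 (by linarith) h_ν_log_b
      (by rw [hQdef]; push_cast; ring) ?_ hQ0.le hP0.le (by positivity) (by positivity)
      (by positivity) (h3.trans ?_) (h1.trans hIK) (h2.trans hJK)
    · rw [hQdef] at hPQ; push_cast at hPQ; linear_combination hPQ
    · have := mul_le_mul_of_nonneg_left hlb hS0.le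
      linarith [hP.S_log_b]

end QuadraticUnit

end InterpolationDet

namespace InterpolationDet

open Finset

namespace QuadraticUnit

open LogSystem

variable {O : Type*} [CommRing O] {δ Δ : ℝ} (Z : QuadraticUnit O δ Δ) {a b : ℤ}

theorem card_box {τ g₀ g₁ g₂ : ℝ} (hτ : 0 ≤ τ) (h₀ : 0 < g₀) (h₁ : 0 < g₁) (h₂ : 0 < g₂) :
    τ ^ 3 ≤ ((⌊τ / g₀⌋₊ : ℝ) + 1) * ((⌊τ / g₁⌋₊ : ℝ) + 1) * ((⌊τ / g₂⌋₊ : ℝ) + 1) *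
      (g₀ * g₁ * g₂) := by
  have key : ∀ g : ℝ, 0 < g → τ ≤ ((⌊τ / g⌋₊ : ℝ) + 1) * g := fun g hg => by
    rw [← div_le_iff₀ hg]
    exact (Nat.lt_floor_add_one _).le
  calc τ ^ 3 = τ * τ * τ := by ring
    _ ≤ (((⌊τ / g₀⌋₊ : ℝ) + 1) * g₀) * (((⌊τ / g₁⌋₊ : ℝ) + 1) * g₁) *
        (((⌊τ / g₂⌋₊ : ℝ) + 1) * g₂) := by
      refine mul_le_mul (mul_le_mul (key _ h₀) (key _ h₁) hτ (by positivity)) (key _ h₂) hτ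
        (by positivity)
    _ = _ := by ring

theorem x₁_bound {D lb h2 k u v : ℝ} (hD : 10 ^ 6 ≤ D) (hlb : 69 / 100 ≤ lb)
    (hh : lb + 69 / 100 ≤ h2) (hk0 : 0 ≤ k) (hk : k * lb ≤ D * lb + 1 + h2) :
    |u + k * v| ≤ (|u| * lb + |v| * h2) * (2.1 * D) := by
  have hkD : k ≤ h2 * (2.1 * D) := by
    have e1 : h2 * (2.1 * D) * lb ≥ 2.898 * D * lb := by
      have : 1.38 * (2.1 * D * lb) ≤ h2 * (2.1 * D * lb) :=
        mul_le_mul_of_nonneg_right (by linarith) (by positivity)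
      linarith
    have e2 : 10 ^ 6 * (69 / 100) * h2 ≤ D * lb * h2 :=
      mul_le_mul_of_nonneg_right (mul_le_mul hD hlb (by norm_num) (by linarith)) (by linarith)
    have e3 : D * lb * 1.38 ≤ D * lb * h2 := mul_le_mul_of_nonneg_left (by linarith) (by positivity)
    refine le_of_mul_le_mul_right ?_ (by linarith : 0 < lb)
    linarith
  calc |u + k * v| ≤ |u| + k * |v| := by
        refine (abs_add_le _ _).trans ?_
        rw [abs_mul, abs_of_nonneg hk0]
    _ ≤ |u| * (lb * (2.1 * D)) + (h2 * (2.1 * D)) * |v| := by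
        refine add_le_add (le_mul_of_one_le_right (abs_nonneg _) ?_)
          (mul_le_mul_of_nonneg_right hkD (abs_nonneg _))
        have : 69 / 100 * (2.1 * D) ≤ lb * (2.1 * D) :=
          mul_le_mul_of_nonneg_right hlb (by linarith)
        linarith
    _ = _ := by ring

theorem x₂_bound {D lb ld h2 n u v : ℝ} (hD : 10 ^ 6 ≤ D)
    (hld : 48 / 100 ≤ ld) (hh : lb + 69 / 100 ≤ h2) (hn0 : 0 ≤ n) (hn : n * ld ≤ D * lb) :
    |u + n * v| ≤ (|u| * ld + |v| * h2) * (2.1 * D) := by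
  have hnD : n ≤ h2 * (2.1 * D) := by
    have e1 : n * (48 / 100) ≤ n * ld := mul_le_mul_of_nonneg_left hld hn0
    have e2 : D * lb ≤ D * h2 := mul_le_mul_of_nonneg_left (by linarith) (by linarith)
    have e3 : 0 ≤ D * h2 := by nlinarith
    linarith
  calc |u + n * v| ≤ |u| + n * |v| := by
        refine (abs_add_le _ _).trans ?_
        rw [abs_mul, abs_of_nonneg hn0]
    _ ≤ |u| * (ld * (2.1 * D)) + (h2 * (2.1 * D)) * |v| := by
        refine add_le_add (le_mul_of_one_le_right (abs_nonneg _) ?_)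
          (mul_le_mul_of_nonneg_right hnD (abs_nonneg _))
        have : 48 / 100 * (2.1 * D) ≤ ld * (2.1 * D) :=
          mul_le_mul_of_nonneg_right hld (by linarith)
        linarith
    _ = _ := by ring

theorem parameters_false (Z : QuadraticUnit O δ Δ) {k n K S : ℕ} {D L Λ : ℝ}
    (hP : Parameters δ Δ a b k n K S D L Λ)
    (hK : 192 * 10 ^ 6 * (S * (Real.log b * Real.log δ * (2 * Real.log b + Real.log Δ))) ≤ K) :
    False := by
  have h := hP.toData
  have hA := hP.toAdmissible
  have hlb := h.log_b
  have hld := h.hδ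
  have hlΔ := h.log_Δ
  have hK6 := hA.le_K
  have hK0 : (0 : ℝ) < K := by linarith
  have hKN := hP.K_le_N
  have hD6 : 10 ^ 6 ≤ D := hK6.trans hP.K_le_D
  have hDeq := hP.D_eq
  have hKΛ := hP.K_mul_Λ
  have hΛ1 : |Λ| ≤ 1 := (le_mul_of_one_le_left (abs_nonneg _) (by linarith)).trans hKΛ
  set Y := Z.logSystem h with hY
  set lb := Real.log b with hlbdef
  set ld := Real.log δ with hlddef
  set h2 := lb + Real.log Δ / 2 with hh2
  let τ : ℝ := K / 400
  have hτ0 : 0 ≤ τ := by positivity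
  let G : Fin 3 → ℝ := ![lb, ld, h2]
  have hG : ∀ i, 0 < G i := fun i => by
    fin_cases i
    · change 0 < lb; linarith
    · change 0 < ld; linarith
    · change 0 < h2; linarith
  let V : Finset (Fin 3 → ℤ) := (Fintype.piFinset fun i => range (⌊τ / G i⌋₊ + 1)).image
    fun p i => (p i : ℤ)
  have hV : ∀ ν ∈ V, ∀ i, 0 ≤ ν i ∧ (ν i : ℝ) * G i ≤ τ := by
    intro ν hν i
    obtain ⟨p, hp, rfl⟩ := mem_image.1 hν
    refine ⟨by positivity, ?_⟩
    rw [← le_div_iff₀ (hG i)]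
    have := Nat.lt_succ_iff.1 (mem_range.1 (Fintype.mem_piFinset.1 hp i))
    exact (Nat.le_floor_iff (div_nonneg hτ0 (hG i).le)).1 this |>.trans' (by simp)
  have hVsub : ∀ ν ∈ V, ∀ μ ∈ V, ∀ i, |((μ - ν) i : ℝ)| * G i ≤ τ := by
    intro ν hν μ hμ i
    obtain ⟨h1, h2⟩ := hV ν hν i
    obtain ⟨h3, h4⟩ := hV μ hμ i
    have h1' : (0 : ℝ) ≤ ν i * G i := mul_nonneg (by exact_mod_cast h1) (hG i).le
    have h3' : (0 : ℝ) ≤ μ i * G i := mul_nonneg (by exact_mod_cast h3) (hG i).le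
    rw [show |((μ - ν) i : ℝ)| * G i = |((μ - ν) i : ℝ) * G i| by rw [abs_mul, abs_of_pos (hG i)],
      abs_le]
    simp only [Pi.sub_apply, Int.cast_sub]
    constructor <;> linarith
  have hV0 : (0 : Fin 3 → ℤ) ∈ V := mem_image.2 ⟨0, by simp, by ext; simp⟩
  have hVcard : 6 * (K * K * S) ≤ V.card := by
    rw [card_image_of_injective _ (fun p q hpq => by
      ext i; exact_mod_cast congrFun hpq i), Fintype.card_piFinset]
    simp only [card_range, Fin.prod_univ_three]
    have h1 := card_box hτ0 (hG 0) (hG 1) (hG 2)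
    have h2' : (6 * (K * K * S : ℝ)) * (G 0 * G 1 * G 2) ≤ τ ^ 3 := by
      have e1 : G 0 * G 1 * G 2 = lb * ld * (2 * lb + Real.log Δ) / 2 := by
        change lb * ld * (lb + Real.log Δ / 2) = _
        ring
      have e2 : K * K * (192 * 10 ^ 6 * (S * (lb * ld * (2 * lb + Real.log Δ)))) ≤
          (K : ℝ) * K * K :=
        mul_le_mul_of_nonneg_left hK (by positivity)
      rw [e1]
      change _ ≤ ((K : ℝ) / 400) ^ 3
      linarith
    have h3 := le_of_mul_le_mul_right (h2'.trans h1) (mul_pos (mul_pos (hG 0) (hG 1)) (hG 2))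
    exact_mod_cast h3
  let x₁ : (Fin 3 → ℤ) →+ ℤ :=
    { toFun := fun x => x 0 + k * x 2
      map_zero' := by simp
      map_add' := fun x y => by simp only [Pi.add_apply]; ring }
  let x₂ : (Fin 3 → ℤ) →+ ℤ :=
    { toFun := fun x => x 1 + n * x 2
      map_zero' := by simp
      map_add' := fun x y => by simp only [Pi.add_apply]; ring }
  have hVn : ∀ ν ∈ V, 0 ≤ x₁ ν ∧ 0 ≤ x₂ ν := fun ν hν => by
    have h0 := (hV ν hν 0).1
    have h1 := (hV ν hν 1).1
    have h2 := (hV ν hν 2).1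
    exact ⟨add_nonneg h0 (by positivity), add_nonneg h1 (by positivity)⟩
  have hVx : ∀ ν ∈ V, ∀ μ ∈ V, ν ≠ μ → x₁ (μ - ν) ≠ 0 ∨ x₂ (μ - ν) ≠ 0 := by
    intro ν hν μ hμ hne
    by_contra! hx
    obtain ⟨e1, e2⟩ : (μ - ν) 0 + k * (μ - ν) 2 = 0 ∧ (μ - ν) 1 + n * (μ - ν) 2 = 0 := hx
    have h2 : (μ - ν) 2 = 0 := by
      by_contra h2
      have h2' : (1 : ℝ) ≤ |((μ - ν) 2 : ℝ)| := by
        exact_mod_cast Int.one_le_abs h2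
      have e3 : |((μ - ν) 1 : ℝ)| = n * |((μ - ν) 2 : ℝ)| := by
        have : ((μ - ν) 1 : ℝ) = -(n * ((μ - ν) 2 : ℝ)) := by
          have : ((μ - ν) 1 : ℝ) + n * ((μ - ν) 2 : ℝ) = 0 := by exact_mod_cast e2
          linarith
        rw [this, abs_neg, abs_mul, Nat.abs_cast]
      have e4 : |((μ - ν) 1 : ℝ)| * ld ≤ K / 400 := hVsub ν hν μ hμ 1
      have e5 : (n : ℝ) * ld * 1 ≤ n * ld * |((μ - ν) 2 : ℝ)| :=
        mul_le_mul_of_nonneg_left h2' (by linarith)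
      rw [e3] at e4
      linarith
    rw [h2, mul_zero, add_zero] at e1 e2
    refine hne (funext fun i => ?_)
    have : (μ - ν) i = 0 := by
      fin_cases i
      · exact e1
      · exact e2
      · exact h2
    exact (sub_eq_zero.1 this).symm
  have hVℓ : ∀ ν ∈ V, ∀ μ ∈ V, ν ≠ μ → Y.ℓ (μ - ν) ≠ 0 := by
    have key : ∀ ν ∈ V, ∀ μ ∈ V, 0 < (μ - ν) 2 → Y.ℓ (μ - ν) ≠ 0 := fun ν hν μ hμ h0 hz =>
      Z.dependent_false hP hz h0 (hVsub ν hν μ hμ 2)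
    intro ν hν μ hμ hne hz
    rcases lt_trichotomy ((μ - ν) 2) 0 with h0 | h0 | h0
    · refine key μ hμ ν hν (by simp only [Pi.sub_apply] at h0 ⊢; omega) ?_
      rw [← neg_sub, map_neg, hz, neg_zero]
    · have h1 := Z.eq_zero_of_ℓ_eq_zero _ hz
      rw [hY, ℓ_apply, h0, h1, Int.cast_zero, zero_mul, zero_mul, add_zero, add_zero] at hz
      have h2 : (μ - ν) 0 = 0 := by
        rcases mul_eq_zero.1 hz with h | h
        · exact_mod_cast neg_eq_zero.1 h
        · linarith
      refine hne (funext fun i => ?_)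
      have : (μ - ν) i = 0 := by
        fin_cases i
        · exact h2
        · exact h1
        · exact h0
      exact (sub_eq_zero.1 this).symm
    · exact key ν hν μ hμ h0 hz
  have hw : ∀ ν, Y.weight ν = |(ν 0 : ℝ)| * lb + |(ν 1 : ℝ)| * ld + |(ν 2 : ℝ)| * h2 :=
    Z.weight_eq h
  have hVw : ∀ ν ∈ V, Y.weight ν ≤ 3 * (K / 400) := fun ν hν => by
    rw [hw]
    have key : ∀ i, |(ν i : ℝ)| * G i ≤ K / 400 := fun i => by
      obtain ⟨e1, e2⟩ := hV ν hν i
      rwa [abs_of_nonneg (by exact_mod_cast e1)]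
    have t0 : |(ν 0 : ℝ)| * lb ≤ _ := key 0
    have t1 : |(ν 1 : ℝ)| * ld ≤ _ := key 1
    have t2 : |(ν 2 : ℝ)| * h2 ≤ _ := key 2
    linarith
  have hx₁ : ∀ ν, |(x₁ ν : ℝ)| ≤ Y.weight ν * (2.1 * Real.exp (L - 1)) := fun ν => by
    have hk : (k : ℝ) * lb ≤ D * lb + 1 + h2 := by
      have e1 := hP.Λ_eq
      have e2 := h.log_a_sqrt
      have e3 := h.log_pred
      linarith [le_abs_self Λ]
    have e := x₁_bound (u := ν 0) (v := ν 2) hD6 hlb (by linarith) (Nat.cast_nonneg k) hk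
    have e' : |(x₁ ν : ℝ)| = |(ν 0 : ℝ) + k * ν 2| := by
      change |((ν 0 + k * ν 2 : ℤ) : ℝ)| = _
      push_cast; rfl
    rw [e', hw, hP.L_eq]
    refine e.trans (mul_le_mul_of_nonneg_right ?_ (by linarith))
    have : 0 ≤ |(ν 1 : ℝ)| * ld := mul_nonneg (abs_nonneg _) (by linarith)
    linarith
  have hx₂ : ∀ ν, |(x₂ ν : ℝ)| ≤ Y.weight ν * (2.1 * Real.exp (L - 1)) := fun ν => by
    have e := x₂_bound (u := ν 1) (v := ν 2) hD6 hld (by linarith : lb + 69 / 100 ≤ h2)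
      (Nat.cast_nonneg n) (by linarith)
    have e' : |(x₂ ν : ℝ)| = |(ν 1 : ℝ) + n * ν 2| := by
      change |((ν 1 + n * ν 2 : ℤ) : ℝ)| = _
      push_cast; rfl
    rw [e', hw, hP.L_eq]
    refine e.trans (mul_le_mul_of_nonneg_right ?_ (by linarith))
    have : 0 ≤ |(ν 0 : ℝ)| * lb := mul_nonneg (abs_nonneg _) (by linarith)
    linarith
  have hℓ : ∀ ν, Y.ℓ ν = -lb * x₁ ν + ld * x₂ ν + ν 2 * Λ := fun ν => by
    rw [hY, ℓ_apply, hP.Λ_eq]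
    change _ = -lb * ((ν 0 + k * ν 2 : ℤ) : ℝ) + ld * ((ν 1 + n * ν 2 : ℤ) : ℝ) + _
    push_cast
    ring
  have hlb' : |-lb| = lb := by rw [abs_neg, abs_of_nonneg (by linarith)]
  have hld' : |ld| = ld := abs_of_nonneg (by linarith)
  rcases le_total lb ld with hle | hle
  · exact three_log_contradiction Y hA (c₁ := -lb) (c₂ := ld) x₁ x₂ V hV0 hVn hVx hVℓ hVw hVcard
      (by rwa [hlb', hld'])
      (by linarith) hℓ hP.exp_Λ hx₁ hx₂
  · exact three_log_contradiction Y hA (c₁ := ld) (c₂ := -lb) x₂ x₁ V hV0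
      (fun ν hν => (hVn ν hν).symm)
      (fun ν hν μ hμ hne => (hVx ν hν μ hμ hne).symm) hVℓ hVw hVcard (by rw [hlb', hld']; exact hle)
      (by linarith) (fun ν => by rw [hℓ]; ring) hP.exp_Λ hx₂ hx₁

/-- A lower bound for the linear form in three logarithms. -/
theorem one_lt_exp_mul_abs (Z : QuadraticUnit O δ Δ) (h : Data δ Δ a b) {k n : ℕ} {D L Λ : ℝ}
    (hD : D = 1 + n * Real.log δ / Real.log b) (hL : L = 1 + Real.log D) (hL50 : 50 ≤ L)
    (hN : 10 ^ 20 * L ^ 2 * (Real.log b * Real.log δ) ^ 2 * (2 * Real.log b + Real.log Δ) ≤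
      n * Real.log δ)
    (hΛ : Λ = Real.log (a * √Δ) - Real.log (b - 1) + k * Real.log b - n * Real.log δ) :
    1 < Real.exp (131 * 10 ^ 9 * L ^ 2 *
        (Real.log b * Real.log δ * (2 * Real.log b + Real.log Δ))) *
      |Λ| := by
  by_contra! hle
  have hlb := h.log_b
  have hld := h.hδ
  have hlΔ := h.log_Δ
  set lb := Real.log b with hlbdef
  set ld := Real.log δ with hlddef
  set H := 2 * lb + Real.log Δ with hH
  have hH2 : 2.76 ≤ H := by linarith
  have hHlb : 2 * lb ≤ H := by linarith
  set T := lb * ld with hT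
  have hT0 : 0.33 ≤ T := by
    have : 69 / 100 * (48 / 100) ≤ T := mul_le_mul hlb hld (by norm_num) (by linarith)
    linarith
  have hTH : 0.91 ≤ T * H := by
    have : 0.33 * 2.76 ≤ T * H := mul_le_mul hT0 hH2 (by norm_num) (by linarith)
    linarith
  have hN0 : 0 ≤ n * ld := mul_nonneg (Nat.cast_nonneg n) (by linarith)
  have hDeq : D * lb = lb + n * ld := by rw [hD]; field_simp
  have hD0 : 0 < D := by
    rw [hD]
    have : 0 ≤ n * ld / lb := div_nonneg hN0 (by linarith)
    linarith
  have hLD : Real.exp (L - 1) = D := by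
    rw [hL, add_sub_cancel_left, Real.exp_log hD0]
  obtain ⟨S, hS⟩ : ∃ S : ℕ, S = ⌈18 * L⌉₊ := ⟨_, rfl⟩
  have hS1 : 18 * L ≤ S := hS ▸ Nat.le_ceil _
  have hS2 : S ≤ 18.02 * L := by
    have := (Nat.ceil_lt_add_one (by linarith : 0 ≤ 18 * L)).le
    rw [← hS] at this
    linarith
  have hS0 : (0 : ℝ) < S := by linarith
  obtain ⟨K, hK⟩ : ∃ K : ℕ, K = ⌈2 * 10 ^ 8 * (S * (T * H))⌉₊ := ⟨_, rfl⟩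
  have hSTH : (S : ℝ) * 0.91 ≤ S * (T * H) := mul_le_mul_of_nonneg_left hTH hS0.le
  have hK1 : 2 * 10 ^ 8 * (S * (T * H)) ≤ K := hK ▸ Nat.le_ceil _
  have hK2 : K ≤ 200010000 * (S * (T * H)) := by
    have := (Nat.ceil_lt_add_one (by linarith : 0 ≤ 2 * 10 ^ 8 * (S * (T * H)))).le
    rw [← hK] at this
    linarith
  have hK3 : K ≤ 3604500000 * (L * (T * H)) := by
    have : S * (T * H) ≤ 18.02 * L * (T * H) := mul_le_mul_of_nonneg_right hS2 (by linarith)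
    have : 0 ≤ L * (T * H) := mul_nonneg (by linarith) (by linarith)
    linarith
  have hK0 : (0 : ℝ) < K := by linarith
  have hLTH : 45 ≤ L * (T * H) := by
    have : 50 * 0.91 ≤ L * (T * H) := mul_le_mul hL50 hTH (by norm_num) (by linarith)
    linarith
  have hbig : 10 ^ 20 * (L * (T * (L * (T * H)))) ≤ n * ld := by
    refine le_trans (le_of_eq ?_) hN
    ring
  have hKN : (K : ℝ) ≤ n * ld := by
    have e1 : 0.33 * (L * (T * H)) ≤ T * (L * (T * H)) :=
      mul_le_mul_of_nonneg_right hT0 (by linarith)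
    have e2 : 50 * (T * (L * (T * H))) ≤ L * (T * (L * (T * H))) :=
      mul_le_mul_of_nonneg_right hL50 (by linarith)
    linarith
  have hKD : (K : ℝ) ≤ D := by
    refine le_of_mul_le_mul_right ?_ (by linarith : 0 < lb)
    rw [hDeq]
    have e0 : 0 ≤ lb * (L * (T * H)) := mul_nonneg (by linarith) (by linarith)
    have e1 : 48 / 100 * (lb * (L * (T * H))) ≤ ld * (lb * (L * (T * H))) :=
      mul_le_mul_of_nonneg_right hld e0
    have e2 : ld * (lb * (L * (T * H))) = T * (L * (T * H)) := by rw [hT]; ring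
    have e3 : 50 * (T * (L * (T * H))) ≤ L * (T * (L * (T * H))) :=
      mul_le_mul_of_nonneg_right hL50 (by linarith)
    have e4 : K * lb ≤ 3604500000 * (L * (T * H)) * lb :=
      mul_le_mul_of_nonneg_right hK3 (by linarith)
    linarith
  have hST : (S : ℝ) * T * 2.76 ≤ S * T * H := mul_le_mul_of_nonneg_left hH2 (by positivity)
  have hSlb : (S : ℝ) * lb * 1.32 ≤ S * lb * (ld * H) := by
    refine mul_le_mul_of_nonneg_left ?_ (mul_nonneg hS0.le (by linarith))
    have : 48 / 100 * 2.76 ≤ ld * H := mul_le_mul hld hH2 (by norm_num) (by linarith)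
    linarith
  have hSlbe : (S : ℝ) * lb * (ld * H) = S * (T * H) := by rw [hT]; ring
  have hSlb0 : 0 ≤ (S : ℝ) * lb := mul_nonneg hS0.le (by linarith)
  refine Z.parameters_false (K := K) (S := S) (k := k) (n := n) (D := D) (L := L) (Λ := Λ)
    ⟨h, ⟨hL50, hS1, by linarith, ?_, by linarith⟩, hD0, hLD, hDeq, hKD, hKN, ?_, ?_, ?_, hΛ⟩ ?_
  · exact hKD.trans (hLD ▸ Real.exp_le_exp.2 (by linarith))
  · linarith
  · change 200000 * (S * T) ≤ K
    linarith
  · rw [← mul_assoc]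
    refine le_trans (mul_le_mul_of_nonneg_right ?_ (abs_nonneg _)) hle
    have e1 : (K : ℝ) ≤ Real.exp L := hKD.trans (hLD ▸ Real.exp_le_exp.2 (by linarith))
    calc Real.exp (2 * (K * S)) * K ≤ Real.exp (2 * (K * S)) * Real.exp L :=
          mul_le_mul_of_nonneg_left e1 (Real.exp_pos _).le
      _ = Real.exp (2 * (K * S) + L) := (Real.exp_add _ _).symm
      _ ≤ _ := Real.exp_le_exp.2 ?_
    have e2 : (K : ℝ) * S ≤ 3604500000 * (L * (T * H)) * (18.02 * L) :=
      mul_le_mul hK3 hS2 hS0.le (by linarith)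
    have e3 : L * 45 ≤ L * (L * (T * H)) := mul_le_mul_of_nonneg_left hLTH (by linarith)
    have e4 : L ^ 2 * (T * H) = L * (L * (T * H)) := by ring
    rw [mul_assoc, e4]
    linarith
  · change 192 * 10 ^ 6 * (S * (T * H)) ≤ K
    linarith

end QuadraticUnit

end InterpolationDet

namespace InterpolationDet

open Finset

theorem exp_three_le : Real.exp 3 ≤ 21 := by
  have h : Real.exp 3 = Real.exp 1 ^ 3 := by rw [← Real.exp_nat_mul]; norm_num
  rw [h]
  calc Real.exp 1 ^ 3 ≤ 2.7182818286 ^ 3 :=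
        pow_le_pow_left₀ (Real.exp_pos _).le Real.exp_one_lt_d9.le 3
    _ ≤ 21 := by norm_num

/-- The interpolation inequality for the points `ψ ^ i * γ ^ j`, where `ψ = α / α'` and
`γ = β / β'` satisfy an almost linear relation `log γ = g * log ψ - Λ`. -/
theorem two_log_box {O : Type*} [CommRing O] (φ₁ φ₂ : O →+* ℝ)
    (hφ : ∀ x ≠ 0, 1 ≤ |φ₁ x| * |φ₂ x|) {K S R₁ R₂ g : ℕ} (hS : 1 ≤ S) (hK : 1 ≤ K)
    (hg : R₁ ≤ g) (hR : K * S ≤ R₁ * R₂) {α α' β β' : O} (hα : 0 < φ₁ α) (hα' : 0 < φ₁ α')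
    (hβ : 0 < φ₁ β) (hβ' : 0 < φ₁ β') {c Λ : ℝ} (hc : c ≠ 0)
    (hψ : Real.log (φ₁ α) - Real.log (φ₁ α') = c)
    (hγ : Real.log (φ₁ β) - Real.log (φ₁ β') = g * c - Λ)
    (hΛ : Real.exp (3 * (K * S)) * (R₂ * |Λ|) ≤ 1) {p₁ p₂ q₁ q₂ : ℝ} (hp₁ : 0 ≤ p₁)
    (hp₂ : 0 ≤ p₂) (hq₁ : 0 ≤ q₁) (hq₂ : 0 ≤ q₂) (h₁α' : Real.log (φ₁ α') ≤ p₁)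
    (h₁β' : Real.log (φ₁ β') ≤ q₁) (h₂α : |φ₂ α| ≤ Real.exp p₂) (h₂α' : |φ₂ α'| ≤ Real.exp p₂)
    (h₂β : |φ₂ β| ≤ Real.exp q₂) (h₂β' : |φ₂ β'| ≤ Real.exp q₂) {t : ℝ} (ht : 1 ≤ t)
    (htX : 21 * ((S + R₁ : ℝ) + g * R₂) + K ≤ K * Real.exp (t - 1)) :
    ((K * S - 1) / 2 - 1) * 3 ≤ 2 * Real.log (K * S) + 2 * (K * t) +
      (S - 1) * ((S + R₁) * (p₁ + p₂ + 21 * |c|) + R₂ * (q₁ + q₂ + 21 * (g * |c|)) + 1) := by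
  classical
  have hρ := exp_three_le
  have hρ1 : 1 ≤ Real.exp 3 := Real.one_le_exp (by norm_num)
  let i₁ : Fin S × (Fin R₁ × Fin R₂) → ℕ := fun p => p.1 + p.2.1
  let i₂ : Fin S × (Fin R₁ × Fin R₂) → ℕ := fun p => p.2.2
  have hi₁ : ∀ p, (i₁ p : ℝ) ≤ S + R₁ := fun p => by
    have : i₁ p ≤ S + R₁ := add_le_add p.1.2.le p.2.1.2.le
    exact_mod_cast this
  have hi₂ : ∀ p, (i₂ p : ℝ) ≤ R₂ := fun p => by exact_mod_cast p.2.2.2.le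
  have hXle : ∀ p, ((i₁ p + g * i₂ p : ℕ) : ℝ) ≤ (S + R₁) + g * R₂ := fun p => by
    push_cast
    exact add_le_add (hi₁ p) (mul_le_mul_of_nonneg_left (hi₂ p) (Nat.cast_nonneg g))
  have hpos : ∀ {x y : O}, 0 < φ₁ x → 0 < φ₁ y → ∀ p, 0 < φ₁ (x ^ i₁ p * y ^ i₂ p) :=
    fun hx hy p => by
      rw [map_mul, map_pow, map_pow]
      exact mul_pos (pow_pos hx _) (pow_pos hy _)
  have hlog : ∀ {x y : O}, 0 < φ₁ x → 0 < φ₁ y → ∀ p, Real.log (φ₁ (x ^ i₁ p * y ^ i₂ p)) =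
      i₁ p * Real.log (φ₁ x) + i₂ p * Real.log (φ₁ y) := fun hx hy p => by
    rw [map_mul, map_pow, map_pow, Real.log_mul (pow_pos hx _).ne' (pow_pos hy _).ne',
      Real.log_pow, Real.log_pow]
  have hlogs : ∀ p, Real.log (φ₁ (α ^ i₁ p * β ^ i₂ p)) - Real.log (φ₁ (α' ^ i₁ p * β' ^ i₂ p)) =
      i₁ p * c + i₂ p * (g * c - Λ) := fun p => by
    rw [hlog hα hβ, hlog hα' hβ']
    linear_combination (i₁ p : ℝ) * hψ + (i₂ p : ℝ) * hγ
  have habs : ∀ {x y : O}, |φ₂ x| ≤ Real.exp p₂ → |φ₂ y| ≤ Real.exp q₂ → ∀ p,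
      |φ₂ (x ^ i₁ p * y ^ i₂ p)| ≤ Real.exp ((S + R₁) * p₂ + R₂ * q₂) := fun {x y} hx hy p => by
    rw [map_mul, map_pow, map_pow, abs_mul, abs_pow, abs_pow]
    calc |φ₂ x| ^ i₁ p * |φ₂ y| ^ i₂ p ≤ Real.exp p₂ ^ i₁ p * Real.exp q₂ ^ i₂ p :=
          mul_le_mul (pow_le_pow_left₀ (abs_nonneg _) hx _) (pow_le_pow_left₀ (abs_nonneg _) hy _)
            (by positivity) (by positivity)
      _ = Real.exp (i₁ p * p₂ + i₂ p * q₂) := by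
          rw [← Real.exp_nat_mul, ← Real.exp_nat_mul, Real.exp_add]
      _ ≤ _ := Real.exp_le_exp.2 (add_le_add (mul_le_mul_of_nonneg_right (hi₁ p) hp₂)
          (mul_le_mul_of_nonneg_right (hi₂ p) hq₂))
  have main := two_log_inequality φ₁ φ₂ hφ hS hK (fun p => i₁ p + g * i₂ p)
    (fun p => α ^ i₁ p * β ^ i₂ p) (fun p => α' ^ i₁ p * β' ^ i₂ p) (hpos hα hβ) (hpos hα' hβ')
    (c := c) (fun p => -(i₂ p * Λ)) (fun p => by rw [hlogs]; push_cast; ring) hρ1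
    (fun p => by
      rw [← Real.exp_nat_mul, abs_neg, abs_mul, Nat.abs_cast]
      refine le_trans ?_ hΛ
      rw [mul_comm (3 : ℝ)]
      push_cast
      exact mul_le_mul_of_nonneg_left (mul_le_mul_of_nonneg_right (hi₂ p) (abs_nonneg _))
        (Real.exp_pos _).le)
    (fun j => (j : ℕ)) (fun j => Real.exp ((j : ℕ) * c)) (fun i => (i.1 : ℕ) + g * (i.2 : ℕ))
    (fun i => Real.exp ((i.1 : ℕ) * c + (i.2 : ℕ) * (g * c - Λ)))
    (fun p => by simp only [i₁, i₂]; push_cast; ring)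
    (fun p => by
      rw [← Real.exp_log (hpos hα hβ p), ← Real.exp_log (hpos hα' hβ' p), ← Real.exp_sub, hlogs,
        ← Real.exp_add]
      simp only [i₁, i₂]; push_cast; ring_nf)
    (fun i j hij => by
      have := mul_right_cancel₀ hc (Real.exp_injective hij)
      exact Fin.ext (by exact_mod_cast this))
    (by
      rw [card_image_of_injective]
      · simpa using hR
      · rintro ⟨i, j⟩ ⟨i', j'⟩ hij
        have h : (i : ℕ) + g * j = i' + g * j' := by
          have hij' : ((i : ℕ) : ℝ) + g * (j : ℕ) = (i' : ℕ) + g * (j' : ℕ) := hij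
          exact_mod_cast hij'
        have hig : (i : ℕ) < g := i.2.trans_le hg
        have hig' : (i' : ℕ) < g := i'.2.trans_le hg
        have h1 : (i : ℕ) = i' := by
          have := congrArg (· % g) h
          simpa [Nat.add_mul_mod_self_left, Nat.mod_eq_of_lt hig, Nat.mod_eq_of_lt hig'] using this
        have h2 : (j : ℕ) = j' := by
          rw [h1] at h
          exact Nat.eq_of_mul_eq_mul_left (by omega) (Nat.add_left_cancel h)
        exact Prod.ext (Fin.ext h1) (Fin.ext h2))
    (t := t) ht
    (fun p => by
      refine le_trans ?_ htX
      gcongr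
      exact hXle p)
    (h₁ := (S + R₁) * p₁ + R₂ * q₁) (h₂ := (S + R₁) * p₂ + R₂ * q₂)
    (z₀ := ((S + R₁) + g * R₂) * |c|)
    (fun p => by
      rw [hlog hα' hβ']
      exact add_le_add ((mul_le_mul_of_nonneg_left h₁α' (Nat.cast_nonneg _)).trans
        (mul_le_mul_of_nonneg_right (hi₁ p) hp₁))
        ((mul_le_mul_of_nonneg_left h₁β' (Nat.cast_nonneg _)).trans
        (mul_le_mul_of_nonneg_right (hi₂ p) hq₁)))
    (habs h₂α h₂β) (habs h₂α' h₂β')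
    (fun p => by
      rw [abs_mul, Nat.abs_cast, mul_comm]
      exact mul_le_mul_of_nonneg_right (hXle p) (abs_nonneg _))
  rw [Real.log_exp] at main
  refine main.trans (add_le_add_right (mul_le_mul_of_nonneg_left ?_ ?_) _)
  · have : Real.exp 3 * (((S + R₁ : ℝ) + g * R₂) * |c|) ≤ 21 * (((S + R₁ : ℝ) + g * R₂) * |c|) :=
      mul_le_mul_of_nonneg_right hρ (by positivity)
    linarith
  · have : (1 : ℝ) ≤ S := by exact_mod_cast hS
    linarith

end InterpolationDet

namespace InterpolationDet

theorem le_exp_fourteen : 1200000 ≤ Real.exp 14 := by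
  have h : Real.exp 14 = Real.exp 1 ^ 14 := by rw [← Real.exp_nat_mul]; norm_num
  rw [h]
  calc (1200000 : ℝ) ≤ 2.7182818283 ^ 14 := by norm_num
    _ ≤ Real.exp 1 ^ 14 := pow_le_pow_left₀ (by norm_num) Real.exp_one_gt_d9.le 14

theorem log_le_add_div {x : ℝ} (hx : 0 < x) : Real.log x ≤ 1000 + x / 1000 := by
  have h : x = 1000 * (x / 1000) := by ring
  have h1 := Real.log_le_sub_one_of_pos (by norm_num : (0 : ℝ) < 1000)
  have h2 := Real.log_le_sub_one_of_pos (by positivity : 0 < x / 1000)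
  rw [h, Real.log_mul (by norm_num) (by positivity)]
  linarith

/-- `two_log_box` with a choice of parameters. -/
theorem two_log_box_false {O : Type*} [CommRing O] (φ₁ φ₂ : O →+* ℝ)
    (hφ : ∀ x ≠ 0, 1 ≤ |φ₁ x| * |φ₂ x|) {g : ℕ} {α α' β β' : O} (hα : 0 < φ₁ α) (hα' : 0 < φ₁ α')
    (hβ : 0 < φ₁ β) (hβ' : 0 < φ₁ β') {c Λ : ℝ} (hc : c ≠ 0)
    (hψ : Real.log (φ₁ α) - Real.log (φ₁ α') = c)
    (hγ : Real.log (φ₁ β) - Real.log (φ₁ β') = g * c - Λ)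
    {p₁ p₂ q₁ q₂ : ℝ} (hp₁ : 0 ≤ p₁)
    (hp₂ : 0 ≤ p₂) (hq₁ : 0 ≤ q₁) (hq₂ : 0 ≤ q₂) (h₁α' : Real.log (φ₁ α') ≤ p₁)
    (h₁β' : Real.log (φ₁ β') ≤ q₁) (h₂α : |φ₂ α| ≤ Real.exp p₂) (h₂α' : |φ₂ α'| ≤ Real.exp p₂)
    (h₂β : |φ₂ β| ≤ Real.exp q₂) (h₂β' : |φ₂ β'| ≤ Real.exp q₂) {ℓ N : ℝ}
    (hℓ : 48 / 100 ≤ ℓ) (hN : 6 * 10 ^ 7 * (105000 * ℓ) ≤ N) (hg : g * ℓ ≤ N)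
    (hg' : N ≤ (g + 1) * ℓ) (hΛ : |Λ| ≤ Real.exp (-(99 / 100 * N)))
    (hp : p₁ + p₂ + 21 * |c| ≤ 21 / 10 * ℓ)
    (hq : q₁ + q₂ + 21 * (g * |c|) ≤ N / (105000 * ℓ)) : False := by
  set w₁ := 21 / 10 * ℓ with hw₁
  set w₂ := N / (105000 * ℓ) with hw₂
  have hℓ0 : 0 < ℓ := by linarith
  have hw₁1 : 1 ≤ w₁ := by linarith
  have hw₂1 : 6 * 10 ^ 7 ≤ w₂ := (le_div_iff₀ (by positivity)).2 hN
  have hNw : N = 105000 * w₂ * ℓ := by rw [hw₂]; field_simp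
  have hw : w₁ * w₂ = N / 50000 := by rw [hNw, hw₁]; ring
  set W := w₁ * w₂ with hW
  have hW1 : w₂ ≤ W := le_mul_of_one_le_left (by linarith) hw₁1
  have hW2 : 6 * 10 ^ 7 * w₁ ≤ W := by
    rw [hW, mul_comm w₁]; exact mul_le_mul_of_nonneg_right hw₂1 (by linarith)
  have hgw : g ≤ 105000 * w₂ := le_of_mul_le_mul_right (hg.trans hNw.le) hℓ0
  have hgw' : 105000 * w₂ ≤ g + 1 := le_of_mul_le_mul_right (hNw.ge.trans hg') hℓ0
  set K := ⌈373 * W⌉₊ with hKdef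
  set R₁ := ⌈127 * w₂⌉₊ with hR₁def
  set R₂ := ⌈127 * w₁⌉₊ with hR₂def
  have hK1 : 373 * W ≤ K := Nat.le_ceil _
  have hK2 : K < 373 * W + 1 := Nat.ceil_lt_add_one (by linarith)
  have hR₁1 : 127 * w₂ ≤ R₁ := Nat.le_ceil _
  have hR₁2 : R₁ < 127 * w₂ + 1 := Nat.ceil_lt_add_one (by linarith)
  have hR₂1 : 127 * w₁ ≤ R₂ := Nat.le_ceil _
  have hR₂2 : R₂ < 127 * w₁ + 1 := Nat.ceil_lt_add_one (by linarith)
  have hK0 : (1 : ℝ) ≤ K := by linarith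
  have hRg : R₁ ≤ g := by
    have : (R₁ : ℝ) ≤ g := by linarith
    exact_mod_cast this
  have hKR : K * 41 ≤ R₁ * R₂ := by
    have h1 : (127 * w₂) * (127 * w₁) ≤ R₁ * R₂ :=
      mul_le_mul hR₁1 hR₂1 (by linarith) (Nat.cast_nonneg _)
    have h2 : (127 * w₂) * (127 * w₁) = 16129 * W := by rw [hW]; ring
    have : (K * 41 : ℝ) ≤ R₁ * R₂ := by linarith
    exact_mod_cast this
  have hgR : g * R₂ ≤ 105000 * 128 * W := by
    calc (g : ℝ) * R₂ ≤ (105000 * w₂) * (128 * w₁) :=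
          mul_le_mul hgw (by linarith) (Nat.cast_nonneg _) (by linarith)
      _ = _ := by rw [hW]; ring
  have htX : 21 * ((((41 : ℕ) : ℝ) + R₁) + g * R₂) + K ≤ K * Real.exp (15 - 1) := by
    have h1 : (K : ℝ) * 1200000 ≤ K * Real.exp (15 - 1) := by
      refine mul_le_mul_of_nonneg_left ?_ (Nat.cast_nonneg _)
      rw [show (15 : ℝ) - 1 = 14 by norm_num]
      exact le_exp_fourteen
    push_cast
    linarith
  have hΛ' : Real.exp (3 * (K * (41 : ℕ))) * (R₂ * |Λ|) ≤ 1 := by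
    have h1 : (R₂ : ℝ) ≤ Real.exp (N / 100) := by
      have := Real.add_one_le_exp (N / 100)
      linarith
    calc Real.exp (3 * (K * (41 : ℕ))) * (R₂ * |Λ|)
        ≤ Real.exp (3 * (K * (41 : ℕ))) * (Real.exp (N / 100) * Real.exp (-(99 / 100 * N))) :=
          mul_le_mul_of_nonneg_left (mul_le_mul h1 hΛ (abs_nonneg _) (Real.exp_pos _).le)
            (Real.exp_pos _).le
      _ = Real.exp (3 * (K * (41 : ℕ)) + (N / 100 + -(99 / 100 * N))) := by
          rw [Real.exp_add, Real.exp_add]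
      _ ≤ 1 := by
          rw [Real.exp_le_one_iff]
          push_cast
          linarith
  have main := two_log_box φ₁ φ₂ hφ (S := 41) (by norm_num) (by exact_mod_cast hK0) hRg hKR
    hα hα' hβ hβ' hc hψ hγ hΛ' hp₁ hp₂ hq₁ hq₂ h₁α' h₁β' h₂α h₂α' h₂β h₂β' (by norm_num) htX
  have hlog := log_le_add_div (x := K * (41 : ℕ)) (by push_cast; linarith)
  have h1 : (((41 : ℕ) : ℝ) + R₁) * (p₁ + p₂ + 21 * |c|) ≤ (42 + 127 * w₂) * w₁ :=
    mul_le_mul (by push_cast; linarith) hp (by positivity) (by positivity)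
  have h2 : (R₂ : ℝ) * (q₁ + q₂ + 21 * (g * |c|)) ≤ (127 * w₁ + 1) * w₂ :=
    mul_le_mul hR₂2.le hq (by positivity) (by positivity)
  have h3 : (42 + 127 * w₂) * w₁ = 42 * w₁ + 127 * W := by rw [hW]; ring
  have h4 : (127 * w₁ + 1) * w₂ = 127 * W + w₂ := by rw [hW]; ring
  push_cast at main hlog h1
  linarith

end InterpolationDet

namespace InterpolationDet

namespace QuadraticUnit

variable {O : Type*} [CommRing O] {δ Δ : ℝ} (Z : QuadraticUnit O δ Δ) {a b : ℤ}

namespace Data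

theorem log_pow_sub_one (h : Data δ Δ a b) {d : ℕ} (hd : 1 ≤ d) : 0 < δ ^ d - 1 ∧
    d * Real.log δ - 1 ≤ Real.log (δ ^ d - 1) ∧ Real.log (δ ^ d - 1) ≤ d * Real.log δ := by
  have hδ : 0 < δ := by linarith [h.hδ0]
  have h1 : (1595 / 1000 : ℝ) ≤ δ ^ d := by
    calc (1595 / 1000 : ℝ) ≤ 1 + 48 / 100 + (48 / 100) ^ 2 / 2 := by norm_num
      _ ≤ Real.exp (48 / 100) := Real.quadratic_le_exp_of_nonneg (by norm_num)
      _ ≤ Real.exp (Real.log δ) := Real.exp_le_exp.2 h.hδ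
      _ = δ ^ 1 := by rw [Real.exp_log hδ, pow_one]
      _ ≤ δ ^ d := pow_le_pow_right₀ h.hδ0 hd
  have h2 : 0 < δ ^ d - 1 := by linarith
  refine ⟨h2, ?_, ?_⟩
  · rw [Real.le_log_iff_exp_le h2, Real.exp_sub, Real.exp_nat_mul, Real.exp_log hδ,
      div_le_iff₀ (Real.exp_pos 1)]
    have := mul_le_mul_of_nonneg_left Real.exp_one_gt_d9.le h2.le
    linarith
  · rw [← Real.log_pow]
    exact Real.log_le_log h2 (by linarith)

/-- A good rational approximation to `log δ / log b`. -/
theorem exists_approx (h : Data δ Δ a b) : ∃ k₀ n₀ : ℕ, 0 < n₀ ∧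
    n₀ * Real.log δ ≤ 5 * 10 ^ 6 * (Real.log b * Real.log δ) ∧
    |k₀ * Real.log b - n₀ * Real.log δ| ≤ 1 / (5 * 10 ^ 6) := by
  have hb := h.log_b
  have hδ := h.hδ
  have hQ : 0 < ⌊5 * 10 ^ 6 * Real.log b⌋₊ := Nat.floor_pos.2 (by linarith)
  obtain ⟨n₀, hn₀, hle, happ⟩ := Real.exists_nat_abs_mul_sub_round_le (Real.log δ / Real.log b) hQ
  have hr : 0 ≤ round (n₀ * (Real.log δ / Real.log b)) := by
    rw [round_eq]
    exact Int.floor_nonneg.2 (by positivity)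
  obtain ⟨k₀, hk₀⟩ := Int.eq_ofNat_of_zero_le hr
  have hn : (n₀ : ℝ) ≤ 5 * 10 ^ 6 * Real.log b :=
    (Nat.cast_le.2 hle).trans (Nat.floor_le (by linarith))
  refine ⟨k₀, n₀, hn₀, by
    have := mul_le_mul_of_nonneg_right hn (by linarith : 0 ≤ Real.log δ)
    linarith, ?_⟩
  rw [hk₀, Int.cast_natCast, le_div_iff₀ (by positivity)] at happ
  have h1 : k₀ * Real.log b - n₀ * Real.log δ =
      -((n₀ * (Real.log δ / Real.log b) - k₀) * Real.log b) := by field_simp; ring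
  rw [h1, abs_neg, abs_mul, abs_of_pos (by linarith : 0 < Real.log b), le_div_iff₀ (by norm_num)]
  have h2 := mul_le_mul_of_nonneg_left (Nat.lt_floor_add_one (5 * 10 ^ 6 * Real.log b)).le
    (abs_nonneg (n₀ * (Real.log δ / Real.log b) - k₀))
  linarith

end Data

theorem abs_map₂_w_pow_le (h : Data δ Δ a b) (i : ℕ) : |Z.φ₂ Z.w ^ i| ≤ 1 := by
  rw [abs_pow, Z.map₂_w]
  exact pow_le_one₀ (inv_nonneg.2 (by linarith [h.hδ0])) (inv_le_one_of_one_le₀ h.hδ0)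

set_option maxHeartbeats 1000000 in
/-- A lower bound for the linear form expressing that `a√Δ b ^ k / (b-1)` is close to
`δ ^ m (δ ^ d - 1)`. -/
theorem two_log_false (Z : QuadraticUnit O δ Δ) (h : Data δ Δ a b) {k m d : ℕ}
    (hd : 1 ≤ d) {Λ N T H : ℝ}
    (hT : T = Real.log b * Real.log δ) (hH : H = 2 * Real.log b + Real.log Δ)
    (hN : N = (m + d : ℕ) * Real.log δ)
    (hΛ : Λ = Real.log (a * √Δ) - Real.log (b - 1) + k * Real.log b - Real.log (δ ^ d - 1) -
      m * Real.log δ)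
    (hN₁ : 10 ^ 20 * T ^ 2 ≤ N) (hN₂ : 2 * 10 ^ 12 * (T * (d * Real.log δ + 4 * H)) ≤ N)
    (hΛN : |Λ| ≤ Real.exp (3 + H - N)) : False := by
  obtain ⟨k₀, n₀, hn₀, hℓT, hc⟩ := h.exists_approx
  obtain ⟨hy, hv₁, hv₂⟩ := h.log_pow_sub_one hd
  have hlb := h.log_b
  have hld := h.hδ
  have hlΔ := h.log_Δ
  have hb := h.b_real
  have ha := h.a_real
  have hδ : 0 < δ := by linarith [h.hδ0]
  have hq := h.one_le_sqrt
  have hA := h.log_a_sqrt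
  have hP := h.log_pred
  have haq : 0 < a * √Δ := by positivity
  have hb1 : 0 < (b : ℝ) - 1 := by linarith
  have hT0 : 33 / 100 ≤ T := by
    have := mul_le_mul hlb hld (by norm_num) (by linarith)
    rw [hT]; linarith
  have hH0 : 276 / 100 ≤ H := by linarith
  set v := Real.log (δ ^ d - 1) with hv
  set lb := Real.log b with hlbdef
  set ld := Real.log δ with hlddef
  set ℓ := n₀ * ld with hℓ
  set c := k₀ * lb - ℓ with hcdef
  set g := (m + d) / n₀ with hgdef
  set n₁ := (m + d) % n₀ with hn₁
  set k₁ : ℤ := k - g * k₀ with hk₁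
  have hdiv : n₀ * g + n₁ = m + d := Nat.div_add_mod (m + d) n₀
  have hdivR : (n₀ : ℝ) * g + n₁ = m + d := by exact_mod_cast hdiv
  have hn₁lt : (n₁ : ℝ) * ld ≤ ℓ :=
    mul_le_mul_of_nonneg_right (by exact_mod_cast (Nat.mod_lt _ hn₀).le) (by linarith)
  have hNg : N = g * ℓ + n₁ * ld := by
    rw [hN, hℓ]; push_cast; rw [← hdivR]; ring
  have hn₁0 : 0 ≤ (n₁ : ℝ) * ld := by positivity
  have hdld : 0 ≤ (d : ℝ) * ld := by positivity
  have hℓ0 : 48 / 100 ≤ ℓ := by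
    have h1 : (1 : ℝ) ≤ n₀ := by exact_mod_cast hn₀
    have := mul_le_mul_of_nonneg_right h1 (by linarith : 0 ≤ ld)
    linarith
  have hc0 : c ≠ 0 := fun h0 => by
    have := Z.eq_zero_of_ℓ_eq_zero h (ν := ![k₀, n₀, 0]) (by
      rw [ℓ_apply]
      simp only [Matrix.cons_val]
      push_cast
      linarith)
    simp only [Matrix.cons_val] at this
    omega
  have hN₁' : 33 / 100 * 10 ^ 20 * T ≤ N := by
    have : 33 / 100 * T ≤ T ^ 2 := by
      rw [sq]; exact mul_le_mul_of_nonneg_right hT0 (by linarith)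
    linarith
  have hTH : 33 / 100 * H ≤ T * (d * ld + 4 * H) := mul_le_mul hT0 (by linarith) (by linarith)
    (by linarith)
  set w := N / (105000 * ℓ) with hw
  have hNw : N = 105000 * w * ℓ := by rw [hw]; field_simp
  have hw0 : 0 ≤ w := by rw [hw]; exact div_nonneg (by linarith) (by linarith)
  have hℓT' : ℓ ≤ 5 * 10 ^ 6 * T := by rw [hT]; exact hℓT
  have hNT : N ≤ 525 * 10 ^ 9 * (T * w) := by
    have := mul_le_mul_of_nonneg_left hℓT' hw0
    rw [hNw]; linarith
  have hEw : 2 * 10 ^ 12 * (d * ld + 4 * H) ≤ 525 * 10 ^ 9 * w :=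
    le_of_mul_le_mul_left (by linarith) (by linarith : 0 < T)
  have hTw : 10 ^ 20 * T ≤ 525 * 10 ^ 9 * w :=
    le_of_mul_le_mul_left (by rw [sq] at hN₁; linarith) (by linarith : 0 < T)
  have hg : g * ℓ ≤ N := by linarith
  have hgw : g ≤ 105000 * w := le_of_mul_le_mul_right (hg.trans hNw.le) (by linarith)
  have hgc : g * |c| ≤ 21 / 1000 * w := by
    have := mul_le_mul hgw hc (abs_nonneg _) (by linarith)
    linarith
  have hΛ1 : |Λ| ≤ 1 := hΛN.trans (Real.exp_le_one_iff.2 (by linarith))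
  have hγ : -(Real.log (a * √Δ) - Real.log (b - 1) - v + d * ld + k₁ * lb - n₁ * ld) =
      g * c - Λ := by
    rw [hΛ, hcdef, hk₁, hℓ]
    push_cast
    linear_combination ld * hdivR
  have hk₁abs : |(k₁ : ℝ)| * lb ≤ g * |c| + H / 2 + 2 + ℓ := by
    have h0 : |(k₁ : ℝ)| * lb = |k₁ * lb| := by rw [abs_mul, abs_of_pos (by linarith : 0 < lb)]
    rw [h0]
    have h1 : g * c ≤ g * |c| := mul_le_mul_of_nonneg_left (le_abs_self _) (Nat.cast_nonneg _)
    have h2 : g * -c ≤ g * |c| := mul_le_mul_of_nonneg_left (neg_le_abs _) (Nat.cast_nonneg _)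
    obtain ⟨h3, h4⟩ := abs_le.1 hΛ1
    rw [abs_le]
    constructor <;> linarith
  have hpm := toNat_sub_toNat_neg_cast k₁
  have hpp := toNat_add_toNat_neg_cast k₁
  have hk₁p : ((k₁.toNat : ℕ) : ℝ) * lb ≤ |(k₁ : ℝ)| * lb :=
    mul_le_mul_of_nonneg_right (by
      linarith [Nat.cast_nonneg (α := ℝ) (-k₁).toNat]) (by linarith)
  have hk₁m : (((-k₁).toNat : ℕ) : ℝ) * lb ≤ |(k₁ : ℝ)| * lb :=
    mul_le_mul_of_nonneg_right (by
      linarith [Nat.cast_nonneg (α := ℝ) k₁.toNat]) (by linarith)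
  have hexp : ∀ i : ℕ, (b : ℝ) ^ i = Real.exp (i * lb) := fun i => by
    rw [Real.exp_nat_mul, Real.exp_log (by linarith)]
  have hβ : Z.φ₁ ((b - 1) * (Z.w ^ d - 1) * b ^ (-k₁).toNat * Z.w ^ n₁) =
      ((b : ℝ) - 1) * (δ ^ d - 1) * b ^ (-k₁).toNat * δ ^ n₁ := by
    simp [Z.map₁_w]
  have hβ' : Z.φ₁ (a * Z.q * b ^ k₁.toNat * Z.w ^ d) = a * √Δ * b ^ k₁.toNat * δ ^ d := by
    simp [Z.map₁_w, Z.map₁_q]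
  have hα : Z.φ₁ ((b : O) ^ k₀) = (b : ℝ) ^ k₀ := by simp
  have hα' : Z.φ₁ (Z.w ^ n₀) = δ ^ n₀ := by simp [Z.map₁_w]
  have hlogβ : Real.log (((b : ℝ) - 1) * (δ ^ d - 1) * b ^ (-k₁).toNat * δ ^ n₁) =
      Real.log (b - 1) + v + (-k₁).toNat * lb + n₁ * ld := by
    rw [Real.log_mul (by positivity) (by positivity), Real.log_mul (by positivity) (by positivity),
      Real.log_mul (by positivity) (by positivity), Real.log_pow, Real.log_pow]
  have hlogβ' : Real.log (a * √Δ * b ^ k₁.toNat * δ ^ d) =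
      Real.log (a * √Δ) + k₁.toNat * lb + d * ld := by
    rw [Real.log_mul (by positivity) (by positivity), Real.log_mul (by positivity) (by positivity),
      Real.log_pow, Real.log_pow]
  have hw₁ := Z.abs_map₂_w_pow_le h
  refine two_log_box_false Z.φ₁ Z.φ₂ Z.one_le (g := g) (α := (b : O) ^ k₀) (α' := Z.w ^ n₀)
    (β := (b - 1) * (Z.w ^ d - 1) * b ^ (-k₁).toNat * Z.w ^ n₁)
    (β' := a * Z.q * b ^ k₁.toNat * Z.w ^ d) (c := c) (Λ := Λ) (p₁ := ℓ) (p₂ := ℓ + |c|)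
    (q₁ := H / 2 + d * ld + |(k₁ : ℝ)| * lb) (q₂ := H + |(k₁ : ℝ)| * lb) (ℓ := ℓ) (N := N)
    (by rw [hα]; positivity) (by rw [hα']; positivity) (by rw [hβ]; positivity)
    (by rw [hβ']; positivity) hc0 ?_ ?_ (by linarith) (by positivity) (by positivity)
    (by positivity) ?_ ?_ ?_ ?_ ?_ ?_ hℓ0 (by linarith) hg (by linarith) ?_ ?_ ?_
  · rw [hα, hα', Real.log_pow, Real.log_pow]
  · rw [hβ, hβ', hlogβ, hlogβ', ← hγ, ← hpm]
    ring
  · rw [hα', Real.log_pow]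
  · rw [hβ', hlogβ']
    linarith
  · rw [map_pow, map_intCast, abs_of_nonneg (by positivity), hexp, Real.exp_le_exp]
    linarith [le_abs_self c]
  · rw [map_pow]
    exact (hw₁ n₀).trans (Real.one_le_exp (by positivity))
  · have h1 : |Z.φ₂ Z.w ^ d - 1| ≤ b := by
      obtain ⟨h2, h3⟩ := abs_le.1 (hw₁ d)
      rw [abs_le]
      constructor <;> linarith
    simp only [map_mul, map_pow, map_sub, map_one, map_intCast, abs_mul, abs_pow,
      abs_of_pos (by linarith : 0 < (b : ℝ)), abs_of_pos hb1]
    have h2 := hw₁ n₁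
    rw [abs_pow] at h2
    calc ((b : ℝ) - 1) * |Z.φ₂ Z.w ^ d - 1| * b ^ (-k₁).toNat * |Z.φ₂ Z.w| ^ n₁
        ≤ b * b * b ^ (-k₁).toNat * 1 := by
          gcongr
          linarith
      _ = Real.exp (lb + lb + (-k₁).toNat * lb) := by
          rw [Real.exp_add, Real.exp_add, ← hexp, Real.exp_log (by linarith), mul_one]
      _ ≤ _ := Real.exp_le_exp.2 (by linarith)
  · simp only [map_mul, map_pow, map_intCast, abs_mul, abs_pow, Z.map₂_q,
      abs_of_pos (by linarith : 0 < (b : ℝ)), abs_of_pos (by linarith : 0 < (a : ℝ))]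
    have h2 := hw₁ d
    rw [abs_pow] at h2
    calc a * √Δ * b ^ k₁.toNat * |Z.φ₂ Z.w| ^ d ≤ a * √Δ * b ^ k₁.toNat * 1 := by gcongr
      _ = Real.exp (Real.log (a * √Δ) + k₁.toNat * lb) := by
          rw [Real.exp_add, ← hexp, Real.exp_log haq, mul_one]
      _ ≤ _ := Real.exp_le_exp.2 (by linarith)
  · exact hΛN.trans (Real.exp_le_exp.2 (by linarith))
  · linarith
  · linarith

end QuadraticUnit

end InterpolationDet

namespace InterpolationDet

theorem abs_log_one_add_le {t : ℝ} (ht : |t| ≤ 1 / 2) : |Real.log (1 + t)| ≤ 2 * |t| := by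
  obtain ⟨h1, h2⟩ := abs_le.1 ht
  have h3 := Real.log_le_sub_one_of_pos (by linarith : 0 < 1 + t)
  have h4 := Real.one_sub_inv_le_log_of_pos (by linarith : 0 < 1 + t)
  have h5 : -(2 * |t|) ≤ 1 - (1 + t)⁻¹ := by
    have h6 : 1 - (1 + t)⁻¹ = t / (1 + t) := by
      rw [eq_div_iff (by linarith), sub_mul, inv_mul_cancel₀ (by linarith)]
      ring
    rw [h6, le_div_iff₀ (by linarith)]
    have h7 := mul_nonneg (abs_nonneg t) (by linarith : 0 ≤ 1 / 2 + t)
    linarith [neg_abs_le t]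
  rw [abs_le]
  constructor <;> linarith [le_abs_self t, abs_nonneg t]

namespace QuadraticUnit

variable {O : Type*} [CommRing O] {δ Δ : ℝ} (Z : QuadraticUnit O δ Δ) {a b : ℤ}

namespace Data

theorem log_form_add (h : Data δ Δ a b) {k m d : ℕ} (hd : 1 ≤ d) {H N Λ : ℝ}
    (hH : H = 2 * Real.log b + Real.log Δ) (hN : N = (m + d : ℕ) * Real.log δ)
    (hΛ : Λ = Real.log (a * √Δ) - Real.log (b - 1) + k * Real.log b - Real.log (δ ^ d - 1) -
      m * Real.log δ)
    (hx : |a * √Δ / (b - 1) * b ^ k - δ ^ m * (δ ^ d - 1)| ≤ √Δ + 2) (hHN : 3 + H ≤ N) :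
    |Λ| ≤ Real.exp (3 + H - N) := by
  obtain ⟨hy, hv, -⟩ := h.log_pow_sub_one hd
  have hlb := h.log_b
  have hδ : 0 < δ := by linarith [h.hδ0]
  have hb := h.b_real
  have ha := h.a_real
  have hq := h.one_le_sqrt
  have hb1 : 0 < (b : ℝ) - 1 := by linarith
  set x := a * √Δ / (b - 1) * b ^ k with hxdef
  set y := δ ^ m * (δ ^ d - 1) with hydef
  have hx0 : 0 < x := by positivity
  have hy0 : 0 < y := by positivity
  have hΛx : Λ = Real.log x - Real.log y := by
    rw [hΛ, hxdef, hydef, Real.log_mul (x := a * √Δ / (b - 1)) (by positivity) (by positivity),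
      Real.log_div (by positivity) (by positivity),
      Real.log_mul (x := δ ^ m) (by positivity) hy.ne',
      Real.log_pow, Real.log_pow]
    ring
  have hyN : Real.exp (N - 1) ≤ y := by
    rw [← Real.le_log_iff_exp_le hy0, hydef, Real.log_mul (by positivity) (by positivity),
      Real.log_pow, hN]
    push_cast
    linarith
  have hsqrt : √Δ + 2 ≤ Real.exp 1 * Real.exp H / 2 := by
    have h1 : √Δ ≤ Real.exp (H - 1) := by
      rw [← Real.log_le_iff_le_exp (by linarith), h.log_sqrt]
      linarith [h.log_Δ]
    have h2 : Real.exp H = Real.exp 1 * Real.exp (H - 1) := by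
      rw [← Real.exp_add]; ring_nf
    have h3 : (7 : ℝ) ≤ Real.exp 1 * Real.exp 1 := by
      calc (7 : ℝ) ≤ 2.7 * 2.7 := by norm_num
        _ ≤ _ := mul_le_mul (by linarith [Real.exp_one_gt_d9]) (by linarith [Real.exp_one_gt_d9])
          (by norm_num) (Real.exp_pos _).le
    have h4 := mul_le_mul_of_nonneg_right h3 (Real.exp_pos (H - 1)).le
    rw [h2]
    linarith
  have ht : |(x - y) / y| ≤ Real.exp (3 + H - N) / 2 := by
    rw [abs_div, abs_of_pos hy0, div_le_iff₀ hy0]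
    have h1 : Real.exp 1 * Real.exp H ≤ Real.exp (3 + H - N) * Real.exp (N - 1) := by
      rw [← Real.exp_add, ← Real.exp_add]
      exact Real.exp_le_exp.2 (by linarith)
    have h2 := mul_le_mul_of_nonneg_left hyN (Real.exp_pos (3 + H - N)).le
    linarith
  have hone : Real.exp (3 + H - N) ≤ 1 := Real.exp_le_one_iff.2 (by linarith)
  have key := abs_log_one_add_le (ht.trans (by linarith))
  have hxy : 1 + (x - y) / y = x / y := by field_simp; ring
  rw [hxy, Real.log_div hx0.ne' hy0.ne'] at key
  rw [hΛx]
  linarith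

theorem abs_log_pow_sub_one_sub_le (h : Data δ Δ a b) {d : ℕ} (hd : 1 ≤ d) :
    |Real.log (δ ^ d - 1) - d * Real.log δ| ≤ Real.exp (1 - d * Real.log δ) := by
  obtain ⟨hy, hv, hv'⟩ := h.log_pow_sub_one hd
  have hδ : 0 < δ := by linarith [h.hδ0]
  rw [abs_of_nonpos (by linarith), neg_sub, ← Real.log_pow, ← Real.log_div (by positivity) hy.ne']
  have h1 : δ ^ d / (δ ^ d - 1) - 1 = (δ ^ d - 1)⁻¹ := by field_simp; ring
  refine (Real.log_le_sub_one_of_pos (by positivity)).trans ?_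
  rw [h1, Real.log_pow, ← neg_sub (d * Real.log δ) 1, Real.exp_neg]
  exact inv_anti₀ (Real.exp_pos _) ((Real.le_log_iff_exp_le hy).1 hv)

end Data

theorem mul_log_lt (Z : QuadraticUnit O δ Δ) (h : Data δ Δ a b) {k m d : ℕ}
    (hd : 1 ≤ d) {D L T H N : ℝ}
    (hT : T = Real.log b * Real.log δ) (hH : H = 2 * Real.log b + Real.log Δ)
    (hN : N = (m + d : ℕ) * Real.log δ)
    (hx : |a * √Δ / (b - 1) * b ^ k - δ ^ m * (δ ^ d - 1)| ≤ √Δ + 2)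
    (hD : D = 1 + (m + d : ℕ) * Real.log δ / Real.log b) (hL : L = 1 + Real.log D)
    (hL50 : 50 ≤ L) : N < 10 ^ 24 * L ^ 2 * T ^ 2 * H := by
  by_contra! hcon
  have hlb := h.log_b
  have hld := h.hδ
  have hlΔ := h.log_Δ
  have hT0 : 33 / 100 ≤ T := by
    have := mul_le_mul hlb hld (by norm_num) (by linarith)
    rw [hT]; linarith
  have hH0 : 276 / 100 ≤ H := by linarith
  have hL2 : 2500 ≤ L ^ 2 := by
    calc (2500 : ℝ) = 50 ^ 2 := by norm_num
      _ ≤ _ := pow_le_pow_left₀ (by norm_num) hL50 2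
  have hLT : 825 ≤ L ^ 2 * T := by
    have := mul_le_mul hL2 hT0 (by norm_num) (by linarith)
    linarith
  set X := L ^ 2 * T * H with hX
  have hXH : 825 * H ≤ X := mul_le_mul_of_nonneg_right hLT (by linarith)
  have hTX : 10 ^ 24 * L ^ 2 * T ^ 2 * H = 10 ^ 24 * (T * X) := by rw [hX]; ring
  have hTX1 : 33 / 100 * X ≤ T * X := mul_le_mul_of_nonneg_right hT0 (by linarith)
  have hTX2 : 10 ^ 20 * T ^ 2 ≤ N := by
    have h1 : 1 ≤ L ^ 2 * H := by
      have := mul_le_mul hL2 hH0 (by norm_num) (by linarith)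
      linarith
    have h2 := mul_le_mul_of_nonneg_left h1 (sq_nonneg T)
    have h3 : T * X = T ^ 2 * (L ^ 2 * H) := by rw [hX]; ring
    linarith
  have hHN : 3 + H ≤ N := by linarith
  set Λ := Real.log (a * √Δ) - Real.log (b - 1) + k * Real.log b - Real.log (δ ^ d - 1) -
      m * Real.log δ with hΛ
  have hΛN := h.log_form_add hd hH hN hΛ hx hHN
  refine Z.two_log_false h hd hT hH hN hΛ hTX2 ?_ hΛN
  have hv := h.abs_log_pow_sub_one_sub_le hd
  have hE : d * Real.log δ ≤ 131 * 10 ^ 9 * X + 4 + H := by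
    have h1 := Z.one_lt_exp_mul_abs h hD hL hL50 (by rw [← hN, ← hT, ← hH]; linarith)
      (k := k) (Λ := Λ + (Real.log (δ ^ d - 1) - d * Real.log δ)) (by
        rw [hΛ]; push_cast; ring)
    by_contra! hcon'
    have hdN : d * Real.log δ ≤ N := by
      have : 0 ≤ (m : ℝ) * Real.log δ := by positivity
      rw [hN]; push_cast; linarith
    have h2 : |Λ + (Real.log (δ ^ d - 1) - d * Real.log δ)| ≤
        Real.exp (4 + H - d * Real.log δ) := by
      refine (abs_add_le _ _).trans ?_
      have h3 : Real.exp (3 + H - N) ≤ Real.exp (3 + H - d * Real.log δ) :=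
        Real.exp_le_exp.2 (by linarith)
      have h4 : Real.exp (1 - d * Real.log δ) ≤ Real.exp (3 + H - d * Real.log δ) :=
        Real.exp_le_exp.2 (by linarith)
      have h5 : Real.exp (4 + H - d * Real.log δ) =
          Real.exp 1 * Real.exp (3 + H - d * Real.log δ) := by
        rw [← Real.exp_add]; ring_nf
      have h6 := mul_le_mul_of_nonneg_right Real.exp_one_gt_d9.le
        (Real.exp_pos (3 + H - d * Real.log δ)).le
      have h7 := Real.exp_pos (3 + H - d * Real.log δ)
      rw [h5]
      linarith
    have h8 := h1.trans_le (mul_le_mul_of_nonneg_left h2 (Real.exp_pos _).le)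
    rw [← Real.exp_add, Real.one_lt_exp_iff, ← hT, ← hH] at h8
    have h9 : L ^ 2 * (T * H) = X := by rw [hX]; ring
    rw [mul_assoc (131 * 10 ^ 9), h9] at h8
    linarith
  have h10 := mul_le_mul_of_nonneg_left (by linarith : d * Real.log δ + 4 * H ≤ 132 * 10 ^ 9 * X)
    (by linarith : 0 ≤ T)
  linarith

end QuadraticUnit

end InterpolationDet

namespace InterpolationDet

theorem le_log_of_golden_le {δ : ℝ} (hδ : 1.618 ≤ δ) : 48 / 100 ≤ Real.log δ := by
  have h1 : Real.exp 12 ≤ 1.618 ^ 25 := by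
    rw [show (12 : ℝ) = (12 : ℕ) * 1 by norm_num, Real.exp_nat_mul]
    calc Real.exp 1 ^ 12 ≤ 2.7182818286 ^ 12 :=
          pow_le_pow_left₀ (Real.exp_pos _).le Real.exp_one_lt_d9.le 12
      _ ≤ _ := by norm_num
  rw [← Real.le_log_iff_exp_le (by norm_num), Real.log_pow] at h1
  have h2 := Real.log_le_log (by norm_num) hδ
  push_cast at h1
  linarith

theorem log_ge_of_le {x : ℝ} (hx : 10 ^ 24 ≤ x) : 49 ≤ Real.log x := by
  rw [Real.le_log_iff_exp_le (by linarith), show (49 : ℝ) = (49 : ℕ) * 1 by norm_num,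
    Real.exp_nat_mul]
  calc Real.exp 1 ^ 49 ≤ 2.7182818286 ^ 49 :=
        pow_le_pow_left₀ (Real.exp_pos _).le Real.exp_one_lt_d9.le 49
    _ ≤ 10 ^ 24 := by norm_num
    _ ≤ x := hx

theorem five_le_discr {r s : ℤ} (hr : 1 ≤ r) (hs : s = -1 ∨ s = 1)
    (hΔ : 0 < r ^ 2 + 4 * s) (hns : ¬ IsSquare (r ^ 2 + 4 * s)) : 5 ≤ r ^ 2 + 4 * s := by
  rcases hs with rfl | rfl
  · have h3 : 3 ≤ r := by
      by_contra! h
      interval_cases r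
      · omega
      · omega
    nlinarith
  · nlinarith

theorem binet {r s : ℤ} {U : ℕ → ℤ} (hU0 : U 0 = 0) (hU1 : U 1 = 1)
    (hUrec : ∀ n : ℕ, U (n + 2) = r * U (n + 1) + s * U n) {x y : ℝ} (hsum : x + y = r)
    (hprod : x * y = -s) (n : ℕ) : U n * (x - y) = x ^ n - y ^ n := by
  induction n using Nat.twoStepInduction with
  | zero => simp [hU0]
  | one => simp [hU1]
  | more n ih₁ ih₂ =>
    rw [hUrec]
    push_cast
    linear_combination (r : ℝ) * ih₂ + (s : ℝ) * ih₁ - (x ^ (n + 1) - y ^ (n + 1)) * hsum +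
      (x ^ n - y ^ n) * hprod

end InterpolationDet

/-- The main bound on `n` from Matveev's theorem. -/
theorem repdigit_diff_lucas_bound_on_n
    (r s : ℤ) (hr : 1 ≤ r) (hs : s = -1 ∨ s = 1)
    (hΔ : (0 : ℤ) < r ^ 2 + 4 * s) (hΔns : ¬ IsSquare (r ^ 2 + 4 * s))
    (U : ℕ → ℤ) (hU0 : U 0 = 0) (hU1 : U 1 = 1)
    (hUrec : ∀ n : ℕ, U (n + 2) = r * U (n + 1) + s * U n)
    (δ : ℝ) (hδ : δ = ((r : ℝ) + Real.sqrt ((r : ℝ) ^ 2 + 4 * (s : ℝ))) / 2)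
    (b : ℤ) (hb : 2 ≤ b)
    (k m n : ℕ) (hk : 1 ≤ k) (hm : 1 ≤ m) (hn : 1 ≤ n) (hnm : m < n)
    (a : ℤ) (ha1 : 1 ≤ a) (ha2 : a ≤ b - 1)
    (heq : a * (b ^ k - 1) = (U n - U m) * (b - 1))
    (D : ℝ) (hD : D = 1 + (n : ℝ) * Real.log δ / Real.log b)
    (ξ : ℝ)
    (hξ : ξ = Real.log (4 * (b : ℝ) ^ 2 * ((r : ℝ) ^ 2 + 4 * s) *
          (1 + 3 * Real.sqrt ((r : ℝ) ^ 2 + 4 * s))) +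
        2 * 10 ^ 12 * (1 + Real.log D) * Real.log δ * Real.log b *
          (2 * Real.log b + Real.log ((r : ℝ) ^ 2 + 4 * s))) :
    (n : ℝ) * Real.log δ - Real.log (8.1 * Real.sqrt ((r : ℝ) ^ 2 + 4 * s)) <
      2 * 10 ^ 12 * (1 + Real.log D) * Real.log δ * Real.log b * ξ := by
  have Z := InterpolationDet.quadraticUnit hr hs hΔ hΔns
  have hΔ5 : (5 : ℝ) ≤ (r : ℝ) ^ 2 + 4 * s := by
    exact_mod_cast InterpolationDet.five_le_discr hr hs hΔ hΔns
  rw [← hδ] at Z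
  set Δ : ℝ := (r : ℝ) ^ 2 + 4 * s with hΔdef
  have hr' : (1 : ℝ) ≤ r := by exact_mod_cast hr
  have hsq : √Δ * √Δ = Δ := Real.mul_self_sqrt (by linarith)
  have hq : 2.236 ≤ √Δ := Real.le_sqrt_of_sq_le (by norm_num; linarith)
  have hδ1 : 1.618 ≤ δ := by rw [hδ]; linarith
  have h : InterpolationDet.QuadraticUnit.Data δ Δ a b :=
    ⟨InterpolationDet.le_log_of_golden_le hδ1, by linarith, hΔ5, hb, ha1, ha2⟩
  obtain ⟨d, rfl⟩ := Nat.exists_eq_add_of_lt hnm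
  have hlb := h.log_b
  have hld := h.hδ
  have hlΔ := h.log_Δ
  have hbR := h.b_real
  have haR := h.a_real
  have habR := h.ab_real
  have hs1 : |(s : ℝ)| = 1 := by rcases hs with rfl | rfl <;> norm_num
  set δ' : ℝ := (r - √Δ) / 2 with hδ'
  have hprod : δ * δ' = -s := by rw [hδ, hδ']; linear_combination -hsq / 4
  have hδ'1 : |δ'| ≤ 1 := by
    have h1 : δ * |δ'| = 1 := by
      rw [← abs_of_pos (by linarith : 0 < δ), ← abs_mul, hprod, abs_neg, hs1]
    by_contra! h2
    have := mul_lt_mul_of_pos_left h2 (by linarith : 0 < δ)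
    linarith
  have hbinet := InterpolationDet.binet hU0 hU1 hUrec (x := δ) (y := δ')
    (by rw [hδ, hδ']; ring) hprod
  have hdiff : δ - δ' = √Δ := by rw [hδ, hδ']; ring
  rw [hdiff] at hbinet
  have hpow : ∀ i, |δ' ^ i| ≤ 1 := fun i => by
    rw [abs_pow]; exact pow_le_one₀ (abs_nonneg _) hδ'1
  have hx : |a * √Δ / (b - 1) * b ^ k - δ ^ m * (δ ^ (d + 1) - 1)| ≤ √Δ + 2 := by
    have hb1 : 0 < (b : ℝ) - 1 := by linarith
    have heqR : (a : ℝ) * (b ^ k - 1) = (U (m + d + 1) - U m) * (b - 1) := by exact_mod_cast heq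
    have h1 : a * √Δ / (b - 1) * b ^ k - δ ^ m * (δ ^ (d + 1) - 1) =
        a * √Δ / (b - 1) - δ' ^ (m + d + 1) + δ' ^ m := by
      have h2 : a * √Δ / (b - 1) * b ^ k - a * √Δ / (b - 1) = (U (m + d + 1) - U m) * √Δ := by
        rw [div_mul_eq_mul_div, ← sub_div, div_eq_iff hb1.ne']
        linear_combination √Δ * heqR
      linear_combination h2 + hbinet (m + d + 1) - hbinet m
    have h3 : a * √Δ / (b - 1) ≤ √Δ := by
      rw [div_le_iff₀ hb1, mul_comm]
      exact mul_le_mul_of_nonneg_left habR (Real.sqrt_nonneg _)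
    have h4 : 0 ≤ a * √Δ / (b - 1) := by positivity
    obtain ⟨h5, h6⟩ := abs_le.1 (hpow (m + d + 1))
    obtain ⟨h7, h8⟩ := abs_le.1 (hpow m)
    rw [h1, abs_le]
    constructor <;> linarith
  by_contra! hcon
  set L := 1 + Real.log D with hL
  set T := Real.log b * Real.log δ with hT
  set H := 2 * Real.log b + Real.log Δ with hH
  set N := ((m + d + 1 : ℕ) : ℝ) * Real.log δ with hN
  have hT0 : 33 / 100 ≤ T := by
    have := mul_le_mul hlb hld (by norm_num) (by linarith)
    linarith
  have hN0 : 0 ≤ N := by positivity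
  have hD1 : 1 ≤ D := by
    have : 0 ≤ N / Real.log b := by positivity
    linarith
  have hL1 : 1 ≤ L := by linarith [Real.log_nonneg hD1]
  have hlog₁ : 0 ≤ Real.log (8.1 * √Δ) := Real.log_nonneg (by linarith)
  have hlog₂ : 0 ≤ Real.log (4 * (b : ℝ) ^ 2 * Δ * (1 + 3 * √Δ)) := by
    refine Real.log_nonneg ?_
    have h1 : (1 : ℝ) ≤ 4 * (b : ℝ) ^ 2 := by nlinarith
    exact one_le_mul_of_one_le_of_one_le
      (one_le_mul_of_one_le_of_one_le h1 (by linarith)) (by linarith)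
  have hξT : 2 * 10 ^ 12 * (L * T * H) ≤ ξ := by
    rw [hξ, hT]; linarith
  have hNbig : 4 * 10 ^ 24 * L ^ 2 * T ^ 2 * H ≤ N := by
    have h1 := mul_le_mul_of_nonneg_left hξT (by positivity : 0 ≤ 2 * 10 ^ 12 * (L * T))
    have h2 : 2 * 10 ^ 12 * (L * T) * (2 * 10 ^ 12 * (L * T * H)) =
      4 * 10 ^ 24 * L ^ 2 * T ^ 2 * H := by ring
    have h3 : 2 * 10 ^ 12 * L * Real.log δ * Real.log b * ξ = 2 * 10 ^ 12 * (L * T) * ξ := by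
      rw [hT]; ring
    linarith
  have hL50 : 50 ≤ L := by
    have h1 : 10 ^ 24 * Real.log b ≤ N := by
      have h2 : 1 ≤ 4 * T * (Real.log δ * H) := by
        have h3 := mul_le_mul hld (by linarith : 276 / 100 ≤ H) (by norm_num) (by linarith)
        have h4 := mul_le_mul hT0 h3 (by norm_num) (by linarith)
        linarith
      have h5 : 1 ≤ L ^ 2 := one_le_pow₀ hL1
      have h6 := one_le_mul_of_one_le_of_one_le h5 h2
      have h7 := mul_le_mul_of_nonneg_left h6 (by linarith : 0 ≤ Real.log b)
      have h8 : Real.log b * (L ^ 2 * (4 * T * (Real.log δ * H))) = 4 * L ^ 2 * T ^ 2 * H := by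
        rw [hT]; ring
      linarith
    have h9 : 10 ^ 24 ≤ N / Real.log b := (le_div_iff₀ (by linarith)).2 h1
    linarith [InterpolationDet.log_ge_of_le (by linarith : 10 ^ 24 ≤ D)]
  have := Z.mul_log_lt h (k := k) (m := m) (d := d + 1) (by omega) hT hH rfl hx hD hL hL50
  have h0 : 0 ≤ 10 ^ 24 * L ^ 2 * T ^ 2 * H := by positivity
  rw [← add_assoc, ← hN] at this
  linarith
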